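/- Let c₁, …, c₈ > 0 be reals with c₃ > 1, c₅ > 3, c₆ > 1 and 1/8 > c₈ + c₇·(log 2)/2 + 1/c₁ + c₂·c₄/2, and fix a real 0 < c_L < 1/2. Then there exists a constant A > 0, depending only on c₁,…,c₈ and c_L, such that the following holds. Let (X,P) be a prebox with s₁ > A that is Siegel-free above some real t with s₁ > t > A (with respect to c_L). Let 𝓜_r ⊆ M_r, 𝓜_{r,P} ⊆ M_{r,P}, and a : 𝓜_r ⊔ 𝓜_{r,P} → F₂. Suppose 1 ≤ k ≤ r is an integer such that every (i,p) ∈ 𝓜_{r,P} has i > k, and such that for every i > k, X_i = {p prime : p ∈ (s_i, t_i], p ≡ 1 (mod 4), and (p/p') = ι(a(i,p')) for all (i,p') ∈ 𝓜_{r,P}}. Assume moreover: (i) |P| ≤ log t_i − i for all i ∈ [r]; (ii) t₁ > r^{c₁} and t_k < exp(t₁^{c₂}); (iii) |X_i| ≥ 2^{c₃·i}·t_i/(log t_i)^{c₄} for all i ∈ [r]; (iv) if k ≠ r then t_{k+1} > max(exp((log t₁)^{c₅}), exp(t^{c₆})); (v) k ≤ ⌈c₇·log t₁⌉, and for all i ≤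 r and all j with i + c₇·log t_i ≤ j ≤ r, t_j > exp((log t_i)^{c₅}). Then | |X(a)| − |X|/2^{|𝓜_r|} | ≤ r·|X| / (t₁^{c₈+1/c₁}·2^{|𝓜_r|}) ≤ |X| / (t₁^{c₈}·2^{|𝓜_r|}). -/

import Mathlib

open scoped Classical

/-- `ι : F₂ ≃ {±1}`. -/
def iotaSign (e : ZMod 2) : ℤ := if e = 0 then 1 else -1

/-- The index set `M_r = {(i,j) : 1 ≤ i < j ≤ r}`, encoded with `0`-based
`Fin r` indices (index `i : Fin r` stands for the paper's `i + 1`). -/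
abbrev MrIdx (r : ℕ) : Type := {q : Fin r × Fin r // q.1 < q.2}

/-- The index set `M_{r,P} = [r] × P`. -/
abbrev MrPIdx (r : ℕ) (P : Finset ℕ) : Type := Fin r × {p : ℕ // p ∈ P}

/-- A prebox `(X, P)` (see `Prebox` docstring in the paper): pairwise disjoint finite sets
`P, X₁, …, X_r` of primes `≡ 1, 2 (mod 4)`, `Xᵢ ⊆ (sᵢ, tᵢ]`, `P ⊆ (1, s₁]`,
`2 < s₁ < t₁ < s₂ < ⋯`. -/
structure Prebox (r : ℕ) where
  X : ℕ → Finset ℕ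
  P : Finset ℕ
  s : ℕ → ℝ
  t : ℕ → ℝ
  prime_X : ∀ i ∈ Finset.Icc 1 r, ∀ p ∈ X i, p.Prime ∧ (p % 4 = 1 ∨ p % 4 = 2)
  prime_P : ∀ p ∈ P, p.Prime ∧ (p % 4 = 1 ∨ p % 4 = 2)
  disj_X : ∀ i ∈ Finset.Icc 1 r, ∀ j ∈ Finset.Icc 1 r, i ≠ j → Disjoint (X i) (X j)
  disj_XP : ∀ i ∈ Finset.Icc 1 r, Disjoint (X i) P
  two_lt_s : 1 ≤ r → (2 : ℝ) < s 1
  s_lt_t : ∀ i ∈ Finset.Icc 1 r, s i < t i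
  t_lt_s : ∀ i ∈ Finset.Icc 1 r, ∀ j ∈ Finset.Icc 1 r, i < j → t i < s j
  X_sub : ∀ i ∈ Finset.Icc 1 r, ∀ p ∈ X i, s i < (p : ℝ) ∧ (p : ℝ) ≤ t i
  P_sub : ∀ p ∈ P, (1 : ℝ) < (p : ℝ) ∧ (1 ≤ r → (p : ℝ) ≤ s 1)

/-- The set `X(a)` determined by Legendre-symbol conditions on the subsets
`𝓜r ⊆ M_r`, `𝓜rP ⊆ M_{r,P}` (with data `a`), as a subtype of points of the prebox. -/
def preboxPoints {r : ℕ} (B : Prebox r) (𝓜r : Set (MrIdx r)) (𝓜rP : Set (MrPIdx r B.P))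
    (a : MrIdx r ⊕ MrPIdx r B.P → ZMod 2) : Set (Fin r → ℕ) :=
  {x | (∀ i : Fin r, x i ∈ B.X ((i : ℕ) + 1)) ∧
    (∀ q ∈ 𝓜r, jacobiSym (x q.1.1) (x q.1.2) = iotaSign (a (Sum.inl q))) ∧
    (∀ q ∈ 𝓜rP, jacobiSym (x q.1) (q.2 : ℕ) = iotaSign (a (Sum.inr q)))}

/-- The set `𝒮(c)` of exceptional (Siegel) squarefree integers `d`: those for which the
`L`-function of the primitive quadratic character `χ_d` attached to `ℚ(√d)` (characterized
by its values `χ_d(p) = (d/p)` at odd primes `p ∤ d`) has a real zero `s` with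
`1 − c/log(|d|+4) ≤ s ≤ 1`. -/
def SiegelSet (c : ℝ) : Set ℤ :=
  {d | Squarefree d ∧ d ≠ 0 ∧ d ≠ 1 ∧
    ∃ (n : ℕ) (hn : n ≠ 0) (χ : DirichletCharacter ℂ n), χ.IsPrimitive ∧
      (∀ p : ℕ, (hp : p.Prime) → p ≠ 2 → ¬ ((p : ℤ) ∣ d) →
        χ (p : ZMod n) = ((@legendreSym p ⟨hp⟩ d : ℤ) : ℂ)) ∧
      ∃ β : ℝ, 1 - c / Real.log (|(d : ℝ)| + 4) ≤ β ∧ β ≤ 1 ∧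
        (letI : NeZero n := ⟨hn⟩; DirichletCharacter.LFunction χ (β : ℂ) = 0)}

/-- A prebox is Siegel-free above `t` (w.r.t. `c`) if no `d ∈ 𝒮(c)` with `|d| > t` divides
`x ∏_{p ∈ P} p` for some `x ∈ X`. -/
def SiegelFree {r : ℕ} (B : Prebox r) (c t : ℝ) : Prop :=
  ¬ ∃ d ∈ SiegelSet c, t < |(d : ℝ)| ∧
    ∃ x : Fin r → ℕ, (∀ i : Fin r, x i ∈ B.X ((i : ℕ) + 1)) ∧
      d ∣ ((∏ i : Fin r, (x i : ℤ)) * ∏ p ∈ B.P, (p : ℤ))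

section

/-! ### Part 1: factoring out zeros of entire functions -/

theorem pb_dec (R : ℝ) (hR : 0 < R) : ∀ (n : ℕ) (f : ℂ → ℂ) (M : ℝ), Differentiable ℂ f → f 0 ≠ 0 →
    (∀ z, ‖z‖ ≤ R → ‖f z‖ ≤ M * ‖f 0‖) → M < 2 ^ (n + 1) →
    ∃ (s : Multiset ℂ) (g : ℂ → ℂ), Differentiable ℂ g ∧
      (∀ z, f z = (s.map (fun ρ => z - ρ)).prod * g z) ∧
      (∀ ρ ∈ s, ‖ρ‖ ≤ R / 3 ∧ f ρ = 0) ∧ (∀ z, ‖z‖ ≤ R / 3 → g z ≠ 0) ∧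
      (2 : ℝ) ^ (Multiset.card s) ≤ M ∧ ∀ z, ‖z‖ ≤ R → ‖g z‖ ≤ M * ‖g 0‖ := by
  intro n
  induction n with
  | zero =>
    intro f M hf h0 hM hlt
    have hf0 : 0 < ‖f 0‖ := norm_pos_iff.mpr h0
    have h1M : 1 ≤ M := by
      have := hM 0 (by simpa using hR.le)
      nlinarith
    refine ⟨0, f, hf, by simp, by simp, ?_, by simpa using h1M, hM⟩
    intro ρ hρ hz
    have hρ0 : ρ ≠ 0 := by rintro rfl; exact h0 hz
    have key : ∀ z, (z - ρ) * dslope f ρ z = f z := by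
      intro z
      have := sub_smul_dslope f ρ z
      simpa [hz] using this
    have hd : Differentiable ℂ (dslope f ρ) := by
      rw [← differentiableOn_univ]
      exact (Complex.differentiableOn_dslope Filter.univ_mem).2 hf.differentiableOn
    have hb : ∀ z ∈ Metric.closedBall (0:ℂ) R, ‖dslope f ρ z‖ ≤ M * ‖f 0‖ / (2 * R / 3) := by
      intro z hzz
      refine Complex.norm_le_of_forall_mem_frontier_norm_le (U := Metric.ball 0 R)
        Metric.isBounded_ball hd.diffContOnCl ?_ (by rwa [closure_ball _ hR.ne'])
      intro w hw
      rw [frontier_ball _ hR.ne', mem_sphere_zero_iff_norm] at hw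
      have h1 : 2 * R / 3 ≤ ‖w - ρ‖ := by
        have := norm_sub_norm_le w ρ
        rw [hw] at this; linarith
      rw [le_div_iff₀ (by positivity)]
      calc ‖dslope f ρ w‖ * (2 * R / 3) ≤ ‖dslope f ρ w‖ * ‖w - ρ‖ := by gcongr
        _ = ‖f w‖ := by rw [← key w, norm_mul, mul_comm]
        _ ≤ _ := hM w hw.le
    have h2 := hb 0 (by simpa using hR.le)
    rw [le_div_iff₀ (by positivity)] at h2
    have h3 : ‖f 0‖ = ‖ρ‖ * ‖dslope f ρ 0‖ := by rw [← key 0]; simp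
    have h4 : 0 < ‖dslope f ρ 0‖ := by
      rw [norm_pos_iff]; intro h; rw [h] at h3; simp at h3; exact h0 h3
    rw [h3] at h2
    have : ‖dslope f ρ 0‖ * (2 * R / 3) < 2 * ((R/3) * ‖dslope f ρ 0‖) := by
      calc _ ≤ _ := h2
        _ ≤ M * ((R/3) * ‖dslope f ρ 0‖) := by gcongr
        _ < _ := by
          have : 0 < (R/3) * ‖dslope f ρ 0‖ := by positivity
          norm_num at hlt; nlinarith
    nlinarith
  | succ n ih =>
    intro f M hf h0 hM hlt
    have hf0 : 0 < ‖f 0‖ := norm_pos_iff.mpr h0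
    have h1M : 1 ≤ M := by
      have := hM 0 (by simpa using hR.le)
      nlinarith
    by_cases hz : ∀ z, ‖z‖ ≤ R / 3 → f z ≠ 0
    · exact ⟨0, f, hf, by simp, by simp, hz, by simpa using h1M, hM⟩
    push Not at hz
    obtain ⟨ρ, hρ, hz⟩ := hz
    have hρ0 : ρ ≠ 0 := by rintro rfl; exact h0 hz
    have key : ∀ z, (z - ρ) * dslope f ρ z = f z := by
      intro z
      have := sub_smul_dslope f ρ z
      simpa [hz] using this
    have hd : Differentiable ℂ (dslope f ρ) := by
      rw [← differentiableOn_univ]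
      exact (Complex.differentiableOn_dslope Filter.univ_mem).2 hf.differentiableOn
    have h3 : ‖f 0‖ = ‖ρ‖ * ‖dslope f ρ 0‖ := by rw [← key 0]; simp
    have h4 : 0 < ‖dslope f ρ 0‖ := by
      rw [norm_pos_iff]; intro h; rw [h] at h3; simp at h3; exact h0 h3
    have hb : ∀ z, ‖z‖ ≤ R → ‖dslope f ρ z‖ ≤ M / 2 * ‖dslope f ρ 0‖ := by
      intro z hzz
      refine Complex.norm_le_of_forall_mem_frontier_norm_le (U := Metric.ball 0 R)
        Metric.isBounded_ball hd.diffContOnCl ?_ (by rw [closure_ball _ hR.ne']; simpa using hzz)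
      intro w hw
      rw [frontier_ball _ hR.ne', mem_sphere_zero_iff_norm] at hw
      have h1 : 2 * R / 3 ≤ ‖w - ρ‖ := by
        have := norm_sub_norm_le w ρ
        rw [hw] at this; linarith
      have h5 : ‖dslope f ρ w‖ * (2 * R / 3) ≤ M * ((R/3) * ‖dslope f ρ 0‖) :=
        calc ‖dslope f ρ w‖ * (2 * R / 3) ≤ ‖dslope f ρ w‖ * ‖w - ρ‖ := by gcongr
        _ = ‖f w‖ := by rw [← key w, norm_mul, mul_comm]
        _ ≤ M * ‖f 0‖ := hM w hw.le
        _ ≤ _ := by rw [h3]; gcongr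
      have h6 : (‖dslope f ρ w‖) * R ≤ (M / 2 * ‖dslope f ρ 0‖) * R := by linarith
      exact le_of_mul_le_mul_right h6 hR
    obtain ⟨s, g, hg, hfg, hs, hgz, hc, hgb⟩ := ih (dslope f ρ) (M/2) hd (norm_pos_iff.mp h4) hb
      (by rw [pow_succ] at hlt; linarith)
    refine ⟨ρ ::ₘ s, g, hg, ?_, ?_, hgz, ?_, ?_⟩
    · intro z; rw [← key z, hfg z]; simp [mul_assoc]
    · intro w hw
      rcases Multiset.mem_cons.mp hw with rfl | hw
      · exact ⟨hρ, hz⟩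
      · exact ⟨(hs w hw).1, by rw [← key w, (hs w hw).2, mul_zero]⟩
    · simp only [Multiset.card_cons, pow_succ]; linarith
    · intro z hz
      refine (hgb z hz).trans ?_
      gcongr; linarith

theorem pb_logderiv_nonzero (r K : ℝ) (hr : 0 < r) (hK : 0 < K) (g : ℂ → ℂ) (hg : Differentiable ℂ g)
    (hz : ∀ z, ‖z‖ < r → g z ≠ 0) (hb : ∀ z, ‖z‖ < r → ‖g z‖ ≤ Real.exp K * ‖g 0‖)
    (z : ℂ) (hzr : ‖z‖ ≤ r / 4) : ‖deriv g z / g z‖ ≤ 8 * K / r := by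
  have hd : DifferentiableOn ℂ (fun z => deriv g z / g z) (Metric.ball 0 r) := by
    intro w hw
    have h1 : DifferentiableAt ℂ (deriv g) w := hg.analyticAt w |>.deriv.differentiableAt
    exact (h1.div (hg w) (hz w (by simpa using hw))).differentiableWithinAt
  obtain ⟨h, h0, hh⟩ := Complex.IsExactOn.with_val_at hd.isExactOn_ball 0 0
  have h0g : g 0 ≠ 0 := hz 0 (by simpa using hr)
  have hexp : ∀ w ∈ Metric.ball (0:ℂ) r, g w * Complex.exp (- h w) = g 0 := by
    intro w hw
    have hder : ∀ y ∈ Metric.ball (0:ℂ) r,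
        HasDerivAt (fun w => g w * Complex.exp (- h w)) 0 y := by
      intro y hy
      have e1 := (hg y).hasDerivAt.mul ((hh y hy).neg.cexp)
      refine e1.congr_deriv ?_
      have h5 := hz y (by simpa using hy)
      have h6 : g y * (deriv g y / g y) = deriv g y := mul_div_cancel₀ _ h5
      linear_combination (-(Complex.exp ((-h) y))) * h6
    have := (convex_ball (0:ℂ) r).is_const_of_fderivWithin_eq_zero (𝕜 := ℂ)
      (f := fun w => g w * Complex.exp (- h w)) 
      (fun y hy => (hder y hy).differentiableAt.differentiableWithinAt) (by
        intro y hy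
        rw [fderivWithin_of_isOpen Metric.isOpen_ball hy]
        ext
        simp [(hder y hy).hasFDerivAt.fderiv]) hw (Metric.mem_ball_self hr)
    simpa [h0] using this
  have hre : Set.MapsTo h (Metric.ball 0 r) {z | z.re ≤ K} := by
    intro w hw
    have e := hexp w hw
    have e2 : g w = g 0 * Complex.exp (h w) := by
      rw [← e, mul_assoc, ← Complex.exp_add]; simp
    have e3 := hb w (by simpa using hw)
    rw [e2, norm_mul, Complex.norm_exp, mul_comm] at e3
    have := le_of_mul_le_mul_right e3 (norm_pos_iff.mpr h0g)
    simpa using this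
  have hdh : DifferentiableOn ℂ h (Metric.ball 0 r) := fun w hw =>
    (hh w hw).differentiableAt.differentiableWithinAt
  have hzb : z ∈ Metric.ball (0:ℂ) r := by simp; linarith
  have hcl : ∀ w ∈ Metric.closedBall z (r/4), ‖w‖ ≤ r / 2 := by
    intro w hw
    rw [mem_closedBall_iff_norm] at hw
    have := norm_le_norm_add_norm_sub z w
    rw [norm_sub_rev] at this
    linarith
  have := Complex.norm_deriv_le_of_forall_mem_sphere_norm_le (c := z) (R := r/4) (C := 2 * K) (f := h)
    (by positivity) (DifferentiableOn.diffContOnCl (s := Metric.ball z (r/4)) (by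
      rw [closure_ball _ (by positivity)]
      refine hdh.mono fun w hw => ?_
      have := hcl w hw
      simp; linarith)) (by
      intro w hw
      have h1 := hcl w (Metric.sphere_subset_closedBall hw)
      have h2 := Complex.borelCaratheodory_zero hK hdh hre hr (z := w) (by simp; linarith) h0
      refine h2.trans ?_
      rw [div_le_iff₀ (by linarith)]
      nlinarith)
  rw [(hh z hzb).deriv] at this
  refine this.trans (le_of_eq ?_)
  field_simp
  ring

theorem pb_logderiv_mulprod (s : Multiset ℂ) (g : ℂ → ℂ) (hg : Differentiable ℂ g) (z : ℂ)
    (hgz : g z ≠ 0) (hs : ∀ ρ ∈ s, z ≠ ρ) :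
    deriv (fun z => (s.map (fun ρ => z - ρ)).prod * g z) z / ((s.map (fun ρ => z - ρ)).prod * g z)
      = deriv g z / g z + (s.map (fun ρ => 1 / (z - ρ))).sum := by
  induction s using Multiset.induction_on with
  | empty => simp
  | cons a s ih =>
    have ih' := ih (fun ρ h => hs ρ (Multiset.mem_cons_of_mem h))
    have hza : z - a ≠ 0 := sub_ne_zero.mpr (hs a (Multiset.mem_cons_self a s))
    have hprod : (s.map (fun ρ => z - ρ)).prod ≠ 0 := by
      rw [Ne, Multiset.prod_eq_zero_iff]
      rw [Multiset.mem_map]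
      rintro ⟨ρ, h, h'⟩
      exact hs ρ (Multiset.mem_cons_of_mem h) (sub_eq_zero.mp h')
    have hdp : Differentiable ℂ (fun z => (s.map (fun ρ => z - ρ)).prod) := by
      clear * -
      induction s using Multiset.induction_on with
      | empty => simp
      | cons a s ih => simp only [Multiset.map_cons, Multiset.prod_cons]; fun_prop
    simp only [Multiset.map_cons, Multiset.prod_cons, Multiset.sum_cons]
    have hF : DifferentiableAt ℂ (fun z => (s.map (fun ρ => z - ρ)).prod * g z) z :=
      (hdp z).mul (hg z)
    have e : (fun z => (z - a) * (s.map (fun ρ => z - ρ)).prod * g z) =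
      fun z => (z - a) * ((s.map (fun ρ => z - ρ)).prod * g z) := by ext; ring
    rw [e]
    have hd := ((hasDerivAt_id z).sub_const a).mul hF.hasDerivAt
    have hd' : deriv (fun z => (z - a) * ((s.map (fun ρ => z - ρ)).prod * g z)) z = _ := hd.deriv
    rw [hd', ← add_left_comm, ← ih']
    simp only [id]
    field_simp

end

section

theorem pb_tail_norm (f : ℝ → ℂ) (C a : ℝ)
    (hf : ∀ t, 1 < t → ‖f t‖ ≤ C * t ^ a) (s : ℂ) (hs : a < s.re) :
    ‖∫ t in Set.Ioi (1:ℝ), f t * (t:ℂ) ^ (-(s+1))‖ ≤ C / (s.re - a) := by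
  have hinteg : MeasureTheory.IntegrableOn (fun t : ℝ => C * t ^ (a - s.re - 1)) (Set.Ioi 1) :=
    (integrableOn_Ioi_rpow_of_lt (by linarith) (by norm_num)).const_mul C
  refine (MeasureTheory.norm_integral_le_of_norm_le hinteg ?_).trans (le_of_eq ?_)
  · refine (MeasureTheory.ae_restrict_iff' measurableSet_Ioi).mpr (Filter.Eventually.of_forall ?_)
    intro t ht
    have ht' : (1:ℝ) < t := ht
    rw [norm_mul, Complex.norm_cpow_eq_rpow_re_of_pos (by linarith)]
    have : a - s.re - 1 = a + (-(s+1)).re := by simp; ring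
    rw [this, Real.rpow_add (by linarith), ← mul_assoc]
    gcongr
    exact hf t ht'
  · rw [MeasureTheory.integral_const_mul, integral_Ioi_rpow_of_lt (by linarith) (by norm_num)]
    rw [Real.one_rpow]
    have : a - s.re - 1 + 1 = -(s.re - a) := by ring
    rw [this, neg_div_neg_eq]; ring

theorem pb_tail_diff (f : ℝ → ℂ) (hm : Measurable f) (C a : ℝ) (ha : 0 ≤ a)
    (hf : ∀ t, 1 < t → ‖f t‖ ≤ C * t ^ a) (s : ℂ) (hs : a < s.re) :
    DifferentiableAt ℂ (fun s : ℂ => ∫ t in Set.Ioi (1:ℝ), f t * (t:ℂ) ^ (-(s+1))) s := by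
  have hC : 0 ≤ C := by
    have h1 := (norm_nonneg _).trans (hf 2 (by norm_num))
    have h2 : (0:ℝ) < 2 ^ a := by positivity
    exact nonneg_of_mul_nonneg_left h1 h2
  set F : ℝ → ℂ := (Set.Ioi (1:ℝ)).indicator f with hF
  have hFm : Measurable F := hm.indicator measurableSet_Ioi
  have e : ∀ s : ℂ, (∫ t in Set.Ioi (1:ℝ), f t * (t:ℂ) ^ (-(s+1))) = mellin F (-s) := by
    intro s
    rw [mellin, ← MeasureTheory.integral_indicator measurableSet_Ioi,
      ← MeasureTheory.integral_indicator measurableSet_Ioi]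
    congr 1
    ext t
    by_cases h : t ∈ Set.Ioi (1:ℝ)
    · have h0 : t ∈ Set.Ioi (0:ℝ) := lt_trans (b := (1:ℝ)) zero_lt_one (Set.mem_Ioi.mp h)
      simp only [Set.indicator_of_mem h, Set.indicator_of_mem h0, hF, smul_eq_mul]
      rw [mul_comm]; congr 2; ring
    · rw [Set.indicator_of_notMem h]
      by_cases h0 : t ∈ Set.Ioi (0:ℝ)
      · simp [Set.indicator_of_mem h0, hF, Set.indicator_of_notMem h]
      · rw [Set.indicator_of_notMem h0]
  have hb : ∀ t, 0 < t → ‖F t‖ ≤ C * t ^ a := by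
    intro t ht
    by_cases h : t ∈ Set.Ioi (1:ℝ)
    · rw [hF, Set.indicator_of_mem h]; exact hf t h
    · rw [hF, Set.indicator_of_notMem h]; simp; positivity
  have hd : DifferentiableAt ℂ (mellin F) (-s) := by
    refine mellin_differentiableAt_of_isBigO_rpow (a := -a) (b := (-s).re - 1) ?_ ?_ ?_ ?_ ?_
    · rw [MeasureTheory.locallyIntegrableOn_iff isOpen_Ioi.isLocallyClosed]
      intro k hk hk2
      obtain ⟨B, hB⟩ := hk2.isBounded.exists_norm_le
      refine MeasureTheory.IntegrableOn.of_bound (C := C * |B| ^ a) hk2.measure_lt_top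
        hFm.aestronglyMeasurable ?_
      refine (MeasureTheory.ae_restrict_iff' hk2.measurableSet).mpr (Filter.Eventually.of_forall ?_)
      intro t ht
      have ht0 : (0:ℝ) < t := hk ht
      refine (hb t ht0).trans ?_
      have h2 := hB t ht
      rw [Real.norm_eq_abs, abs_of_pos ht0] at h2
      gcongr
      exact h2.trans (le_abs_self _)
    · refine Asymptotics.IsBigO.of_bound C ?_
      filter_upwards [Filter.eventually_gt_atTop 0] with t ht
      rw [neg_neg, Real.norm_of_nonneg (by positivity)]
      exact hb t ht
    · simp; linarith
    · refine Asymptotics.IsBigO.of_bound 0 ?_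
      have : ∀ᶠ t in nhdsWithin (0:ℝ) (Set.Ioi 0), t < 1 :=
        nhdsWithin_le_nhds (Iio_mem_nhds (by norm_num))
      filter_upwards [this] with t ht
      rw [hF, Set.indicator_of_notMem (by simp; linarith)]; simp
    · simp
  have : (fun s : ℂ => ∫ t in Set.Ioi (1:ℝ), f t * (t:ℂ) ^ (-(s+1))) = mellin F ∘ (fun s => -s) := by
    ext s; exact e s
  rw [this]
  exact DifferentiableAt.comp s hd (differentiableAt_id.neg)

theorem pb_halfplane_eq (a : ℝ) (ha : a < 1) (f g : ℂ → ℂ)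
    (hf : ∀ s : ℂ, a < s.re → DifferentiableAt ℂ f s)
    (hg : ∀ s : ℂ, a < s.re → DifferentiableAt ℂ g s)
    (h : ∀ s : ℂ, 1 < s.re → f s = g s) (s : ℂ) (hs : a < s.re) : f s = g s := by
  have ho : IsOpen {s : ℂ | a < s.re} := isOpen_lt continuous_const Complex.continuous_re
  have hfa : AnalyticOnNhd ℂ f {s : ℂ | a < s.re} :=
    DifferentiableOn.analyticOnNhd (fun s hs => (hf s hs).differentiableWithinAt) ho
  have hga : AnalyticOnNhd ℂ g {s : ℂ | a < s.re} :=
    DifferentiableOn.analyticOnNhd (fun s hs => (hg s hs).differentiableWithinAt) ho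
  have h2 : (2:ℂ) ∈ {s : ℂ | a < s.re} := by simp; linarith
  refine hfa.eqOn_of_preconnected_of_eventuallyEq hga (convex_halfSpace_re_gt a).isPreconnected h2 ?_ hs
  have : {s : ℂ | 1 < s.re} ∈ nhds (2:ℂ) :=
    (isOpen_lt continuous_const Complex.continuous_re).mem_nhds (by simp)
  filter_upwards [this] with s hs using h s hs

theorem pb_L_bound {q : ℕ} [NeZero q] (χ : DirichletCharacter ℂ q) (hχ : χ ≠ 1) (C a : ℝ)
    (ha : 0 ≤ a) (ha1 : a < 1)
    (hS : ∀ n : ℕ, ‖∑ k ∈ Finset.Icc 1 n, χ k‖ ≤ C * (n:ℝ) ^ a) (s : ℂ) (hs : a < s.re) :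
    ‖DirichletCharacter.LFunction χ s‖ ≤ ‖s‖ * (C / (s.re - a)) := by
  have hC : 0 ≤ C := by simpa using (norm_nonneg _).trans (hS 1)
  set f : ℝ → ℂ := fun t => ∑ k ∈ Finset.Icc 1 ⌊t⌋₊, χ k with hf
  have hfm : Measurable f := by
    have : Measurable (fun n : ℕ => ∑ k ∈ Finset.Icc 1 n, χ k) := measurable_from_nat
    exact this.comp Nat.measurable_floor
  have hfb : ∀ t, 1 < t → ‖f t‖ ≤ C * t ^ a := by
    intro t ht
    refine (hS _).trans ?_
    gcongr
    exact Nat.floor_le (by linarith)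
  have key := pb_halfplane_eq a ha1 (DirichletCharacter.LFunction χ)
    (fun s => s * ∫ t in Set.Ioi (1:ℝ), f t * (t:ℂ) ^ (-(s+1)))
    (fun s _ => DirichletCharacter.differentiable_LFunction hχ s)
    (fun s hs => differentiableAt_id.mul (pb_tail_diff f hfm C a ha hfb s hs))
    (by
      intro s hs
      rw [DirichletCharacter.LFunction_eq_LSeries χ hs]
      refine LSeries_eq_mul_integral _ ha (by linarith)
        (DirichletCharacter.LSeriesSummable_of_one_lt_re χ hs) ?_
      refine Asymptotics.IsBigO.of_bound C (Filter.Eventually.of_forall fun n => ?_)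
      rw [Real.norm_of_nonneg (by positivity)]
      exact hS n) s hs
  rw [key, norm_mul]
  gcongr
  exact pb_tail_norm f C a hfb s hs

theorem pb_charsum_period {q : ℕ} [NeZero q] (χ : DirichletCharacter ℂ q) (hχ : χ ≠ 1) (n : ℕ) :
    ∑ k ∈ Finset.Ico n (n+q), χ k = 0 := by
  have h1 := MulChar.sum_eq_zero_of_ne_one hχ
  have h2 : ∑ k ∈ Finset.Ico n (n+q), χ k = ∑ a : ZMod q, χ a := by
    refine Finset.sum_bij (fun k _ => (k : ZMod q)) (by simp) ?_ ?_ (by simp)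
    · intro a ha b hb hab
      rw [ZMod.natCast_eq_natCast_iff'] at hab
      have := Nat.image_Ico_mod n q
      have hinj : Set.InjOn (· % q) (Finset.Ico n (n+q) : Set ℕ) := by
        rw [← Finset.card_image_iff]
        rw [this]; simp
      exact hinj ha hb hab
    · intro b _
      have := Nat.image_Ico_mod n q
      have hb : b.val ∈ (Finset.Ico n (n+q)).image (· % q) := by
        rw [this]; simpa using ZMod.val_lt b
      obtain ⟨k, hk, hk2⟩ := Finset.mem_image.mp hb
      refine ⟨k, hk, ?_⟩
      have : ((k % q : ℕ) : ZMod q) = (b.val : ZMod q) := by rw [← hk2]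
      simpa using this
  rw [h2, h1]

theorem pb_charsum_le_len {q : ℕ} [NeZero q] (χ : DirichletCharacter ℂ q) (n : ℕ) :
    ‖∑ k ∈ Finset.Icc 1 n, χ k‖ ≤ n := by
  refine (norm_sum_le _ _).trans ?_
  have : ∑ k ∈ Finset.Icc 1 n, ‖χ k‖ ≤ ∑ k ∈ Finset.Icc 1 n, (1:ℝ) :=
    Finset.sum_le_sum fun k _ => DirichletCharacter.norm_le_one χ _
  simpa using this

theorem pb_charsum_le_q {q : ℕ} [NeZero q] (χ : DirichletCharacter ℂ q) (hχ : χ ≠ 1) (n : ℕ) :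
    ‖∑ k ∈ Finset.Icc 1 n, χ k‖ ≤ q := by
  induction n using Nat.strong_induction_on with
  | _ n ih =>
    by_cases h : n < q
    · refine (pb_charsum_le_len χ n).trans (by exact_mod_cast h.le)
    · push Not at h
      have h1 := ih (n - q) (Nat.sub_lt (lt_of_lt_of_le (NeZero.pos q) h) (NeZero.pos q))
      have h2 := pb_charsum_period χ hχ (n - q + 1)
      have h3 : ∑ k ∈ Finset.Icc 1 n, χ k = ∑ k ∈ Finset.Icc 1 (n-q), χ k +
        ∑ k ∈ Finset.Ico (n-q+1) (n-q+1+q), χ k := by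
        rw [← Finset.Ico_add_one_right_eq_Icc, ← Finset.Ico_add_one_right_eq_Icc]
        have : n - q + 1 + q = n + 1 := by omega
        rw [this, Finset.sum_Ico_consecutive _ (by omega) (by omega)]
      rw [h3, h2, add_zero]
      exact h1

/-- `‖L(s,χ)‖ ≤ 2 q ‖s‖` on `Re s ≥ 1/2`. -/
theorem pb_L_bound_q {q : ℕ} [NeZero q] (χ : DirichletCharacter ℂ q) (hχ : χ ≠ 1)
    (s : ℂ) (hs : 1/2 ≤ s.re) :
    ‖DirichletCharacter.LFunction χ s‖ ≤ 2 * q * ‖s‖ := by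
  have := pb_L_bound χ hχ q 0 le_rfl (by norm_num)
    (fun n => by simpa using pb_charsum_le_q χ hχ n) s (by linarith)
  refine this.trans ?_
  rw [sub_zero]
  have h1 : (q:ℝ) / s.re ≤ 2 * q := by
    rw [div_le_iff₀ (by linarith)]
    have : (0:ℝ) ≤ q := by positivity
    nlinarith
  calc ‖s‖ * ((q:ℝ)/s.re) ≤ ‖s‖ * (2*q) := by gcongr
    _ = _ := by ring

/-- `‖L(s,χ)‖ ≤ 20 q^{1/10} ‖s‖` on `Re s ≥ 19/20`. -/
theorem pb_L_bound_near {q : ℕ} [NeZero q] (χ : DirichletCharacter ℂ q) (hχ : χ ≠ 1)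
    (s : ℂ) (hs : 19/20 ≤ s.re) :
    ‖DirichletCharacter.LFunction χ s‖ ≤ 20 * (q:ℝ)^(1/10:ℝ) * ‖s‖ := by
  have := pb_L_bound χ hχ ((q:ℝ)^(1/10:ℝ)) (9/10) (by norm_num) (by norm_num)
    (fun n => by
      have h1 := pb_charsum_le_q χ hχ n
      have h2 := pb_charsum_le_len χ n
      have h0 : 0 ≤ ‖∑ k ∈ Finset.Icc 1 n, χ k‖ := norm_nonneg _
      set S := ‖∑ k ∈ Finset.Icc 1 n, χ k‖
      calc S = S ^ (1:ℝ) := by simp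
        _ = S ^ (1/10:ℝ) * S ^ (9/10:ℝ) := by
          rw [← Real.rpow_add_of_nonneg h0 (by norm_num) (by norm_num)]; norm_num
        _ ≤ _ := by gcongr) s (by linarith)
  refine this.trans ?_
  have h1 : (q:ℝ)^(1/10:ℝ) / (s.re - 9/10) ≤ 20 * (q:ℝ)^(1/10:ℝ) := by
    rw [div_le_iff₀ (by linarith)]
    have : (0:ℝ) ≤ (q:ℝ)^(1/10:ℝ) := by positivity
    nlinarith
  calc ‖s‖ * ((q:ℝ)^(1/10:ℝ)/(s.re - 9/10)) ≤ ‖s‖ * (20 * (q:ℝ)^(1/10:ℝ)) := by gcongr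
    _ = _ := by ring

/-- The entire function `(s-1) ζ(s)`. -/
noncomputable def pbF : ℂ → ℂ := DirichletCharacter.LFunctionTrivChar₁ 1

theorem pbF_eq (s : ℂ) (hs : s ≠ 1) : pbF s = (s - 1) * riemannZeta s := by
  rw [pbF, DirichletCharacter.LFunctionTrivChar₁, Function.update_of_ne hs]
  rw [DirichletCharacter.LFunctionTrivChar, DirichletCharacter.LFunction_modOne_eq]

theorem pbF_one : pbF 1 ≠ 0 := DirichletCharacter.LFunctionTrivChar₁_apply_one_ne_zero 1

theorem pbF_diff : Differentiable ℂ pbF := DirichletCharacter.differentiable_LFunctionTrivChar₁ 1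

theorem pbF_ne (s : ℂ) (hs : 1 ≤ s.re) : pbF s ≠ 0 := by
  by_cases h : s = 1
  · rw [h]; exact pbF_one
  · rw [pbF_eq s h]
    exact mul_ne_zero (sub_ne_zero.mpr h) (riemannZeta_ne_zero_of_one_le_re hs)

theorem pbF_bound (s : ℂ) (hs : 1/2 ≤ s.re) : ‖pbF s‖ ≤ ‖s‖ + 2 * ‖s‖ * ‖s - 1‖ := by
  set f : ℝ → ℂ := fun t => ((⌊t⌋₊ : ℝ) : ℂ) - t with hf
  have hfm : Measurable f := by
    have : Measurable (fun n : ℕ => ((n:ℝ):ℂ)) := measurable_from_nat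
    exact (this.comp Nat.measurable_floor).sub Complex.measurable_ofReal
  have hfb : ∀ t, 1 < t → ‖f t‖ ≤ 1 * t ^ (0:ℝ) := by
    intro t ht
    rw [Real.rpow_zero, hf]
    simp only
    rw [← Complex.ofReal_sub, Complex.norm_real, Real.norm_eq_abs, abs_le]
    have h1 := Nat.floor_le (show 0 ≤ t by linarith)
    have h2 := Nat.lt_floor_add_one t
    constructor <;> linarith
  have key := pb_halfplane_eq 0 (by norm_num) pbF
    (fun s => s + s * (s - 1) * ∫ t in Set.Ioi (1:ℝ), f t * (t:ℂ) ^ (-(s+1)))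
    (fun s _ => pbF_diff s)
    (fun s hs => differentiableAt_id.add ((differentiableAt_id.mul
      (differentiableAt_id.sub_const 1)).mul (pb_tail_diff f hfm 1 0 le_rfl hfb s hs)))
    (by
      intro s hs
      have hs1 : s ≠ 1 := by rintro rfl; simp at hs
      have hs1' : s - 1 ≠ 0 := sub_ne_zero.mpr hs1
      rw [pbF_eq s hs1, ← LSeries_one_eq_riemannZeta hs]
      rw [LSeries_eq_mul_integral 1 (r := 1) (by norm_num) hs (LSeriesSummable_one_iff.mpr hs) (by
        refine Asymptotics.IsBigO.of_bound 1 (Filter.Eventually.of_forall fun n => ?_)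
        simp)]
      have e1 : ∫ t in Set.Ioi (1:ℝ), (t:ℂ) ^ (-s) = 1 / (s - 1) := by
        rw [integral_Ioi_cpow_of_lt (by simpa using hs) zero_lt_one]
        simp only [Complex.ofReal_one, Complex.one_cpow]
        rw [show -s + 1 = -(s-1) by ring, neg_div_neg_eq]
      have e2 : MeasureTheory.IntegrableOn (fun t : ℝ => (t:ℂ) ^ (-s)) (Set.Ioi 1) :=
        integrableOn_Ioi_cpow_of_lt (by simpa using hs) zero_lt_one
      have e3 : MeasureTheory.IntegrableOn (fun t : ℝ => f t * (t:ℂ) ^ (-(s+1))) (Set.Ioi 1) := by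
        refine MeasureTheory.Integrable.mono' (g := fun t : ℝ => 1 * t ^ (-s.re-1))
          (((integrableOn_Ioi_rpow_of_lt (by linarith) (by norm_num))).const_mul 1) ?_ ?_
        · refine (hfm.mul ?_).aestronglyMeasurable
          exact (Complex.measurable_ofReal.pow_const _)
        · refine (MeasureTheory.ae_restrict_iff' measurableSet_Ioi).mpr
            (Filter.Eventually.of_forall ?_)
          intro t ht
          have ht' : (1:ℝ) < t := ht
          rw [norm_mul, Complex.norm_cpow_eq_rpow_re_of_pos (by linarith)]
          have : (-(s+1)).re = -s.re - 1 := by simp; ring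
          rw [this]
          gcongr
          simpa using hfb t ht'
      have e4 : ∫ t in Set.Ioi (1:ℝ), (∑ k ∈ Finset.Icc 1 ⌊t⌋₊, (1 : ℕ → ℂ) k) * (t:ℂ) ^ (-(s + 1))
          = (∫ t in Set.Ioi (1:ℝ), f t * (t:ℂ) ^ (-(s+1))) + ∫ t in Set.Ioi (1:ℝ), (t:ℂ) ^ (-s) := by
        rw [← MeasureTheory.integral_add e3 e2]
        refine MeasureTheory.setIntegral_congr_fun measurableSet_Ioi ?_
        intro t ht
        have ht' : (1:ℝ) < t := ht
        have ht0 : (t:ℂ) ≠ 0 := by exact_mod_cast (by linarith : t ≠ 0)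
        have : (t:ℂ) ^ (-s) = t * (t:ℂ) ^ (-(s+1)) := by
          rw [show -s = 1 + -(s+1) by ring, Complex.cpow_add _ _ ht0, Complex.cpow_one]
        simp only [Pi.one_apply, Finset.sum_const, Nat.card_Icc, this, hf]
        simp
        ring
      rw [e4, e1]
      field_simp
      ring) s (by linarith)
  rw [key]
  have h1 := pb_tail_norm f 1 0 hfb s (by linarith)
  have h2 : 1 / (s.re - 0) ≤ 2 := by
    rw [sub_zero, div_le_iff₀ (by linarith)]; linarith
  refine (norm_add_le _ _).trans ?_
  rw [norm_mul, norm_mul]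
  have : ‖s‖ * ‖s-1‖ * ‖∫ t in Set.Ioi (1:ℝ), f t * (t:ℂ) ^ (-(s+1))‖ ≤ ‖s‖ * ‖s-1‖ * 2 := by
    gcongr; exact h1.trans h2
  linarith

theorem pb_zeta_le (σ : ℝ) (hσ : 1 < σ) (f : ℕ → ℂ) (hf : ∀ n, ‖f n‖ ≤ 1) (s : ℂ) (hs : s.re = σ) :
    ‖LSeries f s‖ ≤ 1 + 1 / (σ - 1) := by
  have hF := pbF_bound
  have hsum : Summable (fun n : ℕ => 1 / (n:ℝ) ^ σ) := Real.summable_one_div_nat_rpow.mpr hσ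
  have h1 : ‖LSeries f s‖ ≤ ∑' n : ℕ, 1 / (n:ℝ) ^ σ := by
    refine tsum_of_norm_bounded hsum.hasSum ?_
    intro n
    rw [LSeries.norm_term_eq]
    split_ifs with h
    · subst h; positivity
    · rw [hs]; gcongr; exact hf n
  refine h1.trans ?_
  have hσ' : 1 < (σ:ℂ).re := by simpa using hσ
  have h2 : ((∑' n : ℕ, 1 / (n:ℝ) ^ σ : ℝ) : ℂ) = LSeries 1 σ := by
    rw [LSeries_one_eq_riemannZeta hσ', zeta_eq_tsum_one_div_nat_cpow hσ', Complex.ofReal_tsum]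
    congr 1
    ext n
    rw [Complex.ofReal_div, Complex.ofReal_cpow (by positivity)]
    simp
  have h3 : ∑' n : ℕ, 1 / (n:ℝ) ^ σ = ‖LSeries 1 (σ:ℂ)‖ := by
    rw [← h2, Complex.norm_real, Real.norm_of_nonneg (tsum_nonneg fun n => by positivity)]
  rw [h3, LSeries_eq_mul_integral 1 (r := 1) (by norm_num) hσ' (LSeriesSummable_one_iff.mpr hσ') (by
        refine Asymptotics.IsBigO.of_bound 1 (Filter.Eventually.of_forall fun n => ?_)
        simp), norm_mul]
  have h4 := pb_tail_norm (fun t => ∑ k ∈ Finset.Icc 1 ⌊t⌋₊, (1 : ℕ → ℂ) k) 1 1 (by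
    intro t ht
    have := Nat.floor_le (show 0 ≤ t by linarith)
    simpa using this) σ hσ'
  have h5 : ‖(σ:ℂ)‖ = σ := by rw [Complex.norm_real, Real.norm_of_nonneg (by linarith)]
  rw [h5]
  refine (mul_le_mul_of_nonneg_left h4 (by linarith)).trans (le_of_eq ?_)
  have : σ - 1 ≠ 0 := by linarith
  simp
  field_simp
  ring

theorem pb_L_lower {q : ℕ} (χ : DirichletCharacter ℂ q) (s : ℂ) (hs : 1 < s.re) :
    (s.re - 1) / s.re ≤ ‖LSeries (fun n => χ n) s‖ := by
  have h1 := DirichletCharacter.LSeries.mul_mu_eq_one χ hs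
  have h2 := pb_zeta_le s.re hs ((fun n : ℕ => χ (n : ZMod q)) * (fun n : ℕ => ((ArithmeticFunction.moebius n : ℤ) : ℂ))) (by
    intro n
    rw [Pi.mul_apply, norm_mul]
    have a1 := DirichletCharacter.norm_le_one χ (n : ZMod q)
    have a2 : ‖((ArithmeticFunction.moebius n : ℤ) : ℂ)‖ ≤ 1 := by
      rw [Complex.norm_intCast]
      exact_mod_cast ArithmeticFunction.abs_moebius_le_one
    calc _ ≤ (1:ℝ) * 1 := by gcongr
      _ = 1 := by norm_num) s rfl
  have h3 := congrArg norm h1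
  rw [norm_mul, norm_one] at h3
  set A := ‖LSeries (fun n => χ n) s‖
  have hA : 0 ≤ A := norm_nonneg _
  rw [div_le_iff₀ (by linarith)]
  have h4 : (1:ℝ) ≤ A * (1 + 1/(s.re - 1)) :=
    h3.symm.le.trans (mul_le_mul_of_nonneg_left h2 hA)
  have h5 : 1 + 1/(s.re-1) = s.re / (s.re-1) := by
    have : s.re - 1 ≠ 0 := by linarith
    field_simp; ring
  rw [h5, ← mul_div_assoc, le_div_iff₀ (by linarith)] at h4
  linarith

theorem pb_zeta_lower (s : ℂ) (hs : 1 < s.re) :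
    (s.re - 1) / s.re ≤ ‖riemannZeta s‖ := by
  have := pb_L_lower (1 : DirichletCharacter ℂ 1) s hs
  rw [← DirichletCharacter.LFunction_eq_LSeries _ hs, DirichletCharacter.LFunction_modOne_eq] at this
  exact this

end

section

theorem pb_local (R K : ℝ) (hR : 0 < R) (hK : 0 < K) (f : ℂ → ℂ) (hf : Differentiable ℂ f)
    (s0 : ℂ) (hf0 : f s0 ≠ 0)
    (hM : ∀ z, ‖z - s0‖ ≤ R → ‖f z‖ ≤ Real.exp K * ‖f s0‖) :
    ∃ s : Multiset ℂ, (∀ ρ ∈ s, ‖ρ - s0‖ ≤ R/3 ∧ f ρ = 0) ∧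
      (∀ ρ, ‖ρ - s0‖ ≤ R/3 → f ρ = 0 → ρ ∈ s) ∧ (2:ℝ) ^ (Multiset.card s) ≤ Real.exp K ∧
      ∀ z, ‖z - s0‖ ≤ R/12 → f z ≠ 0 →
        ‖deriv f z / f z - (s.map (fun ρ => 1 / (z - ρ))).sum‖ ≤ 24 * K / R := by
  obtain ⟨n, hn⟩ := pow_unbounded_of_one_lt (Real.exp K) (one_lt_two : (1:ℝ) < 2)
  have hF : Differentiable ℂ (fun z => f (z + s0)) := by fun_prop
  obtain ⟨s, g, hg, hfg, hs, hgz, hc, hgb⟩ := pb_dec R hR n (fun z => f (z + s0)) (Real.exp K) hF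
    (by simpa using hf0) (fun z hz => by simpa using hM (z + s0) (by simpa using hz))
    (hn.trans (pow_lt_pow_right₀ one_lt_two (Nat.lt_succ_self n)))
  have hfac : ∀ z, f z = ((s.map (fun ρ => z - s0 - ρ)).prod) * g (z - s0) := by
    intro z
    have := hfg (z - s0)
    simpa using this
  have hmem : ∀ ρ, ‖ρ - s0‖ ≤ R/3 → f ρ = 0 → ρ - s0 ∈ s := by
    intro ρ h1 h2
    rw [hfac ρ, mul_eq_zero] at h2
    rcases h2 with h2 | h2
    · rw [Multiset.prod_eq_zero_iff, Multiset.mem_map] at h2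
      obtain ⟨a, ha, hb⟩ := h2
      rwa [sub_eq_zero.mp hb]
    · exact absurd h2 (hgz _ h1)
  refine ⟨s.map (fun ρ => ρ + s0), ?_, ?_, ?_, ?_⟩
  · intro ρ hρ
    obtain ⟨a, ha, rfl⟩ := Multiset.mem_map.mp hρ
    simpa using hs a ha
  · intro ρ h1 h2
    exact Multiset.mem_map.mpr ⟨ρ - s0, hmem ρ h1 h2, by ring⟩
  · simpa using hc
  · intro z hz hfz
    have hw : ∀ ρ ∈ s, z - s0 ≠ ρ := by
      intro ρ hρ h
      apply hfz
      have := (hs ρ hρ).2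
      simp only [← h] at this
      simpa using this
    have h1 := pb_logderiv_mulprod s g hg (z - s0) (hgz _ (by linarith)) hw
    have h2 : deriv f z = deriv (fun z => (s.map (fun ρ => z - ρ)).prod * g z) (z - s0) := by
      have : (fun z => (s.map (fun ρ => z - ρ)).prod * g z) = fun z => f (z + s0) := by
        ext w; exact (hfg w).symm
      rw [this, deriv_comp_add_const]; simp
    rw [h2, hfac z]
    have h3 := pb_logderiv_nonzero (R/3) K (by linarith) hK g hg (fun z hz => hgz z hz.le)
      (fun z hz => hgb z (by linarith)) (z - s0) (by linarith)
    have h4 : 8 * K / (R/3) = 24 * K / R := by field_simp; ring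
    rw [h4] at h3
    rw [h1, Multiset.map_map]
    simp only [Function.comp_def]
    have : (s.map (fun ρ => 1 / (z - s0 - ρ))).sum = (s.map (fun ρ => 1 / (z - (ρ + s0)))).sum := by
      congr 2; ext ρ; congr 1; ring
    rw [this, add_sub_cancel_right]
    exact h3

/-- analytic conductor -/
noncomputable def pbl (q : ℕ) (t : ℝ) : ℝ := Real.log (q * (|t| + 3))

theorem pbl_one_le (q : ℕ) [NeZero q] (t : ℝ) : 1 ≤ pbl q t := by
  have hq : (1:ℝ) ≤ q := by exact_mod_cast NeZero.one_le
  have : (3:ℝ) ≤ q * (|t| + 3) := by nlinarith [abs_nonneg t]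
  rw [pbl, Real.le_log_iff_exp_le (by linarith)]
  have := Real.exp_one_lt_d9
  linarith

theorem pb_center_norm (t : ℝ) (z : ℂ) (hz : ‖z - (1.01 + t * Complex.I)‖ ≤ 0.48) :
    ‖z‖ ≤ |t| + 3 ∧ ‖z - 1‖ ≤ |t| + 3 ∧ 1/2 ≤ z.re := by
  have h1 : ‖(t:ℂ) * Complex.I‖ = |t| := by simp
  refine ⟨?_, ?_, ?_⟩
  · have : z = (z - (1.01 + t * Complex.I)) + (1.01 + t * Complex.I) := by ring
    rw [this]
    refine (norm_add_le _ _).trans ?_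
    have := norm_add_le (1.01:ℂ) (t * Complex.I)
    have h2 : ‖(1.01:ℂ)‖ = 1.01 := by norm_num
    linarith
  · have : z - 1 = (z - (1.01 + t * Complex.I)) + (0.01 + t * Complex.I) := by ring
    rw [this]
    refine (norm_add_le _ _).trans ?_
    have := norm_add_le (0.01:ℂ) (t * Complex.I)
    have h2 : ‖(0.01:ℂ)‖ = 0.01 := by norm_num
    linarith
  · have := (Complex.abs_re_le_norm _).trans hz
    have h2 : (z - (1.01 + t * Complex.I)).re = z.re - 1.01 := by simp
    rw [h2, abs_le] at this
    linarith [this.1]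

theorem pb_exp_six : (400:ℝ) ≤ Real.exp 6 := by
  have h : Real.exp 6 = Real.exp 1 ^ 6 := by rw [← Real.exp_nat_mul]; norm_num
  rw [h]
  have := Real.exp_one_gt_d9
  calc (400:ℝ) ≤ 2.7182818283 ^ 6 := by norm_num
    _ ≤ _ := by gcongr

theorem pb_L_local {q : ℕ} [NeZero q] (χ : DirichletCharacter ℂ q) (hχ : χ ≠ 1) (t : ℝ) :
    ∃ s : Multiset ℂ, (∀ ρ ∈ s, ‖ρ - (1.01 + t * Complex.I)‖ ≤ 0.16 ∧
        DirichletCharacter.LFunction χ ρ = 0) ∧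
      (∀ ρ, ‖ρ - (1.01 + t * Complex.I)‖ ≤ 0.16 → DirichletCharacter.LFunction χ ρ = 0 → ρ ∈ s) ∧
      (Multiset.card s : ℝ) ≤ 14 * pbl q t ∧
      ∀ z, ‖z - (1.01 + t * Complex.I)‖ ≤ 0.04 → DirichletCharacter.LFunction χ z ≠ 0 →
        ‖deriv (DirichletCharacter.LFunction χ) z / DirichletCharacter.LFunction χ z -
          (s.map (fun ρ => 1 / (z - ρ))).sum‖ ≤ 350 * pbl q t := by
  set s0 : ℂ := 1.01 + t * Complex.I with hs0
  have hre : s0.re = 1.01 := by simp [hs0]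
  have hl := pbl_one_le q t
  have hq : (1:ℝ) ≤ q := by exact_mod_cast NeZero.one_le
  have hlow := pb_L_lower χ s0 (by rw [hre]; norm_num)
  rw [← DirichletCharacter.LFunction_eq_LSeries χ (by rw [hre]; norm_num), hre] at hlow
  have hlow' : 1/101 ≤ ‖DirichletCharacter.LFunction χ s0‖ := by norm_num at hlow ⊢; exact hlow
  obtain ⟨s, h1, h2, h3, h4⟩ := pb_local 0.48 (7 * pbl q t) (by norm_num) (by linarith)
    (DirichletCharacter.LFunction χ) (DirichletCharacter.differentiable_LFunction hχ) s0
    (by intro h; rw [h] at hlow'; norm_num at hlow') (by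
      intro z hz
      obtain ⟨a1, a2, a3⟩ := pb_center_norm t z hz
      refine (pb_L_bound_q χ hχ z a3).trans ?_
      have b1 : Real.exp (7 * pbl q t) ≥ 400 * (q * (|t|+3)) := by
        have : Real.exp (6 + pbl q t) ≤ Real.exp (7 * pbl q t) := Real.exp_le_exp.mpr (by linarith)
        rw [Real.exp_add, pbl, Real.exp_log (by positivity)] at this
        refine le_trans ?_ this
        gcongr
        exact pb_exp_six
      calc 2 * q * ‖z‖ ≤ 2 * q * (|t|+3) := by gcongr
        _ ≤ (400 * (q * (|t|+3))) * (1/101) := by nlinarith [mul_pos (by linarith : (0:ℝ) < q) (by positivity : 0 < |t|+3)]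
        _ ≤ _ := by gcongr)
  refine ⟨s, ?_, ?_, ?_, ?_⟩
  · norm_num at h1 ⊢; exact h1
  · norm_num at h2 ⊢; exact h2
  · have := Real.log_le_log (by positivity) h3
    rw [Real.log_exp, Real.log_pow] at this
    have l2 := Real.log_two_gt_d9
    have : (Multiset.card s : ℝ) * (1/2) ≤ 7 * pbl q t := by
      refine le_trans ?_ this
      gcongr; linarith
    linarith
  · intro z hz hz2
    refine (h4 z (by norm_num at hz ⊢; exact hz) hz2).trans (le_of_eq ?_)
    ring

theorem pbF_local (t : ℝ) :
    ∃ s : Multiset ℂ, (∀ ρ ∈ s, pbF ρ = 0) ∧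
      ∀ z, ‖z - (1.01 + t * Complex.I)‖ ≤ 0.04 → pbF z ≠ 0 →
        ‖deriv pbF z / pbF z -
          (s.map (fun ρ => 1 / (z - ρ))).sum‖ ≤ 700 * pbl 1 t := by
  set s0 : ℂ := 1.01 + t * Complex.I with hs0
  have hre : s0.re = 1.01 := by simp [hs0]
  have hl := pbl_one_le 1 t
  have hlow := pb_zeta_lower s0 (by rw [hre]; norm_num)
  rw [hre] at hlow
  have hne : s0 ≠ 1 := by intro h; rw [h] at hre; norm_num at hre
  have hlow' : 1/10100 ≤ ‖pbF s0‖ := by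
    rw [pbF_eq s0 hne, norm_mul]
    have : 1/100 ≤ ‖s0 - 1‖ := by
      refine le_trans ?_ (Complex.re_le_norm _)
      simp [hre]; norm_num
    have h2 : (1/101:ℝ) ≤ ‖riemannZeta s0‖ := by norm_num at hlow ⊢; exact hlow
    calc (1/10100 : ℝ) = 1/100 * (1/101) := by norm_num
      _ ≤ _ := by gcongr
  obtain ⟨s, h1, h2, h3, h4⟩ := pb_local 0.48 (14 * pbl 1 t) (by norm_num) (by linarith)
    pbF pbF_diff s0
    (by intro h; rw [h] at hlow'; norm_num at hlow') (by
      intro z hz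
      obtain ⟨a1, a2, a3⟩ := pb_center_norm t z hz
      refine (pbF_bound z a3).trans ?_
      have b1 : Real.exp (14 * pbl 1 t) ≥ (400 * (|t|+3))^2 := by
        have : Real.exp (6 + pbl 1 t) ≤ Real.exp (7 * pbl 1 t) := Real.exp_le_exp.mpr (by linarith)
        have e : Real.exp (14 * pbl 1 t) = Real.exp (7 * pbl 1 t) ^ 2 := by
          rw [← Real.exp_nat_mul]; congr 1; push_cast; ring
        rw [e]
        rw [Real.exp_add, pbl, Real.exp_log (by positivity)] at this
        have h5 : 400 * (|t|+3) ≤ Real.exp (7 * Real.log ((1:ℕ) * (|t|+3))) := by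
          refine le_trans ?_ this
          rw [Nat.cast_one, one_mul]
          gcongr
          exact pb_exp_six
        rw [pbl]
        gcongr
      calc ‖z‖ + 2 * ‖z‖ * ‖z - 1‖ ≤ (|t|+3) + 2 * (|t|+3) * (|t|+3) := by gcongr
        _ ≤ (400 * (|t|+3))^2 * (1/10100) := by nlinarith [abs_nonneg t]
        _ ≤ _ := by gcongr)
  refine ⟨s, fun ρ h => (h1 ρ h).2, ?_⟩
  · intro z hz hz2
    refine (h4 z (by norm_num at hz ⊢; exact hz) hz2).trans (le_of_eq ?_)
    ring

theorem pb_re_inv_nonneg (z ρ : ℂ) (h : ρ.re ≤ z.re) : 0 ≤ (1 / (z - ρ)).re := by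
  rw [one_div, Complex.inv_re]
  apply div_nonneg
  · simpa using h
  · exact Complex.normSq_nonneg _

theorem pb_multiset_re_nonneg (s : Multiset ℂ) (z : ℂ) (h : ∀ ρ ∈ s, ρ.re ≤ z.re) :
    0 ≤ ((s.map (fun ρ => 1 / (z - ρ))).sum).re := by
  induction s using Multiset.induction_on with
  | empty => simp
  | cons a s ih =>
    simp only [Multiset.map_cons, Multiset.sum_cons, Complex.add_re]
    exact add_nonneg (pb_re_inv_nonneg z a (h a (Multiset.mem_cons_self a s)))
      (ih (fun ρ hρ => h ρ (Multiset.mem_cons_of_mem hρ)))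

theorem pb_center_dist (t δ : ℝ) (h1 : -0.03 ≤ δ) (h2 : δ ≤ 0.05) :
    ‖((1:ℂ) + δ + t * Complex.I) - (1.01 + t * Complex.I)‖ ≤ 0.04 := by
  have : ((1:ℂ) + δ + t * Complex.I) - (1.01 + t * Complex.I) = ((δ - 0.01 : ℝ) : ℂ) := by
    push_cast; ring
  rw [this, Complex.norm_real, Real.norm_eq_abs, abs_le]
  constructor <;> linarith

/-- `Re ζ'/ζ` bound. -/
theorem pb_zeta_re (t δ : ℝ) (h0 : 0 < δ) (h2 : δ ≤ 0.05) :
    (-deriv riemannZeta (1 + δ + t * Complex.I) / riemannZeta (1 + δ + t * Complex.I)).re ≤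
      (1 / ((δ : ℂ) + t * Complex.I)).re + 700 * pbl 1 t := by
  obtain ⟨s, h1, h3⟩ := pbF_local t
  set z : ℂ := 1 + δ + t * Complex.I with hz
  have hre : z.re = 1 + δ := by simp [hz]
  have hF := pbF_ne z (by rw [hre]; linarith)
  have h4 := h3 z (pb_center_dist t δ (by linarith) h2) hF
  have hz1 : z ≠ 1 := by intro h; rw [h] at hre; simp at hre; linarith
  have hz1' : z - 1 ≠ 0 := sub_ne_zero.mpr hz1
  have hζ : riemannZeta z ≠ 0 := riemannZeta_ne_zero_of_one_le_re (by rw [hre]; linarith)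
  have hd : deriv pbF z = riemannZeta z + (z - 1) * deriv riemannZeta z := by
    have e : pbF =ᶠ[nhds z] fun s => (s - 1) * riemannZeta s := by
      filter_upwards [isOpen_ne.mem_nhds hz1] with s hs using pbF_eq s hs
    rw [e.deriv_eq]
    have := ((hasDerivAt_id z).sub_const 1).mul (differentiableAt_riemannZeta hz1).hasDerivAt
    have h5 := this.deriv
    simp only [id] at h5
    rw [one_mul] at h5
    exact h5
  have hl : deriv pbF z / pbF z = 1 / (z - 1) + deriv riemannZeta z / riemannZeta z := by
    rw [hd, pbF_eq z hz1]; field_simp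
  rw [hl] at h4
  have h5 := (Complex.abs_re_le_norm _).trans h4
  rw [abs_le] at h5
  have h6 := pb_multiset_re_nonneg s z (fun ρ hρ => by
    by_contra hcon
    push Not at hcon
    exact pbF_ne ρ (by rw [hre] at hcon; linarith) (h1 ρ hρ))
  have h7 : z - 1 = (δ : ℂ) + t * Complex.I := by rw [hz]; ring
  rw [h7] at h5
  simp only [Complex.sub_re, Complex.add_re] at h5
  rw [neg_div, Complex.neg_re]
  linarith [h5.1]

theorem pb_L_re_zeros {q : ℕ} [NeZero q] (χ : DirichletCharacter ℂ q) (hχ : χ ≠ 1) (t δ : ℝ)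
    (h0 : 0 < δ) (h2 : δ ≤ 0.05) (Z : Multiset ℂ) (hZ : Z.Nodup)
    (hZ0 : ∀ ρ ∈ Z, ‖ρ - (1.01 + t * Complex.I)‖ ≤ 0.16 ∧ DirichletCharacter.LFunction χ ρ = 0) :
    (-deriv (DirichletCharacter.LFunction χ) (1 + δ + t * Complex.I) /
      DirichletCharacter.LFunction χ (1 + δ + t * Complex.I)).re ≤
      350 * pbl q t - ((Z.map (fun ρ => 1 / ((1 + δ + t * Complex.I) - ρ))).sum).re := by
  obtain ⟨s, h1, h1', _, h3⟩ := pb_L_local χ hχ t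
  set z : ℂ := 1 + δ + t * Complex.I with hz
  have hre : z.re = 1 + δ := by simp [hz]
  have hL : DirichletCharacter.LFunction χ z ≠ 0 :=
    DirichletCharacter.LFunction_ne_zero_of_one_le_re χ (Or.inl hχ) (by rw [hre]; linarith)
  have h4 := h3 z (pb_center_dist t δ (by linarith) h2) hL
  have hle : Z ≤ s := by
    rw [Multiset.le_iff_subset hZ]
    intro ρ hρ
    exact h1' ρ (hZ0 ρ hρ).1 (hZ0 ρ hρ).2
  obtain ⟨s', rfl⟩ := Multiset.le_iff_exists_add.mp hle
  have h5 := (Complex.abs_re_le_norm _).trans h4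
  rw [abs_le] at h5
  have h6 := pb_multiset_re_nonneg s' z (fun ρ hρ => by
    by_contra hcon
    push Not at hcon
    exact DirichletCharacter.LFunction_ne_zero_of_one_le_re χ (Or.inl hχ) (by rw [hre] at hcon; linarith)
      (h1 ρ (Multiset.mem_add.mpr (Or.inr hρ))).2)
  rw [Multiset.map_add, Multiset.sum_add] at h5
  simp only [Complex.sub_re, Complex.add_re] at h5
  rw [neg_div, Complex.neg_re]
  linarith [h5.1]

end

section

theorem pb_quad_val {q : ℕ} (χ : DirichletCharacter ℂ q) (h : χ ^ 2 = 1) (a : ZMod q) :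
    χ a = 0 ∨ χ a = 1 ∨ χ a = -1 := by
  by_cases ha : IsUnit a
  · right
    have h1 : (χ ^ 2) a = 1 := by rw [h]; exact MulChar.one_apply ha
    rw [MulChar.pow_apply' _ (by norm_num)] at h1
    have h2 : (χ a - 1) * (χ a + 1) = 0 := by linear_combination h1
    rcases mul_eq_zero.mp h2 with h3 | h3
    · left; linear_combination h3
    · right; linear_combination h3
  · left; exact MulChar.map_nonunit χ ha

theorem pb_re_cpow (n : ℕ) (hn : n ≠ 0) (s : ℂ) :
    (1 / (n:ℂ) ^ s).re = (n:ℝ) ^ (-s.re) * Real.cos (s.im * Real.log n) := by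
  have hn' : (n:ℂ) ≠ 0 := by exact_mod_cast hn
  have hn0 : (0:ℝ) < n := by positivity
  rw [one_div, ← Complex.cpow_neg, Complex.cpow_def_of_ne_zero hn', Complex.exp_re,
    ← Complex.natCast_log]
  have e1 : ((Real.log n : ℂ) * -s).re = -s.re * Real.log n := by
    rw [Complex.re_ofReal_mul, Complex.neg_re]; ring
  have e2 : ((Real.log n : ℂ) * -s).im = -(s.im * Real.log n) := by
    rw [Complex.im_ofReal_mul, Complex.neg_im]; ring
  rw [e1, e2, Real.cos_neg, Real.rpow_def_of_pos hn0]
  ring_nf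

theorem pb_hasSum_zeta (s : ℂ) (hs : 1 < s.re) :
    HasSum (fun n : ℕ => ArithmeticFunction.vonMangoldt n * ((n:ℝ) ^ (-s.re) *
      Real.cos (s.im * Real.log n))) (-deriv riemannZeta s / riemannZeta s).re := by
  have h1 := (ArithmeticFunction.LSeriesSummable_vonMangoldt hs).hasSum
  have h2 := Complex.hasSum_re h1
  have h3 := ArithmeticFunction.LSeries_vonMangoldt_eq_deriv_riemannZeta_div hs
  rw [LSeries] at h3
  rw [h3] at h2
  refine h2.congr_fun ?_
  intro n
  by_cases hn : n = 0
  · subst hn; simp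
  · rw [LSeries.term_of_ne_zero hn, ← pb_re_cpow n hn s, ← Complex.re_ofReal_mul]
    congr 1; ring

theorem pb_hasSum_L {q : ℕ} [NeZero q] (χ : DirichletCharacter ℂ q) (hχ : χ ^ 2 = 1)
    (s : ℂ) (hs : 1 < s.re) :
    HasSum (fun n : ℕ => ArithmeticFunction.vonMangoldt n * ((χ n).re * ((n:ℝ) ^ (-s.re) *
      Real.cos (s.im * Real.log n)))) (-deriv (DirichletCharacter.LFunction χ) s /
        DirichletCharacter.LFunction χ s).re := by
  have h1 := (DirichletCharacter.LSeriesSummable_twist_vonMangoldt χ hs).hasSum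
  have h2 := Complex.hasSum_re h1
  have h3 := DirichletCharacter.LSeries_twist_vonMangoldt_eq χ hs
  rw [← DirichletCharacter.deriv_LFunction_eq_deriv_LSeries χ hs,
    ← DirichletCharacter.LFunction_eq_LSeries χ hs, LSeries] at h3
  rw [h3] at h2
  refine h2.congr_fun ?_
  intro n
  by_cases hn : n = 0
  · subst hn; simp
  · rw [LSeries.term_of_ne_zero hn, ← pb_re_cpow n hn s, Pi.mul_apply]
    rcases pb_quad_val χ hχ n with h | h | h
    · simp [h]
    · rw [h, Complex.one_re, one_mul, ← Complex.re_ofReal_mul (ArithmeticFunction.vonMangoldt n)]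
      congr 1; ring
    · rw [h]
      simp only [Complex.neg_re, Complex.one_re, neg_mul, one_mul, mul_neg]
      rw [← Complex.re_ofReal_mul (ArithmeticFunction.vonMangoldt n), ← Complex.neg_re]
      congr 1; ring

theorem pb_341 {q : ℕ} [NeZero q] (χ : DirichletCharacter ℂ q) (hχ : χ ^ 2 = 1) (σ γ : ℝ)
    (hσ : 1 < σ) :
    0 ≤ 3 * (-deriv riemannZeta σ / riemannZeta σ).re +
      4 * (-deriv (DirichletCharacter.LFunction χ) (σ + γ * Complex.I) /
        DirichletCharacter.LFunction χ (σ + γ * Complex.I)).re +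
      (-deriv riemannZeta (σ + (2 * γ : ℝ) * Complex.I) /
        riemannZeta (σ + (2 * γ : ℝ) * Complex.I)).re := by
  have h1 := pb_hasSum_zeta σ (by simpa using hσ)
  have h2 := pb_hasSum_L χ hχ (σ + γ * Complex.I) (by simpa using hσ)
  have h3 := pb_hasSum_zeta (σ + (2 * γ : ℝ) * Complex.I) (by simpa using hσ)
  have h := ((h1.mul_left 3).add (h2.mul_left 4)).add h3
  refine h.nonneg ?_
  intro n
  have e1 : (((σ:ℂ) + γ * Complex.I)).re = σ := by simp
  have e2 : (((σ:ℂ) + γ * Complex.I)).im = γ := by simp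
  have e3 : (((σ:ℂ) + (2 * γ : ℝ) * Complex.I)).re = σ := by simp
  have e4 : (((σ:ℂ) + (2 * γ : ℝ) * Complex.I)).im = 2 * γ := by simp
  rw [e1, e2, e3, e4]
  have e5 : 2 * γ * Real.log n = 2 * (γ * Real.log n) := by ring
  rw [e5, Real.cos_two_mul]
  simp only [Complex.ofReal_re, Complex.ofReal_im, zero_mul, Real.cos_zero, mul_one]
  set c := Real.cos (γ * Real.log n)
  have hc : c ^ 2 ≤ 1 := by
    have := Real.cos_sq_le_one (γ * Real.log n); exact this
  have hv : 0 ≤ ArithmeticFunction.vonMangoldt n := ArithmeticFunction.vonMangoldt_nonneg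
  have hp : 0 ≤ (n:ℝ) ^ (-σ) := by positivity
  have : 3 * (ArithmeticFunction.vonMangoldt n * (n:ℝ) ^ (-σ)) +
      4 * (ArithmeticFunction.vonMangoldt n * ((χ n).re * ((n:ℝ) ^ (-σ) * c))) +
      ArithmeticFunction.vonMangoldt n * ((n:ℝ) ^ (-σ) * (2 * c ^ 2 - 1)) =
      (ArithmeticFunction.vonMangoldt n * (n:ℝ) ^ (-σ)) * (2 + 4 * (χ n).re * c + 2 * c ^ 2) := by
    ring
  rw [this]
  refine mul_nonneg (mul_nonneg hv hp) ?_
  rcases pb_quad_val χ hχ n with h | h | h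
  · simp [h]; nlinarith
  · simp [h]; nlinarith [sq_nonneg (1 + c)]
  · simp [h]; nlinarith [sq_nonneg (1 - c)]

theorem pb_11 {q : ℕ} [NeZero q] (χ : DirichletCharacter ℂ q) (hχ : χ ^ 2 = 1) (σ : ℝ)
    (hσ : 1 < σ) :
    0 ≤ (-deriv riemannZeta σ / riemannZeta σ).re +
      (-deriv (DirichletCharacter.LFunction χ) σ / DirichletCharacter.LFunction χ σ).re := by
  have h1 := pb_hasSum_zeta σ (by simpa using hσ)
  have h2 := pb_hasSum_L χ hχ σ (by simpa using hσ)
  refine (h1.add h2).nonneg ?_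
  intro n
  simp only [Complex.ofReal_re, Complex.ofReal_im, zero_mul, Real.cos_zero, mul_one]
  have hv : 0 ≤ ArithmeticFunction.vonMangoldt n := ArithmeticFunction.vonMangoldt_nonneg
  have hp : 0 ≤ (n:ℝ) ^ (-σ) := by positivity
  rw [← mul_add]
  refine mul_nonneg hv ?_
  rcases pb_quad_val χ hχ n with h | h | h <;> simp [h] <;> linarith

theorem pb_L_conj {q : ℕ} [NeZero q] (χ : DirichletCharacter ℂ q) (hχ1 : χ ≠ 1) (hχ : χ ^ 2 = 1)
    (s : ℂ) (hs : 0 < s.re) : DirichletCharacter.LFunction χ (starRingEnd ℂ s) =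
      starRingEnd ℂ (DirichletCharacter.LFunction χ s) := by
  have hd := DirichletCharacter.differentiable_LFunction hχ1
  have key := pb_halfplane_eq 0 (by norm_num) (DirichletCharacter.LFunction χ)
    (fun s => starRingEnd ℂ (DirichletCharacter.LFunction χ (starRingEnd ℂ s)))
    (fun s _ => hd s) (fun s _ => differentiableAt_conj_conj_iff.mpr (hd _)) (by
      intro s hs
      rw [DirichletCharacter.LFunction_eq_LSeries χ hs,
        DirichletCharacter.LFunction_eq_LSeries χ (by simpa using hs), LSeries, LSeries,
        Complex.conj_tsum]
      refine tsum_congr fun n => ?_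
      by_cases hn : n = 0
      · subst hn; simp
      · rw [LSeries.term_of_ne_zero hn, LSeries.term_of_ne_zero hn, map_div₀,
          ← Complex.conj_cpow _ _ (by rw [Complex.natCast_arg]; exact Real.pi_pos.ne),
          Complex.conj_natCast]
        rcases pb_quad_val χ hχ n with h | h | h <;> simp [h]) s hs
  rw [key, Complex.conj_conj]

theorem pb_re_inv (x y : ℝ) : (1 / ((x:ℂ) + y * Complex.I)).re = x / (x^2 + y^2) := by
  rw [one_div, Complex.inv_re, Complex.normSq_apply]
  simp
  ring_nf

theorem pbl_two (q : ℕ) [NeZero q] (γ : ℝ) : pbl 1 (2 * γ) ≤ 2 * pbl q γ ∧ pbl 1 0 ≤ pbl q γ ∧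
    pbl q 0 ≤ pbl q γ := by
  have hq : (1:ℝ) ≤ q := by exact_mod_cast NeZero.one_le
  have hγ := abs_nonneg γ
  refine ⟨?_, ?_, ?_⟩
  · rw [pbl, pbl, show (2:ℝ) * Real.log (q * (|γ|+3)) = Real.log ((q * (|γ|+3))^2) by
      rw [Real.log_pow]; norm_num]
    apply Real.log_le_log (by positivity)
    rw [abs_mul]
    norm_num
    have : |γ| + 3 ≤ q * (|γ|+3) := by nlinarith
    nlinarith
  · rw [pbl, pbl]
    apply Real.log_le_log (by positivity)
    norm_num
    nlinarith
  · rw [pbl, pbl]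
    apply Real.log_le_log (by positivity)
    norm_num
    gcongr
    linarith

/-- Zero-free region off the real axis for real characters. -/
theorem pb_zero_free {q : ℕ} [NeZero q] (χ : DirichletCharacter ℂ q) (hχ1 : χ ≠ 1) (hχ : χ ^ 2 = 1)
    (ρ : ℂ) (h0 : DirichletCharacter.LFunction χ ρ = 0) (him : ρ.im ≠ 0) :
    ρ.re ≤ 1 - 1 / 2000000 / pbl q ρ.im := by
  by_contra hcon
  push Not at hcon
  set γ := ρ.im with hγ
  set l := pbl q γ with hl
  have hl1 : 1 ≤ l := pbl_one_le q γ
  obtain ⟨hl2, hl3, hl4⟩ := pbl_two q γ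
  set η := 1 - ρ.re with hη
  have hη0 : 0 < η := by
    by_contra hneg
    push Not at hneg
    exact DirichletCharacter.LFunction_ne_zero_of_one_le_re χ (Or.inl hχ1) (by linarith) h0
  set δ := 1 / 200000 / l with hδ
  have hδ0 : 0 < δ := by positivity
  have hδl : δ * l = 1/200000 := by rw [hδ]; field_simp
  have hδ1 : δ ≤ 1/200000 := by nlinarith
  have hηδ : η < δ / 10 := by
    have : δ / 10 = 1/2000000/l := by rw [hδ]; ring
    linarith
  have hlδ : l = 1/200000 * (1/δ) := by field_simp; linarith
  set w := 1/δ with hw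
  have hw0 : 0 < w := by positivity
  have hρ : ρ = ((1 - η : ℝ) : ℂ) + γ * Complex.I := by
    apply Complex.ext <;> simp [hη, hγ]
  have z1 := pb_zeta_re 0 δ hδ0 (by linarith)
  rw [pb_re_inv] at z1
  have e0 : δ / (δ^2 + 0^2) = w := by rw [hw]; field_simp; ring
  rw [e0] at z1
  by_cases hcase : δ / 2 ≤ |γ|
  · have a1 := pb_341 χ hχ (1 + δ) γ (by linarith)
    have z2 := pb_zeta_re (2 * γ) δ hδ0 (by linarith)
    rw [pb_re_inv] at z2
    have z3 := pb_L_re_zeros χ hχ1 γ δ hδ0 (by linarith) {ρ} (by simp) (by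
      intro ρ' hρ'
      rw [Multiset.mem_singleton] at hρ'
      subst hρ'
      refine ⟨?_, h0⟩
      have : ρ' - (1.01 + γ * Complex.I) = ((-η - 0.01 : ℝ) : ℂ) := by rw [hρ]; push_cast; ring
      rw [this, Complex.norm_real, Real.norm_eq_abs, abs_le]
      constructor <;> linarith)
    simp only [Multiset.map_singleton, Multiset.sum_singleton] at z3
    have e1 : (1 + (δ:ℂ) + γ * Complex.I) - ρ = ((δ + η : ℝ) : ℂ) + (0:ℝ) * Complex.I := by
      rw [hρ]; push_cast; ring
    rw [e1, pb_re_inv] at z3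
    have e2 : (δ + η) / ((δ+η)^2 + 0^2) = 1 / (δ + η) := by
      have : δ + η ≠ 0 := by positivity
      field_simp; ring
    rw [e2] at z3
    have e3 : 10/11 * w ≤ 1 / (δ + η) := by
      rw [hw, mul_one_div, div_le_div_iff₀ hδ0 (by positivity)]; linarith
    have e4 : δ / (δ^2 + (2*γ)^2) ≤ w / 2 := by
      have hsq : (δ/2)^2 ≤ γ^2 := by
        rw [← sq_abs γ]; gcongr
      rw [hw, show 1 / δ / 2 = 1 / (δ * 2) by ring, div_le_div_iff₀ (by positivity) (by positivity)]
      nlinarith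
    push_cast at a1 z1 z2 z3
    simp only [zero_mul, add_zero] at z1
    linarith
  · push Not at hcase
    have a1 := pb_11 χ hχ (1 + δ) (by linarith)
    have hne : ρ ≠ starRingEnd ℂ ρ := by
      intro h
      have := congrArg Complex.im h
      simp at this
      apply him; linarith
    have hρc : starRingEnd ℂ ρ = ((1 - η : ℝ) : ℂ) + (-γ : ℝ) * Complex.I := by
      apply Complex.ext <;> simp [hη, hγ]
    have hdist : ∀ g : ℝ, |g| < δ / 2 →
        ‖(((1 - η : ℝ) : ℂ) + g * Complex.I) - (1.01 + (0:ℝ) * Complex.I)‖ ≤ 0.16 := by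
      intro g hg
      have : (((1 - η : ℝ) : ℂ) + g * Complex.I) - (1.01 + (0:ℝ) * Complex.I) =
        ((-η - 0.01 : ℝ) : ℂ) + g * Complex.I := by push_cast; ring
      rw [this]
      refine (norm_add_le _ _).trans ?_
      rw [Complex.norm_real, norm_mul, Complex.norm_I, Complex.norm_real, Real.norm_eq_abs,
        Real.norm_eq_abs, abs_of_nonpos (by linarith)]
      linarith
    have z3 := pb_L_re_zeros χ hχ1 0 δ hδ0 (by linarith) {ρ, starRingEnd ℂ ρ} (by simpa using hne) (by
      intro ρ' hρ'
      simp only [Multiset.insert_eq_cons, Multiset.mem_cons, Multiset.mem_singleton] at hρ'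
      rcases hρ' with h | h
      · rw [h]; refine ⟨?_, h0⟩
        rw [hρ]; exact hdist γ hcase
      · rw [h]; refine ⟨?_, ?_⟩
        · rw [hρc]; exact hdist (-γ) (by rwa [abs_neg])
        · rw [pb_L_conj χ hχ1 hχ ρ (by linarith), h0, map_zero])
    simp only [Multiset.insert_eq_cons, Multiset.map_cons, Multiset.sum_cons,
      Multiset.map_singleton, Multiset.sum_singleton, Complex.add_re] at z3
    have e1 : (1 + (δ:ℂ) + (0:ℝ) * Complex.I) - ρ = ((δ + η : ℝ) : ℂ) + (-γ:ℝ) * Complex.I := by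
      rw [hρ]; push_cast; ring
    have e1' : (1 + (δ:ℂ) + (0:ℝ) * Complex.I) - starRingEnd ℂ ρ =
        ((δ + η : ℝ) : ℂ) + (γ:ℝ) * Complex.I := by
      rw [hρc]; push_cast; ring
    rw [e1, e1', pb_re_inv, pb_re_inv] at z3
    have hsq : γ^2 ≤ (δ/2)^2 := by
      rw [← sq_abs γ]; gcongr
    have e2 : 0.7 * w ≤ (δ + η) / ((δ+η)^2 + γ^2) := by
      rw [hw, mul_one_div, div_le_div_iff₀ hδ0 (by positivity)]
      nlinarith
    rw [neg_sq] at z3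
    push_cast at a1 z1 z3
    simp only [zero_mul, add_zero] at z1 z3
    linarith

end

section

theorem pb_logderiv_bound {q : ℕ} [NeZero q] (χ : DirichletCharacter ℂ q) (hχ : χ ≠ 1) (ν t δ : ℝ)
    (hν : 0 < ν) (hν2 : ν ≤ 0.02) (h1 : -(ν/2) ≤ δ) (h2 : δ ≤ 0.05)
    (hz : ∀ ρ, DirichletCharacter.LFunction χ ρ = 0 → |ρ.im - t| ≤ 1 → ρ.re ≤ 1 - ν) :
    DirichletCharacter.LFunction χ (1 + δ + t * Complex.I) ≠ 0 ∧
    ‖deriv (DirichletCharacter.LFunction χ) (1 + δ + t * Complex.I) /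
      DirichletCharacter.LFunction χ (1 + δ + t * Complex.I)‖ ≤ 35 * pbl q t / ν := by
  obtain ⟨s, h3, h3', h4, h5⟩ := pb_L_local χ hχ t
  set z : ℂ := 1 + δ + t * Complex.I with hzdef
  have hre : z.re = 1 + δ := by simp [hzdef]
  have him : z.im = t := by simp [hzdef]
  have hl := pbl_one_le q t
  have hL : DirichletCharacter.LFunction χ z ≠ 0 := by
    intro h
    have := hz z h (by rw [him]; simp)
    rw [hre] at this; linarith
  refine ⟨hL, ?_⟩
  have h6 := h5 z (pb_center_dist t δ (by linarith) h2) hL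
  have hsum : ‖(s.map (fun ρ => 1 / (z - ρ))).sum‖ ≤ Multiset.card s * (2 / ν) := by
    have h7 : ‖(s.map (fun ρ => 1 / (z - ρ))).sum‖ ≤ ((s.map (fun ρ => 1 / (z - ρ))).map norm).sum := by
      exact norm_multiset_sum_le _
    refine h7.trans ?_
    rw [Multiset.map_map]
    have : ∀ x ∈ s.map (norm ∘ fun ρ => 1 / (z - ρ)), x ≤ 2 / ν := by
      intro x hx
      rw [Multiset.mem_map] at hx
      obtain ⟨ρ, hρ, rfl⟩ := hx
      have h8 := h3 ρ hρ
      have h9 : |(ρ - (1.01 + t * Complex.I)).im| ≤ 0.16 := (Complex.abs_im_le_norm _).trans h8.1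
      have h10 : (ρ - (1.01 + t * Complex.I)).im = ρ.im - t := by simp
      rw [h10] at h9
      have h11 := hz ρ h8.2 (h9.trans (by norm_num))
      have h12 : ν / 2 ≤ ‖z - ρ‖ := by
        calc ν / 2 ≤ (z - ρ).re := by rw [Complex.sub_re, hre]; linarith
          _ ≤ _ := Complex.re_le_norm _
      simp only [Function.comp, norm_div, norm_one]
      calc 1 / ‖z - ρ‖ ≤ 1 / (ν/2) := by gcongr
        _ = 2 / ν := by field_simp
    have := Multiset.sum_le_card_nsmul _ _ this
    rw [Multiset.card_map, nsmul_eq_mul] at this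
    exact this
  have h13 : ‖deriv (DirichletCharacter.LFunction χ) z / DirichletCharacter.LFunction χ z‖ ≤
      350 * pbl q t + 14 * pbl q t * (2 / ν) := by
    calc _ = ‖(deriv (DirichletCharacter.LFunction χ) z / DirichletCharacter.LFunction χ z -
          (s.map (fun ρ => 1 / (z - ρ))).sum) + (s.map (fun ρ => 1 / (z - ρ))).sum‖ := by rw [sub_add_cancel]
      _ ≤ _ := norm_add_le _ _
      _ ≤ 350 * pbl q t + Multiset.card s * (2 / ν) := add_le_add h6 hsum
      _ ≤ _ := by gcongr
  refine h13.trans ?_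
  rw [le_div_iff₀ hν]
  have : (350 * pbl q t + 14 * pbl q t * (2 / ν)) * ν = 350 * pbl q t * ν + 28 * pbl q t := by
    field_simp
    ring
  rw [this]
  nlinarith

/-- Cesaro kernel. -/
noncomputable def pbk (x : ℝ) : ℂ :=
  Set.indicator (Set.Ioc 0 1) (fun _ => 1 : ℝ → ℂ) x - Set.indicator (Set.Ioc 0 1) (fun t => (t:ℂ) ^ (1:ℂ) : ℝ → ℂ) x

theorem pbk_eq (x : ℝ) (hx : 0 < x) : pbk x = ((max (1 - x) 0 : ℝ) : ℂ) := by
  unfold pbk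
  by_cases h : x ≤ 1
  · have : x ∈ Set.Ioc (0:ℝ) 1 := ⟨hx, h⟩
    rw [Set.indicator_of_mem this, Set.indicator_of_mem this, max_eq_left (by linarith)]
    simp
  · have : x ∉ Set.Ioc (0:ℝ) 1 := fun h' => h h'.2
    rw [Set.indicator_of_notMem this, Set.indicator_of_notMem this, max_eq_right (by linarith)]
    simp

theorem pbk_mellin (s : ℂ) (hs : 0 < s.re) : HasMellin pbk s (1 / (s * (s + 1))) := by
  have h1 := hasMellin_one_Ioc hs
  have h2 := hasMellin_cpow_Ioc 1 (s := s) (by simp; linarith)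
  have h3 := h1.1.sub h2.1 
  have h4 := hasMellin_sub h1.1 h2.1
  rw [h1.2, h2.2] at h4
  have hs0 : s ≠ 0 := by rintro rfl; simp at hs
  have hs1 : s + 1 ≠ 0 := by
    intro h
    have := congrArg Complex.re h
    simp at this; linarith
  have : 1 / (s * (s+1)) = 1 / s - 1 / (s+1) := by field_simp; ring
  rw [this]
  exact h4

theorem pb_ker_norm (σ y : ℝ) (hσ : 1 ≤ σ) :
    ‖1 / (((σ:ℂ) + y * Complex.I) * ((σ:ℂ) + y * Complex.I + 1))‖ ≤ (1 + y^2)⁻¹ := by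
  have hs : ‖(σ:ℂ) + y * Complex.I‖ ^2 = σ^2 + y^2 := by
    rw [Complex.sq_norm, Complex.normSq_apply]; simp; ring
  have hs1 : ‖(σ:ℂ) + y * Complex.I + 1‖ ^2 = (σ+1)^2 + y^2 := by
    rw [Complex.sq_norm, Complex.normSq_apply]; simp; ring
  rw [norm_div, norm_mul, norm_one, one_div]
  apply inv_anti₀ (by positivity)
  apply le_of_sq_le_sq _ (by positivity)
  rw [mul_pow, hs, hs1, sq]
  apply mul_le_mul <;> nlinarith [sq_nonneg y]

theorem pb_ker_cont (σ : ℝ) (hσ : 1 ≤ σ) :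
    Continuous (fun y : ℝ => 1 / (((σ:ℂ) + y * Complex.I) * ((σ:ℂ) + y * Complex.I + 1))) := by
  apply Continuous.div continuous_const (by fun_prop)
  intro y
  apply mul_ne_zero <;>
  · intro h
    have := congrArg Complex.re h
    simp at this; linarith

theorem pb_ker_integrable (σ : ℝ) (hσ : 1 ≤ σ) :
    MeasureTheory.Integrable (fun y : ℝ => 1 / (((σ:ℂ) + y * Complex.I) * ((σ:ℂ) + y * Complex.I + 1))) := by
  refine integrable_inv_one_add_sq.mono' (pb_ker_cont σ hσ).aestronglyMeasurable ?_
  filter_upwards with y using pb_ker_norm σ y hσ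

theorem pb_mellin_inv (σ x : ℝ) (hσ : 1 ≤ σ) (hx : 0 < x) :
    ∫ y : ℝ, (x:ℂ) ^ (-((σ:ℂ) + y * Complex.I)) *
      (1 / (((σ:ℂ) + y * Complex.I) * ((σ:ℂ) + y * Complex.I + 1))) =
      2 * Real.pi * ((max (1 - x) 0 : ℝ) : ℂ) := by
  have hm : ∀ y : ℝ, mellin pbk ((σ:ℂ) + y * Complex.I) =
      1 / (((σ:ℂ) + y * Complex.I) * ((σ:ℂ) + y * Complex.I + 1)) := fun y =>
    (pbk_mellin _ (by simp; linarith)).2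
  have hc : ContinuousAt pbk x := by
    have : (fun x : ℝ => ((max (1 - x) 0 : ℝ) : ℂ)) =ᶠ[nhds x] pbk := by
      filter_upwards [lt_mem_nhds hx] with z hz using (pbk_eq z hz).symm
    refine ContinuousAt.congr ?_ this
    fun_prop
  have h := mellinInv_mellin_eq σ pbk hx (pbk_mellin _ (by simp; linarith)).1 (by
    unfold Complex.VerticalIntegrable
    refine (pb_ker_integrable σ hσ).congr ?_
    filter_upwards with y using (hm y).symm) hc
  rw [mellinInv, pbk_eq x hx] at h
  simp_rw [hm] at h
  rw [← h]
  simp only [smul_eq_mul, Complex.real_smul]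
  push_cast
  have : (Real.pi:ℂ) ≠ 0 := by exact_mod_cast Real.pi_ne_zero
  rw [← mul_assoc, mul_one_div_cancel (mul_ne_zero two_ne_zero this), one_mul]

theorem pb_perron (a : ℕ → ℂ) (σ u : ℝ) (hσ : 1 ≤ σ) (hu : 0 < u) (hs : LSeriesSummable a σ) :
    ∫ y : ℝ, LSeries a ((σ:ℂ) + y * Complex.I) * (u:ℂ) ^ ((σ:ℂ) + y * Complex.I) *
      (1 / (((σ:ℂ) + y * Complex.I) * ((σ:ℂ) + y * Complex.I + 1))) =
      2 * Real.pi * ∑ n ∈ Finset.Icc 1 ⌊u⌋₊, a n * (1 - n / u) := by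
  set K : ℝ → ℂ := fun y => 1 / (((σ:ℂ) + y * Complex.I) * ((σ:ℂ) + y * Complex.I + 1)) with hK
  set F : ℕ → ℝ → ℂ := fun n y => LSeries.term a ((σ:ℂ) + y * Complex.I) n *
    (u:ℂ) ^ ((σ:ℂ) + y * Complex.I) * K y with hF
  have hu0 : (u:ℂ) ≠ 0 := by exact_mod_cast hu.ne'
  have hFe : ∀ n y, n ≠ 0 → F n y = a n * (((n / u : ℝ):ℂ) ^ (-((σ:ℂ) + y * Complex.I)) * K y) := by
    intro n y hn
    simp only [hF]
    rw [LSeries.term_of_ne_zero hn, Complex.ofReal_div, Complex.div_cpow_ofReal_nonneg (by positivity) hu.le,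
      Complex.cpow_neg, Complex.cpow_neg, Complex.ofReal_natCast]
    simp only [div_eq_mul_inv, inv_inv]
    ring
  have hnorm : ∀ n y, ‖F n y‖ = ‖LSeries.term a σ n‖ * u ^ σ * ‖K y‖ := by
    intro n y
    simp only [hF]
    rw [norm_mul, norm_mul, LSeries.norm_term_eq, LSeries.norm_term_eq,
      Complex.norm_cpow_eq_rpow_re_of_pos hu]
    simp
  have hKi := pb_ker_integrable σ hσ
  have hmeas : ∀ n, Continuous (F n) := by
    intro n
    simp only [hF]
    refine Continuous.mul (Continuous.mul ?_ ?_) (pb_ker_cont σ hσ)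
    · by_cases hn : n = 0
      · subst hn; simp only [LSeries.term_zero]; exact continuous_const
      · simp_rw [LSeries.term_of_ne_zero hn]
        have hn' : (n:ℂ) ≠ 0 := by exact_mod_cast hn
        refine Continuous.div continuous_const ?_ ?_
        · refine Continuous.const_cpow (by fun_prop) (Or.inl hn')
        · intro y; simp [Complex.cpow_eq_zero_iff, hn']
    · refine Continuous.const_cpow (by fun_prop) (Or.inl hu0)
  have hinteg : ∀ n, MeasureTheory.Integrable (F n) := by
    intro n
    refine ((hKi.norm).const_mul (‖LSeries.term a σ n‖ * u ^ σ)).mono' (hmeas n).aestronglyMeasurable ?_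
    filter_upwards with y
    rw [hnorm]
  have hsum : Summable fun n => ∫ y, ‖F n y‖ := by
    simp_rw [hnorm, MeasureTheory.integral_const_mul]
    exact (hs.norm.mul_right _).mul_right _
  have h := MeasureTheory.hasSum_integral_of_summable_integral_norm hinteg hsum
  have h1 : ∀ y : ℝ, ∑' n, F n y = LSeries a ((σ:ℂ) + y * Complex.I) * (u:ℂ) ^ ((σ:ℂ) + y * Complex.I) * K y := by
    intro y
    simp only [hF]
    rw [tsum_mul_right, tsum_mul_right]; rfl
  simp_rw [h1] at h
  rw [← h.tsum_eq, Finset.mul_sum]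
  have h2 : ∀ n : ℕ, n ≠ 0 → ∫ y, F n y = a n * (2 * Real.pi * ((max (1 - n / u) 0 : ℝ):ℂ)) := by
    intro n hn
    have : (fun y : ℝ => F n y) = fun y : ℝ => a n * (((n / u : ℝ):ℂ) ^ (-((σ:ℂ) + y * Complex.I)) * K y) := by
      funext y; exact hFe n y hn
    rw [this, MeasureTheory.integral_const_mul, pb_mellin_inv σ (n/u) hσ (by positivity)]
  rw [tsum_eq_sum (s := Finset.Icc 1 ⌊u⌋₊)]
  · apply Finset.sum_congr rfl
    intro n hn
    rw [Finset.mem_Icc] at hn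
    have hnu : (n:ℝ) ≤ u := (Nat.le_floor_iff hu.le).mp hn.2
    rw [h2 n (by omega), max_eq_left]
    · push_cast; ring
    · rw [sub_nonneg, div_le_one hu]; exact hnu
  · intro n hn
    by_cases hn0 : n = 0
    · subst hn0; simp [hF]
    · rw [h2 n hn0, max_eq_right]
      · simp
      · rw [Finset.mem_Icc, not_and_or] at hn
        have : ¬ (n:ℝ) ≤ u := by
          intro h; rcases hn with hn | hn
          · omega
          · exact hn (Nat.le_floor h)
        rw [sub_nonpos, one_le_div hu]; linarith

end

section

/-- twisted von Mangoldt coefficients -/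
noncomputable def pba {q : ℕ} (χ : DirichletCharacter ℂ q) (n : ℕ) : ℂ :=
  χ n * (ArithmeticFunction.vonMangoldt n : ℂ)

theorem pba_eq {q : ℕ} (χ : DirichletCharacter ℂ q) :
    pba χ = ((fun n : ℕ => χ n) * fun n => (ArithmeticFunction.vonMangoldt n : ℂ)) := rfl

theorem pba_norm {q : ℕ} (χ : DirichletCharacter ℂ q) (n : ℕ) :
    ‖pba χ n‖ ≤ ArithmeticFunction.vonMangoldt n := by
  unfold pba
  rw [norm_mul, Complex.norm_real, Real.norm_of_nonneg ArithmeticFunction.vonMangoldt_nonneg]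
  have := DirichletCharacter.norm_le_one χ (n : ZMod q)
  have h2 : 0 ≤ ArithmeticFunction.vonMangoldt n := ArithmeticFunction.vonMangoldt_nonneg
  nlinarith

theorem pba_L {q : ℕ} [NeZero q] (χ : DirichletCharacter ℂ q) (s : ℂ) (hs : 1 < s.re) :
    LSeries (pba χ) s = -(deriv (DirichletCharacter.LFunction χ) s / DirichletCharacter.LFunction χ s) := by
  rw [pba_eq, DirichletCharacter.LSeries_twist_vonMangoldt_eq χ hs,
    ← DirichletCharacter.deriv_LFunction_eq_deriv_LSeries χ hs,
    ← DirichletCharacter.LFunction_eq_LSeries χ hs, neg_div]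

theorem pba_bound {q : ℕ} [NeZero q] (χ : DirichletCharacter ℂ q) (δ y : ℝ) (h0 : 0 < δ) (h2 : δ ≤ 0.05) :
    ‖LSeries (pba χ) (((1 + δ : ℝ):ℂ) + y * Complex.I)‖ ≤ 1 / δ + 1400 := by
  have h1 := pb_hasSum_zeta (1 + δ + (0:ℝ) * Complex.I) (by simp; exact h0)
  have h3 := pb_zeta_re 0 δ h0 h2
  have h4 : (1 / ((δ : ℂ) + (0:ℝ) * Complex.I)).re = 1 / δ := by
    simp only [Complex.ofReal_zero, zero_mul, add_zero]
    rw [← Complex.ofReal_one, ← Complex.ofReal_div, Complex.ofReal_re]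
  have h5 : pbl 1 0 ≤ 2 := by
    unfold pbl
    have := Real.log_le_sub_one_of_pos (show (0:ℝ) < 3 by norm_num)
    norm_num
    linarith
  rw [h4] at h3
  have h6 : ∀ n : ℕ, ‖LSeries.term (pba χ) (((1 + δ : ℝ):ℂ) + y * Complex.I) n‖ ≤
      ArithmeticFunction.vonMangoldt n * ((n:ℝ) ^ (-(1 + δ + (0:ℝ) * Complex.I : ℂ).re) *
      Real.cos ((1 + δ + (0:ℝ) * Complex.I : ℂ).im * Real.log n)) := by
    intro n
    rw [LSeries.norm_term_eq]
    split_ifs with hn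
    · subst hn; simp
    · simp only [Complex.ofReal_zero, zero_mul, add_zero, Complex.add_re, Complex.one_re, Complex.ofReal_re,
        Complex.add_im, Complex.one_im, Complex.ofReal_im, Real.cos_zero, mul_one, Complex.mul_re,
        Complex.I_re, Complex.I_im, mul_zero, sub_zero]
      rw [Real.rpow_neg (by positivity), div_eq_mul_inv]
      gcongr
      exact pba_norm χ n
  have h7 := tsum_of_norm_bounded h1 h6
  unfold LSeries
  linarith

theorem pb_tail_le (T : ℝ) (hT : 0 < T) :
    ∫ y in (Set.Ioc (-T) T)ᶜ, (1 + y^2)⁻¹ ≤ 2 / T := by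
  rw [MeasureTheory.setIntegral_compl measurableSet_Ioc integrable_inv_one_add_sq,
    integral_univ_inv_one_add_sq, ← intervalIntegral.integral_of_le (by linarith), integral_inv_one_add_sq,
    Real.arctan_neg]
  have h := Real.arctan_inv_of_pos hT
  have h1 : Real.arctan T⁻¹ ≤ T⁻¹ := by
    have := Real.le_tan (Real.arctan_nonneg.mpr (inv_nonneg.mpr hT.le)) (Real.arctan_lt_pi_div_two T⁻¹)
    rwa [Real.tan_arctan] at this
  rw [div_eq_mul_inv]
  linarith

theorem pbl_mono (q : ℕ) [NeZero q] (t T : ℝ) (h : |t| ≤ T) : pbl q t ≤ pbl q T := by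
  have hq : (1:ℝ) ≤ q := by exact_mod_cast NeZero.one_le
  unfold pbl
  apply Real.log_le_log
  · have := abs_nonneg t; positivity
  · have h2 := h.trans (le_abs_self T)
    gcongr

theorem pb_contour {q : ℕ} [NeZero q] (χ : DirichletCharacter ℂ q) (hχ : χ ≠ 1) (ν δ T u : ℝ)
    (hν : 0 < ν) (hν2 : ν ≤ 0.02) (h1 : 0 < δ) (h2 : δ ≤ 0.05) (hT : 1 ≤ T) (hu : 1 ≤ u)
    (hz : ∀ ρ, DirichletCharacter.LFunction χ ρ = 0 → |ρ.im| ≤ T + 1 → ρ.re ≤ 1 - ν) :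
    2 * Real.pi * ‖∑ n ∈ Finset.Icc 1 ⌊u⌋₊, pba χ n * (1 - n / u)‖ ≤
      u ^ (1 + δ) * ((1 / δ + 1400) * (2 / T) + 2 * (35 * pbl q T / ν) / T) +
      2 * T * (35 * pbl q T / ν) * u ^ (1 - ν / 2) := by
  set B : ℝ := 35 * pbl q T / ν with hB
  have hl := pbl_one_le q T
  have hB0 : 0 ≤ B := by positivity
  have hu0 : 0 < u := by linarith
  have hu0' : (u:ℂ) ≠ 0 := by exact_mod_cast hu0.ne'
  set G : ℂ → ℂ := fun s => -(deriv (DirichletCharacter.LFunction χ) s / DirichletCharacter.LFunction χ s) *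
    (u:ℂ) ^ s * (1 / (s * (s + 1))) with hG
  have hLd : Differentiable ℂ (DirichletCharacter.LFunction χ) := DirichletCharacter.differentiable_LFunction hχ
  have hLd2 : Differentiable ℂ (deriv (DirichletCharacter.LFunction χ)) := by
    intro z
    exact (hLd.analyticAt z).deriv.differentiableAt
  -- pointwise facts in the strip
  have hstrip : ∀ s : ℂ, 1 - ν / 2 ≤ s.re → s.re ≤ 1 + δ → |s.im| ≤ T →
      DirichletCharacter.LFunction χ s ≠ 0 ∧
      ‖deriv (DirichletCharacter.LFunction χ) s / DirichletCharacter.LFunction χ s‖ ≤ B := by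
    intro s hs1 hs2 hs3
    have := pb_logderiv_bound χ hχ ν s.im (s.re - 1) hν hν2 (by linarith) (by linarith) (by
      intro ρ h0 hi
      refine hz ρ h0 ?_
      have : |ρ.im| = |(ρ.im - s.im) + s.im| := by ring_nf
      rw [this]
      linarith [abs_add_le (ρ.im - s.im) s.im])
    have he : (1:ℂ) + ((s.re - 1 : ℝ):ℂ) + s.im * Complex.I = s := by
      apply Complex.ext <;> simp
    rw [he] at this
    refine ⟨this.1, this.2.trans ?_⟩
    rw [hB]
    have := pbl_mono q s.im T hs3
    gcongr
  have hsne : ∀ s : ℂ, 0 < s.re → s * (s+1) ≠ 0 := by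
    intro s hs
    apply mul_ne_zero <;>
    · intro h
      have := congrArg Complex.re h
      simp at this; linarith
  have hGb : ∀ s : ℂ, 1 - ν / 2 ≤ s.re → s.re ≤ 1 + δ → |s.im| ≤ T →
      ‖G s‖ ≤ B * u ^ s.re * ‖1 / (s * (s+1))‖ := by
    intro s hs1 hs2 hs3
    simp only [hG]
    rw [norm_mul, norm_mul, norm_neg, Complex.norm_cpow_eq_rpow_re_of_pos hu0]
    gcongr
    exact (hstrip s hs1 hs2 hs3).2
  have hrect := Complex.integral_boundary_rect_eq_zero_of_differentiableOn G
    (((1 - ν/2 : ℝ):ℂ) + ((-T:ℝ):ℂ) * Complex.I) (((1 + δ : ℝ):ℂ) + (T:ℂ) * Complex.I) (by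
    intro s hs
    rw [Complex.mem_reProdIm] at hs
    simp only [Complex.add_re, Complex.ofReal_re, Complex.mul_re, Complex.I_re, mul_zero, Complex.ofReal_im,
      Complex.I_im, mul_one, add_zero, Complex.add_im, Complex.mul_im, zero_add, sub_self] at hs
    rw [Set.uIcc_of_le (by linarith), Set.uIcc_of_le (by linarith)] at hs
    have hs3 : |s.im| ≤ T := abs_le.mpr hs.2
    have := (hstrip s hs.1.1 hs.1.2 hs3).1
    have h3 := hsne s (by linarith [hs.1.1])
    apply DifferentiableAt.differentiableWithinAt
    simp only [hG]
    apply DifferentiableAt.mul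
    · apply DifferentiableAt.mul
      · exact ((hLd2 s).div (hLd s) this).neg
      · exact DifferentiableAt.const_cpow differentiableAt_id (Or.inl hu0')
    · exact DifferentiableAt.div (differentiableAt_const _) (by fun_prop) h3)
  simp only [Complex.add_re, Complex.ofReal_re, Complex.mul_re, Complex.I_re, mul_zero, Complex.ofReal_im,
      Complex.I_im, mul_one, add_zero, Complex.add_im, Complex.mul_im, zero_add, sub_self] at hrect
  have hnI : ∀ s : ℂ, |s.im| = T → ‖1 / (s * (s+1))‖ ≤ 1 / T := by
    intro s hs
    have e1 : T ≤ ‖s‖ := by rw [← hs]; exact Complex.abs_im_le_norm s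
    have e2 : T ≤ ‖s+1‖ := by
      have := Complex.abs_im_le_norm (s+1)
      simp only [Complex.add_im, Complex.one_im, add_zero, hs] at this
      exact this
    rw [norm_div, norm_one, norm_mul]
    apply one_div_le_one_div_of_le (by linarith)
    nlinarith
  have hhor : ∀ v : ℝ, |v| = T → ‖∫ x : ℝ in (1 - ν/2)..(1 + δ), G (x + v * Complex.I)‖ ≤
      B * u ^ (1 + δ) * (1 / T) := by
    intro v hv
    have := intervalIntegral.norm_integral_le_of_norm_le_const (a := 1 - ν/2) (b := 1 + δ)
      (C := B * u ^ (1 + δ) * (1 / T)) (f := fun x : ℝ => G (x + v * Complex.I)) (by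
      intro x hx
      rw [Set.uIoc_of_le (by linarith)] at hx
      have := hGb (x + v * Complex.I) (by simp; linarith [hx.1]) (by simp; linarith [hx.2]) (by simp [hv])
      refine this.trans ?_
      have h3 := hnI (x + v * Complex.I) (by simp [hv])
      have h4 : u ^ ((x:ℂ) + v * Complex.I).re ≤ u ^ (1 + δ) := by
        apply Real.rpow_le_rpow_of_exponent_le hu
        simp; exact hx.2
      gcongr)
    refine this.trans ?_
    have h5 : |1 + δ - (1 - ν/2)| ≤ 1 := by rw [abs_of_nonneg (by linarith)]; linarith
    have : 0 ≤ B * u ^ (1 + δ) * (1 / T) := by positivity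
    nlinarith
  have hleft : ‖∫ y : ℝ in (-T)..T, G (((1 - ν/2 : ℝ):ℂ) + y * Complex.I)‖ ≤ 2 * T * B * u ^ (1 - ν/2) := by
    have := intervalIntegral.norm_integral_le_of_norm_le_const (a := -T) (b := T)
      (C := B * u ^ (1 - ν/2)) (f := fun y : ℝ => G (((1 - ν/2 : ℝ):ℂ) + y * Complex.I)) (by
      intro y hy
      rw [Set.uIoc_of_le (by linarith)] at hy
      have hre : (((1 - ν/2 : ℝ):ℂ) + y * Complex.I).re = 1 - ν/2 := by simp
      have him : (((1 - ν/2 : ℝ):ℂ) + y * Complex.I).im = y := by simp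
      have := hGb (((1 - ν/2 : ℝ):ℂ) + y * Complex.I) (by rw [hre]) (by rw [hre]; linarith)
        (by rw [him, abs_le]; constructor <;> linarith [hy.1, hy.2])
      refine this.trans ?_
      rw [hre]
      have h3 : ‖1 / ((((1 - ν/2 : ℝ):ℂ) + y * Complex.I) * (((1 - ν/2 : ℝ):ℂ) + y * Complex.I + 1))‖ ≤ 1 := by
        have e1 := Complex.re_le_norm (((1 - ν/2 : ℝ):ℂ) + y * Complex.I)
        have e2 := Complex.re_le_norm (((1 - ν/2 : ℝ):ℂ) + y * Complex.I + 1)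
        rw [Complex.add_re _ 1, Complex.one_re] at e2
        rw [hre] at e1 e2
        rw [norm_div, norm_one, norm_mul, div_le_one (by nlinarith)]
        nlinarith
      have h4 : 0 ≤ B * u ^ (1 - ν/2) := by positivity
      nlinarith)
    refine this.trans (le_of_eq ?_)
    rw [abs_of_nonneg (by linarith)]; ring
  -- integral on the right line
  have hright : ‖∫ y : ℝ in (-T)..T, G (((1 + δ : ℝ):ℂ) + y * Complex.I)‖ ≤
      2 * (B * u ^ (1 + δ) * (1 / T)) + 2 * T * B * u ^ (1 - ν/2) := by
    have e1 := hhor (-T) (by rw [abs_neg, abs_of_nonneg]; linarith)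
    have e2 := hhor T (by rw [abs_of_nonneg]; linarith)
    set I1 := ∫ x : ℝ in (1 - ν/2)..(1 + δ), G (x + ((-T:ℝ):ℂ) * Complex.I)
    set I2 := ∫ x : ℝ in (1 - ν/2)..(1 + δ), G (x + (T:ℂ) * Complex.I)
    set I3 := ∫ y : ℝ in (-T)..T, G (((1 + δ : ℝ):ℂ) + y * Complex.I)
    set I4 := ∫ y : ℝ in (-T)..T, G (((1 - ν/2 : ℝ):ℂ) + y * Complex.I)
    have : Complex.I • I3 = Complex.I • I4 - I1 + I2 := by linear_combination hrect
    calc ‖I3‖ = ‖Complex.I • I3‖ := by rw [norm_smul, Complex.norm_I, one_mul]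
      _ = ‖Complex.I • I4 - I1 + I2‖ := by rw [this]
      _ ≤ ‖Complex.I • I4 - I1‖ + ‖I2‖ := norm_add_le _ _
      _ ≤ ‖Complex.I • I4‖ + ‖I1‖ + ‖I2‖ := by gcongr; exact norm_sub_le _ _
      _ = ‖I4‖ + ‖I1‖ + ‖I2‖ := by rw [norm_smul, Complex.norm_I, one_mul]
      _ ≤ _ := by linarith
  -- the full line
  have hLs : LSeriesSummable (pba χ) ((1 + δ : ℝ):ℂ) :=
    DirichletCharacter.LSeriesSummable_twist_vonMangoldt χ (by simp; exact h1)
  have hper := pb_perron (pba χ) (1 + δ) u (by linarith) hu0 hLs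
  set E : ℝ → ℂ := fun y : ℝ => LSeries (pba χ) (((1 + δ : ℝ):ℂ) + y * Complex.I) *
    (u:ℂ) ^ (((1 + δ : ℝ):ℂ) + y * Complex.I) *
      (1 / ((((1 + δ : ℝ):ℂ) + y * Complex.I) * (((1 + δ : ℝ):ℂ) + y * Complex.I + 1))) with hE
  have hEG : ∀ y : ℝ, E y = G (((1 + δ : ℝ):ℂ) + y * Complex.I) := by
    intro y
    simp only [hE, hG]
    rw [pba_L χ _ (by simp; exact h1)]
  have hEn : ∀ y : ℝ, ‖E y‖ ≤ (1 / δ + 1400) * u ^ (1 + δ) * (1 + y^2)⁻¹ := by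
    intro y
    simp only [hE]
    rw [norm_mul, norm_mul, Complex.norm_cpow_eq_rpow_re_of_pos hu0]
    have e0 : (((1 + δ : ℝ):ℂ) + y * Complex.I).re = 1 + δ := by simp
    rw [e0]
    gcongr
    · exact pba_bound χ δ y h1 h2
    · exact pb_ker_norm (1 + δ) y (by linarith)
  have hEc : Continuous E := by
    have : E = fun y : ℝ => G (((1 + δ : ℝ):ℂ) + y * Complex.I) := funext hEG
    rw [this]
    simp only [hG]
    refine Continuous.mul (Continuous.mul ?_ ?_) (pb_ker_cont (1 + δ) (by linarith))
    · apply Continuous.neg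
      apply Continuous.div
      · exact hLd2.continuous.comp (by fun_prop)
      · exact hLd.continuous.comp (by fun_prop)
      · intro y
        exact DirichletCharacter.LFunction_ne_zero_of_one_le_re χ (Or.inl hχ) (by simp; linarith)
    · refine Continuous.const_cpow (by fun_prop) (Or.inl hu0')
  have hEi : MeasureTheory.Integrable E := by
    refine (integrable_inv_one_add_sq.const_mul ((1 / δ + 1400) * u ^ (1 + δ))).mono' hEc.aestronglyMeasurable ?_
    filter_upwards with y using hEn y
  have hsplit := MeasureTheory.integral_add_compl (measurableSet_Ioc (a := -T) (b := T)) hEi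
  have htail : ‖∫ y in (Set.Ioc (-T) T)ᶜ, E y‖ ≤ (1 / δ + 1400) * u ^ (1 + δ) * (2 / T) := by
    have := MeasureTheory.norm_integral_le_of_norm_le (μ := MeasureTheory.volume.restrict (Set.Ioc (-T) T)ᶜ)
      (f := E) (g := fun y => (1 / δ + 1400) * u ^ (1 + δ) * (1 + y^2)⁻¹)
      ((integrable_inv_one_add_sq.const_mul _).integrableOn) (by filter_upwards with y using hEn y)
    refine this.trans ?_
    rw [MeasureTheory.integral_const_mul]
    have := pb_tail_le T (by linarith)
    gcongr
  have hmid : ∫ y in Set.Ioc (-T) T, E y = ∫ y : ℝ in (-T)..T, G (((1 + δ : ℝ):ℂ) + y * Complex.I) := by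
    rw [intervalIntegral.integral_of_le (by linarith)]
    simp_rw [hEG]
  have hfin : ‖∫ y, E y‖ ≤ 2 * (B * u ^ (1 + δ) * (1 / T)) + 2 * T * B * u ^ (1 - ν/2) +
      (1 / δ + 1400) * u ^ (1 + δ) * (2 / T) := by
    rw [← hsplit, hmid]
    exact (norm_add_le _ _).trans (add_le_add hright htail)
  have hpi := Real.pi_pos
  have : ‖∫ y, E y‖ = 2 * Real.pi * ‖∑ n ∈ Finset.Icc 1 ⌊u⌋₊, pba χ n * (1 - n / u)‖ := by
    rw [hper, norm_mul, norm_mul, Complex.norm_real, Real.norm_of_nonneg hpi.le]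
    simp
  rw [← this]
  refine hfin.trans (le_of_eq ?_)
  ring

end

section

theorem pb_abel (w : ℕ → ℝ) (c : ℕ → ℂ) (E : ℝ) (a b : ℕ) (hab : a ≤ b)
    (hw0 : ∀ n, a < n → 0 ≤ w n) (hw : ∀ n, a < n → w (n+1) ≤ w n)
    (hE : ∀ n, a ≤ n → n ≤ b → ‖∑ k ∈ Finset.Ioc a n, c k‖ ≤ E) :
    ‖∑ k ∈ Finset.Ioc a b, (w k : ℂ) * c k‖ ≤ E * w (a+1) := by
  have hE0 : 0 ≤ E := by have := hE a le_rfl hab; simpa using this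
  rcases hab.eq_or_lt with rfl | hlt
  · simp; exact mul_nonneg hE0 (hw0 _ (Nat.lt_succ_self _))
  have key : ∀ m, a + 1 ≤ m → m ≤ b → ‖∑ k ∈ Finset.Ioc a m, (w k : ℂ) * c k -
      w m * ∑ k ∈ Finset.Ioc a m, c k‖ ≤ E * (w (a+1) - w m) := by
    intro m hm
    induction m, hm using Nat.le_induction with
    | base => intro _; simp
    | succ m hm ih =>
      intro hmb
      have h1 := ih (by omega)
      have h2 := hE m (by omega) (by omega)
      have h3 := hw m (by omega)
      rw [Finset.sum_Ioc_succ_top (by omega), Finset.sum_Ioc_succ_top (by omega)]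
      set S := ∑ k ∈ Finset.Ioc a m, (w k : ℂ) * c k
      set C := ∑ k ∈ Finset.Ioc a m, c k
      have : S + w (m+1) * c (m+1) - w (m+1) * (C + c (m+1)) = (S - w m * C) + ((w m - w (m+1) : ℝ):ℂ) * C := by
        push_cast; ring
      rw [this]
      calc _ ≤ ‖S - w m * C‖ + ‖((w m - w (m+1) : ℝ):ℂ) * C‖ := norm_add_le _ _
        _ ≤ E * (w (a+1) - w m) + (w m - w (m+1)) * E := by
          rw [norm_mul, Complex.norm_real, Real.norm_of_nonneg (by linarith)]
          gcongr
        _ = _ := by ring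
  have h1 := key b hlt le_rfl
  have h2 := hE b hab le_rfl
  have h3 := hw0 b hlt
  calc _ = ‖(∑ k ∈ Finset.Ioc a b, (w k : ℂ) * c k - w b * ∑ k ∈ Finset.Ioc a b, c k) +
        w b * ∑ k ∈ Finset.Ioc a b, c k‖ := by rw [sub_add_cancel]
    _ ≤ _ := norm_add_le _ _
    _ ≤ E * (w (a+1) - w b) + w b * E := by
      rw [norm_mul, Complex.norm_real, Real.norm_of_nonneg h3]
      gcongr
    _ = _ := by ring

theorem pb_vm_le_log (n m : ℕ) (h : n ≤ m) (hm : 1 ≤ m) : ArithmeticFunction.vonMangoldt n ≤ Real.log m := by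
  refine ArithmeticFunction.vonMangoldt_le_log.trans ?_
  rcases Nat.eq_zero_or_pos n with rfl | hn
  · simp; exact Real.log_nonneg (by exact_mod_cast hm)
  · exact Real.log_le_log (by exact_mod_cast hn) (by exact_mod_cast h)

theorem pb_uncesaro {q : ℕ} (χ : DirichletCharacter ℂ q) (N h : ℕ) (hh : 1 ≤ h) (E : ℝ)
    (h1 : ‖∑ n ∈ Finset.Icc 1 N, pba χ n * (N - n)‖ ≤ E)
    (h2 : ‖∑ n ∈ Finset.Icc 1 (N + h), pba χ n * (((N + h : ℕ):ℂ) - n)‖ ≤ E) :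
    ‖∑ n ∈ Finset.Icc 1 N, pba χ n‖ ≤ 2 * E / h + h * Real.log ((N + h : ℕ):ℝ) := by
  have e1 : ∑ n ∈ Finset.Icc 1 (N + h), pba χ n * (((N + h : ℕ):ℂ) - n) =
      ∑ n ∈ Finset.Icc 1 N, pba χ n * (((N + h : ℕ):ℂ) - n) +
      ∑ n ∈ Finset.Ioc N (N + h), pba χ n * (((N + h : ℕ):ℂ) - n) := by
    have : ∀ M, Finset.Icc 1 M = Finset.Ioc 0 M := by intro M; ext; simp; omega
    rw [this, this, Finset.sum_Ioc_consecutive _ (Nat.zero_le _) (by omega)]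
  have e2 : ∑ n ∈ Finset.Icc 1 N, pba χ n * (((N + h : ℕ):ℂ) - n) =
      ∑ n ∈ Finset.Icc 1 N, pba χ n * (N - n) + h * ∑ n ∈ Finset.Icc 1 N, pba χ n := by
    rw [Finset.mul_sum, ← Finset.sum_add_distrib]
    apply Finset.sum_congr rfl
    intros; push_cast; ring
  have e3 : ‖∑ n ∈ Finset.Ioc N (N + h), pba χ n * (((N + h : ℕ):ℂ) - n)‖ ≤
      h * (h * Real.log ((N + h : ℕ):ℝ)) := by
    have hb : ∀ n ∈ Finset.Ioc N (N+h), ‖pba χ n * (((N + h : ℕ):ℂ) - n)‖ ≤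
        h * Real.log ((N + h : ℕ):ℝ) := by
      intro n hn
      rw [Finset.mem_Ioc] at hn
      rw [norm_mul, mul_comm]
      have a1 : ‖(((N + h : ℕ):ℂ) - n)‖ ≤ h := by
        rw [← Nat.cast_sub hn.2, Complex.norm_natCast]
        exact_mod_cast (by omega : N + h - n ≤ h)
      have a2 := (pba_norm χ n).trans (pb_vm_le_log n (N+h) hn.2 (by omega))
      gcongr
    refine (norm_sum_le_of_le _ hb).trans (le_of_eq ?_)
    simp
  have hh0 : (0:ℝ) < h := by exact_mod_cast hh
  set A := ∑ n ∈ Finset.Icc 1 N, pba χ n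
  have e4 : (h:ℂ) * A = ∑ n ∈ Finset.Icc 1 (N + h), pba χ n * (((N + h : ℕ):ℂ) - n) -
      ∑ n ∈ Finset.Icc 1 N, pba χ n * (N - n) -
      ∑ n ∈ Finset.Ioc N (N + h), pba χ n * (((N + h : ℕ):ℂ) - n) := by
    rw [e1, e2]; ring
  have e5 : h * ‖A‖ ≤ E + E + h * (h * Real.log ((N + h : ℕ):ℝ)) := by
    have : h * ‖A‖ = ‖(h:ℂ) * A‖ := by rw [norm_mul, Complex.norm_natCast]
    rw [this, e4]
    refine (norm_sub_le _ _).trans (add_le_add ((norm_sub_le _ _).trans (add_le_add h2 h1)) e3)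
  have : ‖A‖ ≤ (E + E + h * (h * Real.log ((N + h : ℕ):ℝ))) / h := by
    rw [le_div_iff₀ hh0]; linarith
  refine this.trans (le_of_eq ?_)
  field_simp
  ring

theorem pb_theta_psi {q : ℕ} (χ : DirichletCharacter ℂ q) (N : ℕ) (hN : 1 ≤ N) :
    ‖∑ n ∈ Finset.Ioc 0 N, (if n.Prime then χ n * (Real.log n : ℂ) else 0)‖ ≤
      ‖∑ n ∈ Finset.Icc 1 N, pba χ n‖ + 2 * Real.sqrt N * Real.log N := by
  have h := Chebyshev.abs_psi_sub_theta_le_sqrt_mul_log (x := N) (by exact_mod_cast hN)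
  have e1 : Chebyshev.psi N - Chebyshev.theta N = ∑ n ∈ Finset.Ioc 0 N,
      (if n.Prime then 0 else ArithmeticFunction.vonMangoldt n) := by
    rw [Chebyshev.psi, Chebyshev.theta, Nat.floor_natCast, Finset.sum_filter, ← Finset.sum_sub_distrib]
    apply Finset.sum_congr rfl
    intro n _
    split_ifs with hp
    · rw [ArithmeticFunction.vonMangoldt_apply_prime hp]; simp
    · simp
  have e2 : ∑ n ∈ Finset.Ioc 0 N, (if n.Prime then χ n * (Real.log n : ℂ) else 0) =
      ∑ n ∈ Finset.Icc 1 N, pba χ n - ∑ n ∈ Finset.Ioc 0 N, (if n.Prime then 0 else pba χ n) := by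
    have : Finset.Icc 1 N = Finset.Ioc 0 N := by ext; simp; omega
    rw [this, ← Finset.sum_sub_distrib]
    apply Finset.sum_congr rfl
    intro n _
    split_ifs with hp
    · rw [pba, ArithmeticFunction.vonMangoldt_apply_prime hp]; simp
    · simp
  rw [e2]
  refine (norm_sub_le _ _).trans ?_
  gcongr
  refine le_trans ?_ ((le_abs_self _).trans h)
  rw [e1]
  refine norm_sum_le_of_le _ ?_
  intro n _
  split_ifs
  · simp
  · exact pba_norm χ n

theorem pb_primes_of_theta {q : ℕ} (χ : DirichletCharacter ℂ q) (E : ℝ) (M : ℕ)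
    (hE : ∀ N, N ≤ M → ‖∑ n ∈ Finset.Ioc 0 N, (if n.Prime then χ n * (Real.log n : ℂ) else 0)‖ ≤ E)
    (a b : ℕ) (ha : 1 ≤ a) (hab : a ≤ b) (hb : b ≤ M) :
    ‖∑ n ∈ Finset.Ioc a b, (if n.Prime then χ n else 0)‖ ≤ 4 * E := by
  have hE0 : 0 ≤ E := by simpa using hE 0 (Nat.zero_le _)
  have h := pb_abel (fun n => (Real.log n)⁻¹) (fun n => if n.Prime then χ n * (Real.log n : ℂ) else 0) (2 * E) a b hab
    (by intro n hn; exact inv_nonneg.mpr (Real.log_nonneg (by exact_mod_cast (by omega : 1 ≤ n))))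
    (by
      intro n hn
      apply inv_anti₀
      · exact Real.log_pos (by exact_mod_cast (by omega : 1 < n))
      · apply Real.log_le_log <;> norm_cast <;> omega)
    (by
      intro n h1 h2
      have h3 := hE n (by omega)
      have h4 := hE a (by omega)
      have : ∑ k ∈ Finset.Ioc a n, (if k.Prime then χ k * (Real.log k : ℂ) else 0) =
        ∑ k ∈ Finset.Ioc 0 n, (if k.Prime then χ k * (Real.log k : ℂ) else 0) -
        ∑ k ∈ Finset.Ioc 0 a, (if k.Prime then χ k * (Real.log k : ℂ) else 0) := by
        rw [← Finset.sum_Ioc_consecutive _ (Nat.zero_le a) h1]; ring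
      rw [this]
      refine (norm_sub_le _ _).trans (by linarith))
  have e : ∑ n ∈ Finset.Ioc a b, (((Real.log n)⁻¹ : ℝ):ℂ) * (if n.Prime then χ n * (Real.log n : ℂ) else 0) =
      ∑ n ∈ Finset.Ioc a b, (if n.Prime then χ n else 0) := by
    apply Finset.sum_congr rfl
    intro n hn
    split_ifs with hp
    · have : Real.log n ≠ 0 := (Real.log_pos (by exact_mod_cast hp.one_lt)).ne'
      have : (Real.log n : ℂ) ≠ 0 := by exact_mod_cast this
      rw [Complex.ofReal_inv]
      field_simp
    · simp
  rw [e] at h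
  refine h.trans ?_
  have h2 : (Real.log ((a+1 : ℕ):ℝ))⁻¹ ≤ 2 := by
    have : (2:ℝ)⁻¹ ≤ Real.log ((a+1 : ℕ):ℝ) := by
      have h1 : Real.log 2 ≤ Real.log ((a+1 : ℕ):ℝ) := by
        apply Real.log_le_log (by norm_num); exact_mod_cast (by omega : 2 ≤ a + 1)
      have := Real.log_two_gt_d9
      linarith
    rw [inv_le_comm₀ (by linarith) (by norm_num)]
    exact this
  nlinarith

theorem pb_pnt_core {q : ℕ} [NeZero q] (χ : DirichletCharacter ℂ q) (hχ : χ ≠ 1) (Λ y ν : ℝ)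
    (hy : 100 ≤ y) (hν : 0 < ν) (hν2 : ν ≤ 0.02) (hνΛ : 20 * y ≤ ν * Λ)
    (hB : 35 * pbl q (Real.exp (4 * y)) / ν ≤ Real.exp (y / 4))
    (hΛ : Λ + 1400 ≤ Real.exp (y / 4))
    (hz : ∀ ρ, DirichletCharacter.LFunction χ ρ = 0 → |ρ.im| ≤ Real.exp (4 * y) + 1 → ρ.re ≤ 1 - ν)
    (a b : ℕ) (ha : 1 ≤ a) (hab : a ≤ b) (hb : (b:ℝ) ≤ Real.exp Λ) :
    ‖∑ n ∈ Finset.Ioc a b, (if n.Prime then χ n else 0)‖ ≤ Real.exp (Λ - y) := by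
  have hΛy : 1000 * y ≤ Λ := by nlinarith
  have hΛ0 : 0 < Λ := by linarith
  set T := Real.exp (4 * y) with hT
  set B := 35 * pbl q T / ν with hBd
  have hB0 : 0 ≤ B := by have := pbl_one_le q T; positivity
  have hT1 : 1 ≤ T := Real.one_le_exp (by linarith)
  have hx1 : 1 ≤ Real.exp Λ := Real.one_le_exp hΛ0.le
  have h25 : (2:ℝ)^10 ≤ Real.exp (y / 4) := by
    have h1 : (2:ℝ) ≤ Real.exp 1 := by linarith [Real.add_one_le_exp 1]
    calc (2:ℝ)^10 ≤ (Real.exp 1)^10 := by gcongr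
      _ = Real.exp 10 := by rw [← Real.exp_nat_mul]; norm_num
      _ ≤ _ := Real.exp_le_exp.mpr (by linarith)
  -- Cesaro bound
  have hces : ∀ N : ℕ, (N:ℝ) ≤ 2 * Real.exp Λ → ‖∑ n ∈ Finset.Icc 1 N, pba χ n * (N - n)‖ ≤
      Real.exp (2 * Λ - 3.5 * y) := by
    intro N hN
    rcases Nat.eq_zero_or_pos N with rfl | hN0
    · simp; positivity
    have hN1 : (1:ℝ) ≤ N := by exact_mod_cast hN0
    have h := pb_contour χ hχ ν (1/Λ) T N hν hν2 (by positivity)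
      (by rw [div_le_iff₀ hΛ0]; linarith) hT1 hN1 hz
    rw [Nat.floor_natCast] at h
    set S := ∑ n ∈ Finset.Icc 1 N, pba χ n * (1 - (n:ℂ) / ((N:ℝ):ℂ)) with hS
    have e1 : ∑ n ∈ Finset.Icc 1 N, pba χ n * (N - n) = N * S := by
      rw [hS, Finset.mul_sum]
      apply Finset.sum_congr rfl
      intro n _
      have : (N:ℂ) ≠ 0 := by exact_mod_cast hN0.ne'
      push_cast
      field_simp
    rw [e1, norm_mul, Complex.norm_natCast]
    have hpi := Real.pi_gt_three
    have h2 : ‖S‖ ≤ 2 * Real.pi * ‖S‖ := by nlinarith [norm_nonneg S]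
    have h3 := h2.trans h
    -- powers
    have p1 : (N:ℝ) ^ (1 + 1/Λ) ≤ 16 * Real.exp Λ := by
      have : (N:ℝ) ≤ Real.exp (Λ + 1) := by
        refine hN.trans ?_
        rw [Real.exp_add, mul_comm]
        gcongr
        linarith [Real.add_one_le_exp 1]
      calc (N:ℝ) ^ (1 + 1/Λ) ≤ (Real.exp (Λ + 1)) ^ (1 + 1/Λ) := by gcongr
        _ = Real.exp (Λ + (2 + 1/Λ)) := by rw [← Real.exp_mul]; congr 1; field_simp; ring
        _ ≤ Real.exp (Λ + 2.5) := by
          apply Real.exp_le_exp.mpr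
          have : 1/Λ ≤ 0.5 := by rw [div_le_iff₀ hΛ0]; linarith
          linarith
        _ = Real.exp 2.5 * Real.exp Λ := by rw [Real.exp_add, mul_comm]
        _ ≤ _ := by
          gcongr
          have h8 : Real.exp 2.5 = (Real.exp 0.5)^5 := by rw [← Real.exp_nat_mul]; norm_num
          have h9 : Real.exp 0.5 ≤ 1.7 := by
            apply le_of_sq_le_sq _ (by norm_num)
            rw [← Real.exp_nat_mul]; norm_num
            linarith [Real.exp_one_lt_d9]
          rw [h8]
          calc (Real.exp 0.5)^5 ≤ 1.7^5 := by gcongr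
            _ ≤ 16 := by norm_num
    have p2 : (N:ℝ) ^ (1 - ν/2) ≤ 2 * Real.exp (Λ - 10 * y) := by
      calc (N:ℝ) ^ (1 - ν/2) ≤ (2 * Real.exp Λ) ^ (1 - ν/2) := by gcongr; linarith
        _ = 2 ^ (1 - ν/2) * Real.exp (Λ * (1 - ν/2)) := by
          rw [Real.mul_rpow (by norm_num) (by positivity), ← Real.exp_mul]
        _ ≤ 2 ^ (1:ℝ) * Real.exp (Λ - 10 * y) := by
          gcongr
          · norm_num
          · linarith
          · nlinarith
        _ = _ := by simp
    have p3 : (1 / (1/Λ) + 1400) * (2 / T) + 2 * B / T ≤ 4 * Real.exp (y/4) / T := by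
      rw [one_div_one_div]
      have : (Λ + 1400) * (2 / T) + 2 * B / T = (2 * (Λ + 1400) + 2 * B) / T := by ring
      rw [this]
      gcongr
      linarith
    have q1 : Real.exp Λ / T = Real.exp (Λ - 4 * y) := by rw [hT, ← Real.exp_sub]
    calc (N:ℝ) * ‖S‖ ≤ 2 * Real.exp Λ * (16 * Real.exp Λ * (4 * Real.exp (y/4) / T) +
          2 * T * Real.exp (y/4) * (2 * Real.exp (Λ - 10 * y))) := by
          gcongr
          refine h3.trans ?_
          gcongr
      _ = 2 * Real.exp Λ * (64 * Real.exp (y/4) * (Real.exp Λ / T) +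
          4 * T * Real.exp (y/4) * Real.exp (Λ - 10 * y)) := by ring
      _ = 128 * Real.exp (2 * Λ - 3.75 * y) + 8 * Real.exp (2 * Λ - 5.75 * y) := by
          rw [q1, hT]
          have r1 : Real.exp (2 * Λ - 3.75 * y) = Real.exp Λ * Real.exp (y/4) * Real.exp (Λ - 4 * y) := by
            rw [← Real.exp_add, ← Real.exp_add]; congr 1; ring
          have r2 : Real.exp (2 * Λ - 5.75 * y) = Real.exp Λ * Real.exp (4 * y) * Real.exp (y/4) * Real.exp (Λ - 10 * y) := by
            rw [← Real.exp_add, ← Real.exp_add, ← Real.exp_add]; congr 1; ring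
          rw [r1, r2]; ring
      _ ≤ 128 * Real.exp (2 * Λ - 3.75 * y) + 8 * Real.exp (2 * Λ - 3.75 * y) := by
          gcongr; linarith
      _ ≤ Real.exp (y/4) * Real.exp (2 * Λ - 3.75 * y) := by
          have := Real.exp_pos (2 * Λ - 3.75 * y)
          nlinarith
      _ = _ := by rw [← Real.exp_add]; congr 1; ring
  -- psi bound
  have hpsi : ∀ N : ℕ, (N:ℝ) ≤ Real.exp Λ → ‖∑ n ∈ Finset.Icc 1 N, pba χ n‖ ≤
      4 * Real.exp (Λ - 1.25 * y) := by
    intro N hN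
    set w := Real.exp (Λ - 1.5 * y) with hw
    have hw1 : 1 ≤ w := Real.one_le_exp (by linarith)
    have hc1 := Nat.le_ceil w
    have hc2 := Nat.ceil_lt_add_one (show 0 ≤ w by linarith)
    set h := ⌈w⌉₊ with hh
    have h2w : (h:ℝ) ≤ 2 * w := by linarith
    have hwx : 2 * w ≤ Real.exp Λ := by
      have : w * 2 ≤ w * Real.exp (1.5 * y) := by
        gcongr
        linarith [Real.add_one_le_exp (1.5 * y)]
      rw [hw, ← Real.exp_add] at this
      have e : Λ - 1.5 * y + 1.5 * y = Λ := by ring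
      rw [e] at this; linarith
    have hh1 : 1 ≤ h := by
      have : (1:ℝ) ≤ h := hw1.trans hc1
      exact_mod_cast this
    have hNh : ((N + h : ℕ):ℝ) ≤ 2 * Real.exp Λ := by push_cast; linarith
    have := pb_uncesaro χ N h hh1 _ (hces N (by linarith)) (hces (N+h) hNh)
    refine this.trans ?_
    have hlog : Real.log ((N + h : ℕ):ℝ) ≤ Real.exp (y/4) := by
      calc Real.log ((N + h : ℕ):ℝ) ≤ Real.log (2 * Real.exp Λ) := by
            apply Real.log_le_log _ hNh
            exact_mod_cast (by omega : 0 < N + h)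
        _ = Real.log 2 + Λ := by rw [Real.log_mul (by norm_num) (by positivity), Real.log_exp]
        _ ≤ _ := by linarith [Real.log_two_lt_d9]
    have a1 : 2 * Real.exp (2 * Λ - 3.5 * y) / h ≤ 2 * Real.exp (Λ - 2 * y) := by
      calc 2 * Real.exp (2 * Λ - 3.5 * y) / h ≤ 2 * Real.exp (2 * Λ - 3.5 * y) / w := by gcongr
        _ = _ := by rw [hw, mul_div_assoc, ← Real.exp_sub]; congr 2; ring
    have a2 : h * Real.log ((N + h : ℕ):ℝ) ≤ 2 * Real.exp (Λ - 1.25 * y) := by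
      calc h * Real.log ((N + h : ℕ):ℝ) ≤ 2 * w * Real.exp (y/4) := by gcongr
        _ = _ := by rw [hw, mul_assoc, ← Real.exp_add]; congr 2; ring
    have a3 : Real.exp (Λ - 2 * y) ≤ Real.exp (Λ - 1.25 * y) := Real.exp_le_exp.mpr (by linarith)
    linarith
  have htheta : ∀ N, N ≤ b → ‖∑ n ∈ Finset.Ioc 0 N, (if n.Prime then χ n * (Real.log n : ℂ) else 0)‖ ≤
      6 * Real.exp (Λ - 1.25 * y) := by
    intro N hN
    rcases Nat.eq_zero_or_pos N with rfl | hN0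
    · simp; positivity
    have hNx : (N:ℝ) ≤ Real.exp Λ := le_trans (by exact_mod_cast hN) hb
    refine (pb_theta_psi χ N hN0).trans ?_
    have h1 := hpsi N hNx
    have h2 : Real.sqrt N ≤ Real.exp (Λ / 2) := by
      rw [Real.sqrt_le_left (by positivity), ← Real.exp_nat_mul]
      convert hNx using 2; push_cast; ring
    have h3 : Real.log N ≤ Real.exp (y/4) := by
      have : Real.log N ≤ Λ := by
        rw [Real.log_le_iff_le_exp (by exact_mod_cast hN0)]; exact hNx
      linarith
    have h4 : 2 * Real.sqrt N * Real.log N ≤ 2 * Real.exp (Λ - 1.25 * y) := by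
      calc 2 * Real.sqrt N * Real.log N ≤ 2 * Real.exp (Λ/2) * Real.exp (y/4) := by gcongr
        _ = 2 * Real.exp (Λ/2 + y/4) := by rw [mul_assoc, ← Real.exp_add]
        _ ≤ _ := by gcongr; linarith
    linarith
  refine (pb_primes_of_theta χ _ b htheta a b ha hab le_rfl).trans ?_
  calc 4 * (6 * Real.exp (Λ - 1.25 * y)) = 24 * Real.exp (Λ - 1.25 * y) := by ring
    _ ≤ Real.exp (y/4) * Real.exp (Λ - 1.25 * y) := by gcongr; linarith
    _ = _ := by rw [← Real.exp_add]; congr 1; ring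

end

section

set_option maxHeartbeats 800000 in
theorem pb_pnt (ε : ℝ) (hε : 0 < ε) (hε2 : ε ≤ 1/6) : ∃ Λ₀ : ℝ, 1 ≤ Λ₀ ∧ ∀ Λ : ℝ, Λ₀ ≤ Λ →
    ∀ (q : ℕ) [NeZero q] (χ : DirichletCharacter ℂ q), χ ≠ 1 → χ ^ 2 = 1 →
      Real.log q ≤ Λ ^ (2/3 - ε) →
      (∀ β : ℝ, 1 - Λ ^ (-(2/3 - ε)) < β → β ≤ 1 → DirichletCharacter.LFunction χ (β:ℂ) ≠ 0) →
      ∀ a b : ℕ, 1 ≤ a → a ≤ b → (b:ℝ) ≤ Real.exp Λ →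
      ‖∑ n ∈ Finset.Ioc a b, (if n.Prime then χ n else 0)‖ ≤ Real.exp (Λ - Λ ^ (1/3 : ℝ)) := by
  have t1 := tendsto_rpow_atTop (show (0:ℝ) < 1/3 by norm_num)
  have t2 := tendsto_rpow_atTop (show (0:ℝ) < ε/2 by linarith)
  have t3 := tendsto_rpow_atTop (show (0:ℝ) < 1/3 - ε/2 by linarith)
  have ev := ((t1.eventually_ge_atTop 5000000).and ((t2.eventually_ge_atTop 8000000).and
    ((t3.eventually_ge_atTop 32000000).and (Filter.eventually_ge_atTop (1:ℝ)))))
  obtain ⟨Λ₀, hΛ₀⟩ := Filter.eventually_atTop.mp ev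
  refine ⟨max Λ₀ 1, le_max_right _ _, ?_⟩
  intro Λ hΛ q _ χ hχ1 hχ hq hβ a b ha hab hb
  obtain ⟨hy, h2, h3, hΛ1⟩ := hΛ₀ Λ ((le_max_left _ _).trans hΛ)
  have hΛ0 : 0 < Λ := by linarith
  set y := Λ ^ (1/3:ℝ) with hyd
  set z := Λ ^ (2/3 - ε/2) with hzd
  have hz0 : 0 < z := by positivity
  have hz1 : z = Λ ^ (2/3 - ε) * Λ ^ (ε/2) := by rw [hzd, ← Real.rpow_add hΛ0]; congr 1; ring
  have hz2 : z = y * Λ ^ (1/3 - ε/2) := by rw [hzd, hyd, ← Real.rpow_add hΛ0]; congr 1; ring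
  have hy3 : y ^ 3 = Λ := by rw [hyd, ← Real.rpow_natCast, ← Real.rpow_mul hΛ0.le]; norm_num
  have hyz : y * y = z * Λ ^ (ε/2) := by
    rw [hyd, hzd, ← Real.rpow_add hΛ0, ← Real.rpow_add hΛ0]; congr 1; ring
  have hzy : z ≤ y * y := by rw [hyz]; nlinarith
  set ν := z⁻¹ with hν
  have hp0 : 0 < Λ ^ (2/3 - ε) := by positivity
  have hl : pbl q (Real.exp (4 * y) + 1) ≤ z / 2000000 := by
    have hq1 : (1:ℝ) ≤ q := by exact_mod_cast NeZero.one_le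
    have he : 4 ≤ Real.exp (4 * y) := by linarith [Real.add_one_le_exp (4 * y)]
    unfold pbl
    rw [abs_of_pos (by positivity), Real.log_mul (by positivity) (by positivity)]
    have e1 : Real.log (Real.exp (4 * y) + 1 + 3) ≤ 4 * y + 1 := by
      rw [Real.log_le_iff_le_exp (by positivity), Real.exp_add]
      have := Real.add_one_le_exp 1
      nlinarith
    have e2 : Λ ^ (2/3 - ε) ≤ z / 8000000 := by rw [hz1]; nlinarith
    have e3 : y ≤ z / 32000000 := by rw [hz2]; nlinarith
    linarith
  have hexp : y ^ 4 * 35 ≤ Real.exp (y / 4) := by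
    have := Real.pow_div_factorial_le_exp (y/4) (by linarith) 5
    refine le_trans ?_ this
    have e : ((Nat.factorial 5 : ℕ):ℝ) = 120 := by norm_num [Nat.factorial]
    rw [e]
    have : (y/4)^5/120 = y^4 * (y / 122880) := by ring
    rw [this]
    gcongr
    linarith
  refine pb_pnt_core χ hχ1 Λ y ν (by linarith) (by positivity) ?_ ?_ ?_ ?_ ?_ a b ha hab hb
  · rw [hν]
    apply inv_le_of_inv_le₀ (by norm_num)
    rw [hz2]; nlinarith
  · rw [hν, inv_mul_eq_div, le_div_iff₀ hz0, ← hy3]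
    have : z ≤ y * y / 8000000 := by rw [hyz]; nlinarith
    nlinarith
  · have : pbl q (Real.exp (4 * y)) ≤ pbl q (Real.exp (4 * y) + 1) := by
      apply pbl_mono
      rw [abs_of_pos (by positivity)]; linarith
    have h4 : pbl q (Real.exp (4 * y)) ≤ z := by linarith
    have : 35 * pbl q (Real.exp (4 * y)) / ν = 35 * pbl q (Real.exp (4 * y)) * z := by
      rw [hν, div_inv_eq_mul]
    rw [this]
    refine le_trans ?_ hexp
    calc 35 * pbl q (Real.exp (4 * y)) * z ≤ 35 * z * z := by gcongr
      _ ≤ 35 * (y * y) * (y * y) := by gcongr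
      _ = _ := by ring
  · refine le_trans ?_ hexp
    rw [← hy3]
    have : (1:ℝ) ≤ y ^ 3 := by rw [hy3]; exact hΛ1
    nlinarith
  · intro ρ hρ him
    have hνle : ν ≤ Λ ^ (-(2/3 - ε)) := by
      rw [hν, Real.rpow_neg hΛ0.le]
      apply inv_anti₀ hp0
      rw [hz1]; nlinarith
    by_cases hi : ρ.im = 0
    · by_contra hcon
      push Not at hcon
      have e : ((ρ.re:ℝ):ℂ) = ρ := by apply Complex.ext <;> simp [hi]
      by_cases h1 : ρ.re ≤ 1
      · exact hβ ρ.re (by linarith) h1 (by rw [e]; exact hρ)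
      · exact DirichletCharacter.LFunction_ne_zero_of_one_le_re χ (Or.inl hχ1) (not_le.mp h1).le hρ
    · have h5 := pb_zero_free χ hχ1 hχ ρ hρ hi
      have h6 := pbl_mono q ρ.im _ him
      have h7 := pbl_one_le q ρ.im
      have : ν ≤ 1/2000000 / pbl q ρ.im := by
        rw [le_div_iff₀ (by linarith), hν, inv_mul_eq_div, div_le_iff₀ hz0]
        linarith
      linarith

end

section

theorem pb_sum_zmod {q : ℕ} [NeZero q] (f : ℕ → ℝ) :
    ∑ j : ZMod q, f j.val = ∑ v ∈ Finset.range q, f v := by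
  refine Finset.sum_nbij' (fun j => j.val) (fun v => (v : ZMod q)) ?_ ?_ ?_ ?_ ?_
  · intro j _; simpa using ZMod.val_lt j
  · intro v _; simp
  · intro j _; simp
  · intro v hv; rw [Finset.mem_range] at hv; exact ZMod.val_cast_of_lt hv
  · intro j _; rfl

theorem pb_gauss_norm {q : ℕ} [NeZero q] (χ : DirichletCharacter ℂ q) (hp : χ.IsPrimitive) (h2 : χ ^ 2 = 1) :
    ‖gaussSum χ ZMod.stdAddChar‖ = Real.sqrt q := by
  have hinv : χ⁻¹ = χ := by
    rw [inv_eq_iff_mul_eq_one, ← sq, h2]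
  set g := gaussSum χ ZMod.stdAddChar with hg
  have hF : ∀ k, ZMod.dft (χ : ZMod q → ℂ) k = χ (-k) * g := by
    intro k
    have := hp.fourierTransform_eq_inv_mul_gaussSum k
    rw [hinv] at this
    exact this
  have h1 := congrFun (ZMod.dft_dft (χ : ZMod q → ℂ)) 1
  have h3 : ZMod.dft (ZMod.dft (χ : ZMod q → ℂ)) 1 = g * g := by
    have e : ZMod.dft (χ : ZMod q → ℂ) = fun k => χ (-k) * g := funext hF
    rw [e, ZMod.dft_apply]
    have e2 : g = ∑ j : ZMod q, χ j * ZMod.stdAddChar j := rfl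
    have e3 : ∑ j : ZMod q, ZMod.stdAddChar (-(j * 1)) • (χ (-j) * g) =
        ∑ j : ZMod q, (χ j * ZMod.stdAddChar j) * g := by
      rw [← Equiv.sum_comp (Equiv.neg (ZMod q))]
      apply Finset.sum_congr rfl
      intro j _
      simp only [Equiv.neg_apply, mul_one, neg_neg, smul_eq_mul]
      ring
    rw [e3, ← Finset.sum_mul, ← e2]
  rw [h3] at h1
  have h4 : ‖χ (-1)‖ = 1 := by
    have hu : IsUnit (-1 : ZMod q) := isUnit_one.neg
    have := χ.unit_norm_eq_one hu.unit
    simpa using this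
  have h5 : ‖g‖ ^ 2 = q := by
    have := congrArg norm h1
    rw [norm_mul, norm_smul, h4, Complex.norm_natCast, mul_one] at this
    rw [sq, this]
  rw [← h5, Real.sqrt_sq (norm_nonneg _)]

theorem pb_geom_bound {q : ℕ} [NeZero q] (j : ZMod q) (hj : j ≠ 0) (N : ℕ) :
    ‖∑ n ∈ Finset.range N, ZMod.stdAddChar (-(j * (n : ZMod q)))‖ ≤
      q / 2 * (1 / (j.val : ℝ) + 1 / ((q - j.val : ℕ) : ℝ)) := by
  set v := j.val with hv
  have hvq : v < q := ZMod.val_lt j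
  have hv0 : 0 < v := Nat.pos_of_ne_zero (by rw [hv]; simpa [ZMod.val_eq_zero] using hj)
  set z : ℂ := ZMod.stdAddChar (-j) with hz
  have e1 : ∀ n : ℕ, ZMod.stdAddChar (-(j * (n : ZMod q))) = z ^ n := by
    intro n
    rw [hz, ← AddChar.map_nsmul_eq_pow]
    congr 1
    simp [mul_comm]
  simp_rw [e1]
  have hzexp : z = (Complex.exp (Complex.I * ((2 * Real.pi * (-(v:ℝ) / q) : ℝ) : ℂ))) := by
    have : -j = ((-(v:ℤ) : ℤ) : ZMod q) := by rw [hv]; simp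
    rw [hz, this, ZMod.stdAddChar_coe]
    congr 1
    push_cast
    ring
  have hq0 : (0:ℝ) < q := by exact_mod_cast (by omega : 0 < q)
  have hn1 : ‖z‖ = 1 := by
    rw [hzexp, mul_comm]; exact Complex.norm_exp_ofReal_mul_I _
  have hpi := Real.pi_pos
  have hvR : (0:ℝ) < v := by exact_mod_cast hv0
  have hcast : ((q - v : ℕ) : ℝ) = q - v := by rw [Nat.cast_sub hvq.le]
  have hvqR : (v:ℝ) < q := by exact_mod_cast hvq
  have hsin : 0 < Real.sin (Real.pi * (v / q)) := by
    apply Real.sin_pos_of_pos_of_lt_pi (by positivity)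
    have : (v:ℝ) / q < 1 := by rw [div_lt_one hq0]; exact hvqR
    nlinarith
  have hz1 : ‖z - 1‖ = 2 * Real.sin (Real.pi * (v / q)) := by
    rw [hzexp, Complex.norm_exp_I_mul_ofReal_sub_one]
    have : 2 * Real.pi * (-(v:ℝ) / q) / 2 = -(Real.pi * (v / q)) := by ring
    rw [this, Real.sin_neg, Real.norm_eq_abs, mul_neg, abs_neg, abs_of_pos (by positivity)]
  have hzne : z ≠ 1 := by
    intro h
    rw [h] at hz1; simp at hz1; linarith
  have hsinlow : 1 / Real.sin (Real.pi * (v / q)) ≤ q / 2 * (1 / (v : ℝ) + 1 / ((q - v : ℕ) : ℝ)) := by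
    rw [hcast]
    have hqv : (0:ℝ) < q - v := by linarith
    by_cases hc : (v:ℝ) ≤ q / 2
    · have := Real.mul_le_sin (x := Real.pi * (v/q)) (by positivity) (by
        have : (v:ℝ)/q ≤ 1/2 := by rw [div_le_iff₀ hq0]; linarith
        nlinarith)
      have e : 2 / Real.pi * (Real.pi * (v/q)) = 2 * v / q := by field_simp
      rw [e] at this
      calc 1 / Real.sin (Real.pi * (v / q)) ≤ 1 / (2 * v / q) := by gcongr
        _ = q / 2 * (1 / v) := by field_simp
        _ ≤ _ := by
          have h0 : (0:ℝ) ≤ 1 / (q - v) := div_nonneg zero_le_one hqv.le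
          have h1 : (1:ℝ) / v ≤ 1 / v + 1 / (q - v) := by linarith
          gcongr
    · have := Real.mul_le_sin (x := Real.pi * ((q-v)/q)) (by positivity) (by
        have : ((q:ℝ) - v)/q ≤ 1/2 := by rw [div_le_iff₀ hq0]; linarith
        nlinarith)
      have e : 2 / Real.pi * (Real.pi * ((q-v)/q)) = 2 * (q - v) / q := by field_simp
      have e2 : Real.sin (Real.pi * ((q-v)/q)) = Real.sin (Real.pi * (v/q)) := by
        rw [← Real.sin_pi_sub]; congr 1; field_simp; ring
      rw [e, e2] at this
      calc 1 / Real.sin (Real.pi * (v / q)) ≤ 1 / (2 * (q - v) / q) := by gcongr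
        _ = q / 2 * (1 / (q - v)) := by field_simp
        _ ≤ _ := by gcongr; simp
  refine le_trans ?_ hsinlow
  rw [geom_sum_eq hzne, norm_div, hz1]
  have : ‖z ^ N - 1‖ ≤ 2 := by
    refine (norm_sub_le _ _).trans ?_
    rw [norm_pow, hn1]; norm_num
  calc ‖z ^ N - 1‖ / (2 * Real.sin (Real.pi * (v / q))) ≤ 2 / (2 * Real.sin (Real.pi * (v / q))) := by gcongr
    _ = _ := by field_simp

theorem pb_PV {q : ℕ} [NeZero q] (χ : DirichletCharacter ℂ q) (hχ : χ ≠ 1) (hp : χ.IsPrimitive) (h2 : χ ^ 2 = 1)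
    (N : ℕ) : ‖∑ n ∈ Finset.range N, χ (n : ZMod q)‖ ≤ Real.sqrt q * (1 + Real.log q) := by
  have hq0 : (0:ℝ) < q := by exact_mod_cast Nat.pos_of_ne_zero (NeZero.ne q)
  have hq1 : q ≠ 1 := by
    rintro rfl
    exact hχ (DirichletCharacter.level_one χ)
  have hinv : χ⁻¹ = χ := by
    rw [inv_eq_iff_mul_eq_one, ← sq, h2]
  have hg := pb_gauss_norm χ hp h2
  set g := gaussSum χ ZMod.stdAddChar with hgd
  have hF : ∀ k, ∑ j : ZMod q, ZMod.stdAddChar (-(j * k)) * χ j = χ (-1) * χ k * g := by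
    intro k
    have := hp.fourierTransform_eq_inv_mul_gaussSum k
    rw [hinv, ← neg_one_mul k, map_mul] at this
    exact this
  have h4 : ‖χ (-1)‖ = 1 := by
    have hu : IsUnit (-1 : ZMod q) := isUnit_one.neg
    have := χ.unit_norm_eq_one hu.unit
    simpa using this
  have h5 : χ (-1) * g * ∑ n ∈ Finset.range N, χ (n : ZMod q) =
      ∑ j : ZMod q, χ j * ∑ n ∈ Finset.range N, ZMod.stdAddChar (-(j * (n : ZMod q))) := by
    simp_rw [Finset.mul_sum]
    rw [Finset.sum_comm]
    apply Finset.sum_congr rfl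
    intro n _
    rw [mul_assoc, mul_comm g, ← mul_assoc, ← hF]
    apply Finset.sum_congr rfl
    intros; ring
  have h6 : ‖∑ j : ZMod q, χ j * ∑ n ∈ Finset.range N, ZMod.stdAddChar (-(j * (n : ZMod q)))‖ ≤
      q * (1 + Real.log q) := by
    have hb : ∀ j ∈ (Finset.univ : Finset (ZMod q)),
        ‖χ j * ∑ n ∈ Finset.range N, ZMod.stdAddChar (-(j * (n : ZMod q)))‖ ≤
        (fun v : ℕ => q / 2 * (1 / (v : ℝ) + 1 / ((q - v : ℕ) : ℝ))) j.val := by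
      intro j _
      by_cases hj : j = 0
      · subst hj
        have : χ 0 = 0 := by
          apply MulChar.map_nonunit
          haveI : Fact (1 < q) := ⟨by have := NeZero.pos q; omega⟩
          exact not_isUnit_zero
        rw [this, zero_mul, norm_zero]
        positivity
      · rw [norm_mul]
        have a1 := DirichletCharacter.norm_le_one χ j
        have a2 := pb_geom_bound j hj N
        calc _ ≤ 1 * (q / 2 * (1 / (j.val : ℝ) + 1 / ((q - j.val : ℕ) : ℝ))) := by gcongr
          _ = _ := by simp
    refine (norm_sum_le_of_le _ hb).trans ?_
    rw [pb_sum_zmod (fun v : ℕ => q / 2 * (1 / (v : ℝ) + 1 / ((q - v : ℕ) : ℝ))), ← Finset.mul_sum,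
      Finset.sum_add_distrib]
    have hH := harmonic_le_one_add_log q
    have hH' : ∑ v ∈ Finset.range q, 1 / ((v + 1 : ℕ):ℝ) ≤ 1 + Real.log q := by
      refine le_trans (le_of_eq ?_) hH
      rw [harmonic]; push_cast; simp
    have s1 : ∑ v ∈ Finset.range q, 1 / (v:ℝ) ≤ 1 + Real.log q := by
      refine le_trans ?_ hH'
      obtain ⟨m, rfl⟩ : ∃ m, q = m + 1 := ⟨q - 1, by have := NeZero.pos q; omega⟩
      rw [Finset.sum_range_succ', Finset.sum_range_succ]
      simp only [Nat.cast_zero, div_zero, add_zero]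
      have : (0:ℝ) ≤ 1 / ((m + 1 : ℕ):ℝ) := by positivity
      linarith
    have s2 : ∑ v ∈ Finset.range q, 1 / ((q - v : ℕ):ℝ) ≤ 1 + Real.log q := by
      refine le_trans (le_of_eq ?_) hH'
      rw [← Finset.sum_range_reflect]
      apply Finset.sum_congr rfl
      intro v hv
      rw [Finset.mem_range] at hv
      congr 2; omega
    nlinarith
  rw [← h5, norm_mul, norm_mul, h4, one_mul, hg] at h6
  have hs : 0 < Real.sqrt q := Real.sqrt_pos.mpr hq0
  have hss : Real.sqrt q * Real.sqrt q = q := Real.mul_self_sqrt hq0.le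
  by_contra hcon
  push Not at hcon
  have : Real.sqrt q * (Real.sqrt q * (1 + Real.log q)) <
    Real.sqrt q * ‖∑ n ∈ Finset.range N, χ (n : ZMod q)‖ := by gcongr
  rw [← mul_assoc, hss] at this
  linarith

end

section

theorem pb_mkchar (q : ℕ) [NeZero q] (f : ℤ → ℤ) (h1 : f 1 = 1) (hm : ∀ a b, f (a * b) = f a * f b)
    (hp : ∀ a b : ℤ, (a : ZMod q) = b → f a = f b) (h0 : ∀ a : ℤ, ¬ IsUnit (a : ZMod q) → f a = 0) :
    ∃ χ : DirichletCharacter ℂ q, ∀ a : ℤ, χ (a : ZMod q) = (f a : ℂ) := by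
  have key : ∀ z : ZMod q, (((z.val : ℕ) : ℤ) : ZMod q) = z := by intro z; simp
  refine ⟨⟨⟨⟨fun z => ((f (z.val : ℤ) : ℤ) : ℂ), ?_⟩, ?_⟩, ?_⟩, ?_⟩
  · have : f (((1 : ZMod q).val : ℕ) : ℤ) = f 1 := hp _ _ (by rw [key]; simp)
    simp only [this, h1, Int.cast_one]
  · intro x y
    have : f (((x * y).val : ℕ) : ℤ) = f ((x.val : ℤ) * (y.val : ℤ)) := hp _ _ (by
      rw [key]; push_cast; simp)
    simp only [this, hm, Int.cast_mul]
  · intro z hz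
    have : f ((z.val : ℕ) : ℤ) = 0 := h0 _ (by rw [key]; exact hz)
    change ((f (z.val : ℤ) : ℤ) : ℂ) = 0
    rw [this]; simp
  · intro a
    change ((f (((a : ZMod q).val : ℕ) : ℤ) : ℤ) : ℂ) = _
    rw [hp _ a (by rw [key])]

theorem pb_jacobi_congr (D : ℕ) (a b : ℤ) (h : (a : ZMod D) = b) : jacobiSym a D = jacobiSym b D := by
  apply jacobiSym.mod_left'
  exact (ZMod.intCast_eq_intCast_iff a b D).1 h

theorem pb_unit_iff (q : ℕ) (a : ℤ) : IsUnit (a : ZMod q) ↔ a.gcd q = 1 := by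
  rw [← Int.isCoprime_iff_gcd_eq_one]
  exact ZMod.coe_int_isUnit_iff_isCoprime a q |>.trans isCoprime_comm

/-- Character mod `D`. -/
theorem pb_char1 (D : ℕ) [NeZero D] :
    ∃ χ : DirichletCharacter ℂ D, ∀ a : ℤ, χ (a : ZMod D) = ((jacobiSym a D : ℤ) : ℂ) := by
  apply pb_mkchar D (fun a => jacobiSym a D)
  · exact jacobiSym.one_left D
  · intro a b; exact jacobiSym.mul_left a b D
  · intro a b; exact pb_jacobi_congr D a b
  · intro a ha
    rw [pb_unit_iff] at ha
    exact jacobiSym.eq_zero_iff_not_coprime.2 ha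

theorem pb_char4 (D : ℕ) [NeZero D] [NeZero (4 * D)] :
    ∃ χ : DirichletCharacter ℂ (4 * D), ∀ a : ℤ,
      χ (a : ZMod (4 * D)) = ((ZMod.χ₄ (a : ZMod 4) * jacobiSym a D : ℤ) : ℂ) := by
  apply pb_mkchar (4 * D) (fun a => ZMod.χ₄ (a : ZMod 4) * jacobiSym a D)
  · simp [jacobiSym.one_left]
  · intro a b
    rw [jacobiSym.mul_left a b D]; push_cast; rw [map_mul]; ring
  · intro a b h
    rw [ZMod.intCast_eq_intCast_iff] at h
    have h4 : (a : ZMod 4) = b := by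
      rw [ZMod.intCast_eq_intCast_iff]
      exact Int.ModEq.of_mul_right (D : ℤ) (by push_cast at h; exact h)
    have hD : (a : ZMod D) = b := by
      rw [ZMod.intCast_eq_intCast_iff]
      exact Int.ModEq.of_mul_left (4 : ℤ) (by push_cast at h; exact h)
    simp only [h4, pb_jacobi_congr D a b hD]
  · intro a ha
    by_cases h4 : IsUnit (a : ZMod 4)
    · have : ¬ (a.gcd D = 1) := by
        intro h
        apply ha
        rw [pb_unit_iff, ← Int.isCoprime_iff_gcd_eq_one]
        rw [← Int.isCoprime_iff_gcd_eq_one] at h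
        have h4' := (pb_unit_iff 4 a).1 h4
        rw [← Int.isCoprime_iff_gcd_eq_one] at h4'
        push_cast
        exact IsCoprime.mul_right (by simpa using h4') h
      simp only [jacobiSym.eq_zero_iff_not_coprime.2 this, mul_zero]
    · simp only [MulChar.map_nonunit ZMod.χ₄ h4, zero_mul]

theorem pb_nonres (D x : ℕ) (hD : Odd D) (hsq : Squarefree D) (hx : x.Prime) (hxD : x ∣ D) :
    ∃ n : ℤ, n ≡ 1 [ZMOD ((4 * (D / x) : ℕ) : ℤ)] ∧ jacobiSym n D = -1 := by
  have : Fact x.Prime := ⟨hx⟩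
  obtain ⟨m, rfl⟩ := hxD
  have hm : x * m / x = m := Nat.mul_div_cancel_left m hx.pos
  have hxodd : Odd x := (Nat.odd_mul.1 hD).1
  have hmodd : Odd m := (Nat.odd_mul.1 hD).2
  have hcop : Nat.Coprime x m := Nat.coprime_of_squarefree_mul hsq
  have hx2 : x ≠ 2 := by rintro rfl; revert hxodd; decide
  obtain ⟨u, hu⟩ := FiniteField.exists_nonsquare (F := ZMod x) (by rw [ZMod.ringChar_zmod_n]; exact hx2)
  have hcop4 : Nat.Coprime x (4 * m) := by
    apply Nat.Coprime.mul_right _ hcop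
    have : Nat.Coprime x 2 := Nat.Coprime.symm (Nat.coprime_two_left.2 hxodd)
    exact Nat.Coprime.pow_right 2 this
  obtain ⟨n, hn1, hn2⟩ := Nat.chineseRemainder hcop4 u.val 1
  refine ⟨n, ?_, ?_⟩
  · rw [hm]
    exact (Int.natCast_modEq_iff.2 hn2)
  · have hm0 : m ≠ 0 := by rintro rfl; revert hmodd; decide
    rw [jacobiSym.mul_right' _ hx.ne_zero hm0]
    have e1 : jacobiSym n m = 1 := by
      rw [pb_jacobi_congr m n 1, jacobiSym.one_left]
      rw [ZMod.intCast_eq_intCast_iff]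
      exact Int.natCast_modEq_iff.2 (Nat.ModEq.of_mul_left 4 hn2)
    have e2 : jacobiSym n x = -1 := by
      rw [← jacobiSym.legendreSym.to_jacobiSym, legendreSym.eq_neg_one_iff]
      have : ((n : ℤ) : ZMod x) = u := by
        have := (ZMod.natCast_eq_natCast_iff n u.val x).2 hn1
        simpa using this
      rw [this]; exact hu
    rw [e1, e2]; norm_num

theorem pb_prim (D : ℕ) [NeZero D] (hD : Odd D) (hsq : Squarefree D) (χ : DirichletCharacter ℂ D)
    (hχ : ∀ a : ℤ, χ (a : ZMod D) = ((jacobiSym a D : ℤ) : ℂ)) : χ.IsPrimitive := by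
  rw [DirichletCharacter.isPrimitive_def]
  by_contra hne
  obtain ⟨f, hf⟩ := χ.conductor_dvd_level
  have hf1 : f ≠ 1 := by rintro rfl; rw [mul_one] at hf; exact hne hf.symm
  obtain ⟨x, hx, hxf⟩ := Nat.exists_prime_and_dvd hf1
  obtain ⟨g, rfl⟩ := hxf
  have hxD : x ∣ D := by rw [hf]; exact ⟨χ.conductor * g, by ring⟩
  obtain ⟨n, hn1, hn2⟩ := pb_nonres D x hD hsq hx hxD
  have hDx : D / x = χ.conductor * g := by
    apply Nat.div_eq_of_eq_mul_right hx.pos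
    rw [mul_comm x, mul_assoc, mul_comm g]; exact hf
  have hcop : IsCoprime n (D : ℤ) := by
    rw [Int.isCoprime_iff_gcd_eq_one]
    by_contra h
    rw [jacobiSym.eq_zero_iff_not_coprime.2 h] at hn2
    norm_num at hn2
  have h1 := χ.primitiveCharacter_apply_of_isCoprime hcop
  have h2 : ((n : ℤ) : ZMod χ.conductor) = ((1 : ℤ) : ZMod χ.conductor) := by
    rw [ZMod.intCast_eq_intCast_iff]
    refine hn1.of_dvd ?_
    rw [hDx]; exact Int.natCast_dvd_natCast.2 ⟨4 * g, by ring⟩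
  rw [h2, hχ, hn2] at h1
  simp at h1
  norm_num at h1

theorem pb_quad_sq {q : ℕ} [NeZero q] (χ : DirichletCharacter ℂ q)
    (h : ∀ a : ℤ, χ (a : ZMod q) = 0 ∨ χ (a : ZMod q) = 1 ∨ χ (a : ZMod q) = -1) : χ ^ 2 = 1 := by
  ext u
  have hu : (((u : ZMod q).val : ℤ) : ZMod q) = (u : ZMod q) := by simp
  have := h ((u : ZMod q).val : ℤ)
  rw [hu] at this
  rw [MulChar.one_apply_coe, pow_two, MulChar.mul_apply]
  rcases this with h | h | h
  · exfalso
    exact (u.isUnit.map χ).ne_zero h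
  · rw [h]; norm_num
  · rw [h]; norm_num

theorem pb_nonzero (cL : ℝ) (hcL0 : 0 < cL) (hcL : cL < 1/2) (d : ℤ) (hd : Squarefree d) (hd1 : d ≠ 1) (hd0 : d ≠ 0)
    (hS : d ∉ SiegelSet cL)
    {q : ℕ} [NeZero q] (hq : (q : ℤ) ∣ 4 * d) (χ : DirichletCharacter ℂ q) (hχ1 : χ ≠ 1)
    (hχ : ∀ p : ℕ, (hp : p.Prime) → p ≠ 2 → ¬ ((p : ℤ) ∣ d) →
        χ (p : ZMod q) = ((@legendreSym p ⟨hp⟩ d : ℤ) : ℂ)) (β : ℝ)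
    (hβ : 1 - cL / Real.log (|(d : ℝ)| + 4) ≤ β) (hβ1 : β ≤ 1) : DirichletCharacter.LFunction χ (β : ℂ) ≠ 0 := by
  intro h0
  apply hS
  refine ⟨hd, hd0, hd1, χ.conductor, χ.conductor_ne_zero, χ.primitiveCharacter,
    χ.primitiveCharacter_isPrimitive, ?_, β, hβ, hβ1, ?_⟩
  · intro p hp hp2 hpd
    rw [← hχ p hp hp2 hpd]
    have hcop : IsCoprime (p : ℤ) q := by
      have h1 : IsCoprime (p : ℤ) (4 * d) := by
        have hpp := Nat.prime_iff_prime_int.1 hp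
        rw [Prime.coprime_iff_not_dvd hpp]
        intro h
        rcases hpp.dvd_or_dvd h with h | h
        · have h4 : p ∣ 2 ^ 2 := by exact_mod_cast h
          exact hp2 ((Nat.prime_dvd_prime_iff_eq hp Nat.prime_two).1 (hp.dvd_of_dvd_pow h4))
        · exact hpd h
      exact h1.of_isCoprime_of_dvd_right hq
    have := χ.primitiveCharacter_apply_of_isCoprime hcop
    simpa using this
  · have : NeZero χ.conductor := ⟨χ.conductor_ne_zero⟩
    have hc1 : χ.primitiveCharacter ≠ 1 := by
      intro h
      apply hχ1
      rw [← χ.changeLevel_primitiveCharacter, h, DirichletCharacter.changeLevel_one]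
    have hL := DirichletCharacter.LFunction_changeLevel χ.conductor_dvd_level χ.primitiveCharacter
      (s := (β : ℂ)) (Or.inl hc1)
    rw [χ.changeLevel_primitiveCharacter, h0] at hL
    rcases mul_eq_zero.1 hL.symm with h | h
    · exact h
    · exfalso
      rw [Finset.prod_eq_zero_iff] at h
      obtain ⟨p, hp, hp0⟩ := h
      have hpp := Nat.prime_of_mem_primeFactors hp
      have hlog : 1 ≤ Real.log (|(d : ℝ)| + 4) := by
        rw [Real.le_log_iff_exp_le (by positivity)]
        have := Real.exp_one_lt_d9
        have := abs_nonneg (d : ℝ)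
        linarith
      have hβ0 : 0 < β := by
        have : cL / Real.log (|(d : ℝ)| + 4) ≤ cL := div_le_self hcL0.le hlog
        linarith
      have : χ.primitiveCharacter (p : ZMod χ.conductor) * (p : ℂ) ^ (-(β : ℂ)) = 1 := (sub_eq_zero.1 hp0).symm
      have hn : ‖χ.primitiveCharacter (p : ZMod χ.conductor) * (p : ℂ) ^ (-(β : ℂ))‖ < 1 := by
        rw [norm_mul, Complex.norm_natCast_cpow_of_pos hpp.pos]
        have h1 := DirichletCharacter.norm_le_one χ.primitiveCharacter (p : ZMod χ.conductor)
        have h2 : (p : ℝ) ^ (-(β : ℂ)).re < 1 := by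
          apply Real.rpow_lt_one_of_one_lt_of_neg (by exact_mod_cast hpp.one_lt)
          simpa using hβ0
        have h3 : 0 ≤ (p : ℝ) ^ (-(β : ℂ)).re := by positivity
        nlinarith [norm_nonneg (χ.primitiveCharacter (p : ZMod χ.conductor))]
      rw [this] at hn
      simp at hn

end

section

theorem pb_sum_conv {q : ℕ} (χ : DirichletCharacter ℂ q) (f : ℤ → ℤ) (h : ∀ a : ℤ, χ (a : ZMod q) = (f a : ℂ))
    (a b : ℕ) (E : ℝ) (hE : ‖∑ n ∈ Finset.Ioc a b, (if n.Prime then χ n else 0)‖ ≤ E) :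
    |((∑ n ∈ (Finset.Ioc a b).filter Nat.Prime, f n : ℤ) : ℝ)| ≤ E := by
  have : ∑ n ∈ Finset.Ioc a b, (if n.Prime then χ n else 0)
      = ((∑ n ∈ (Finset.Ioc a b).filter Nat.Prime, f n : ℤ) : ℂ) := by
    rw [Finset.sum_filter]
    push_cast
    apply Finset.sum_congr rfl
    intro n _
    split_ifs
    · have := h (n : ℤ)
      simpa using this
    · simp
  rw [this, Complex.norm_intCast] at hE
  exact hE

theorem pb_jac_sum (cL c₅ : ℝ) (hcL0 : 0 < cL) (hcL : cL < 1/2) (hc : 3 < c₅) :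
    ∃ A : ℝ, 1 ≤ A ∧ ∀ L Λ : ℝ, A ≤ L → L ^ c₅ ≤ Λ → ∀ D : ℕ, Squarefree D → D % 4 = 1 → D ≠ 1 →
      Real.log D ≤ L ^ 2 → (D : ℤ) ∉ SiegelSet cL → (-(D : ℤ)) ∉ SiegelSet cL →
      ∀ a b : ℕ, 1 ≤ a → a ≤ b → (b : ℝ) ≤ Real.exp Λ →
      |((∑ n ∈ (Finset.Ioc a b).filter Nat.Prime, jacobiSym n D : ℤ) : ℝ)| ≤ Real.exp (Λ - Λ ^ (1/3:ℝ)) ∧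
      |((∑ n ∈ (Finset.Ioc a b).filter Nat.Prime, ZMod.χ₄ (n : ZMod 4) * jacobiSym n D : ℤ) : ℝ)|
        ≤ Real.exp (Λ - Λ ^ (1/3:ℝ)) := by
  set ε : ℝ := min (1/6) ((2/3 - 2/c₅)/2) with hε
  have hc2 : 2 / c₅ < 2/3 := by rw [div_lt_div_iff₀ (by linarith) (by norm_num)]; linarith
  have hε0 : 0 < ε := lt_min (by norm_num) (by linarith)
  obtain ⟨Λ₀, hΛ₀1, hΛ₀⟩ := pb_pnt ε hε0 (min_le_left _ _)
  set θ := 2/3 - ε with hθ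
  have hθc : 2 / c₅ < θ := by
    have : ε ≤ (2/3 - 2/c₅)/2 := min_le_right _ _
    rw [hθ]; linarith
  have hη : 0 < c₅ * θ - 2 := by
    rw [div_lt_iff₀ (by linarith)] at hθc; linarith
  have hθ0 : 0 < θ := lt_trans (by positivity) hθc
  refine ⟨max Λ₀ ((3 / cL) ^ (1 / (c₅ * θ - 2))), le_max_of_le_left hΛ₀1, ?_⟩
  intro L Λ hL hΛ D hsq hD4 hD1 hlogD hS1 hS2 a b ha hab hb
  have hL0 : Λ₀ ≤ L := le_trans (le_max_left _ _) hL
  have hL1 : 1 ≤ L := hΛ₀1.trans hL0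
  have hLη : 3 / cL ≤ L ^ (c₅ * θ - 2) := by
    have h := le_trans (le_max_right _ _) hL
    have h2 := Real.rpow_le_rpow (by positivity) h hη.le
    rwa [← Real.rpow_mul (by positivity), one_div, inv_mul_cancel₀ hη.ne', Real.rpow_one] at h2
  have hLL : L ≤ L ^ c₅ := by
    conv_lhs => rw [← Real.rpow_one L]
    exact Real.rpow_le_rpow_of_exponent_le hL1 (by linarith)
  have hΛL : Λ₀ ≤ Λ := by linarith
  have hΛ1 : 1 ≤ Λ := by linarith
  have hΛθ : 3 * L ^ 2 / cL ≤ Λ ^ θ := by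
    have h1 : L ^ (c₅ * θ) ≤ Λ ^ θ := by
      rw [Real.rpow_mul (by linarith)]
      exact Real.rpow_le_rpow (by positivity) hΛ hθ0.le
    have h2 : L ^ (c₅ * θ) = L ^ (c₅ * θ - 2) * L ^ 2 := by
      rw [← Real.rpow_natCast L 2, ← Real.rpow_add (by linarith)]; congr 1; push_cast; ring
    calc 3 * L ^ 2 / cL = 3 / cL * L ^ 2 := by ring
      _ ≤ L ^ (c₅ * θ - 2) * L ^ 2 := by gcongr
      _ ≤ _ := by rw [← h2]; exact h1
  have hΛθ' : 3 * L ^ 2 ≤ Λ ^ θ := by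
    refine le_trans ?_ hΛθ
    rw [le_div_iff₀ hcL0]; nlinarith [sq_nonneg L]
  have hDpos : 0 < D := by omega
  have hDR : (1:ℝ) ≤ D := by exact_mod_cast hDpos
  have hNZ : NeZero D := ⟨hDpos.ne'⟩
  have hNZ4 : NeZero (4 * D) := ⟨by omega⟩
  have hodd : Odd D := by rw [Nat.odd_iff]; omega
  have hlog5 : Real.log (5 * D) ≤ 3 * L ^ 2 := by
    rw [Real.log_mul (by norm_num) (by positivity)]
    have : Real.log 5 ≤ 2 := by
      rw [Real.log_le_iff_le_exp (by norm_num)]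
      have h1 := Real.add_one_le_exp (1:ℝ)
      have h2 : Real.exp 2 = Real.exp 1 * Real.exp 1 := by rw [← Real.exp_add]; norm_num
      have := Real.exp_one_gt_d9
      nlinarith
    nlinarith
  have hlogq1 : Real.log ((D : ℕ) : ℝ) ≤ Λ ^ θ := by nlinarith [sq_nonneg L]
  have hlogq4 : Real.log ((4 * D : ℕ) : ℝ) ≤ Λ ^ θ := by
    refine le_trans (Real.log_le_log ?_ ?_) (hlog5.trans hΛθ')
    · push_cast; positivity
    · push_cast; linarith
  have hlogp : 0 < Real.log ((D:ℝ) + 4) := Real.log_pos (by linarith)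
  have hβ : Λ ^ (-θ) ≤ cL / Real.log ((D:ℝ) + 4) := by
    have h1 : Real.log ((D:ℝ) + 4) ≤ 3 * L ^ 2 := by
      refine le_trans (Real.log_le_log (by positivity) ?_) hlog5
      linarith
    have hΛp : 0 < Λ ^ θ := by positivity
    rw [Real.rpow_neg (by linarith), inv_eq_one_div, div_le_div_iff₀ hΛp hlogp]
    rw [div_le_iff₀ hcL0] at hΛθ
    linarith
  obtain ⟨x, hx, hxD⟩ := Nat.exists_prime_and_dvd hD1
  obtain ⟨n, hn1, hn2⟩ := pb_nonres D x hodd hsq hx hxD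
  have hsqZ : Squarefree (D : ℤ) := by exact_mod_cast Int.squarefree_natCast.2 hsq
  constructor
  · obtain ⟨χ, hχ⟩ := pb_char1 D
    have hχ1 : χ ≠ 1 := by
      intro h
      have := hχ n
      rw [hn2, h] at this
      by_cases hu : IsUnit ((n : ℤ) : ZMod D)
      · rw [MulChar.one_apply hu] at this; norm_num at this
      · rw [MulChar.map_nonunit _ hu] at this; norm_num at this
    have hχ2 : χ ^ 2 = 1 := by
      apply pb_quad_sq
      intro a
      rw [hχ]
      rcases jacobiSym.trichotomy a D with h | h | h <;> rw [h] <;> simp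
    apply pb_sum_conv χ (fun a => jacobiSym a D) hχ
    refine hΛ₀ Λ hΛL D χ hχ1 hχ2 hlogq1 ?_ a b ha hab hb
    intro β hβ0 hβ1
    refine pb_nonzero cL hcL0 hcL (D : ℤ) hsqZ (by exact_mod_cast hD1) (by exact_mod_cast hDpos.ne') hS1
      ⟨4, by ring⟩ χ hχ1 ?_ β ?_ hβ1
    · intro p hp hp2 hpD
      have := hχ p
      have hpodd : Odd p := hp.odd_of_ne_two hp2
      simp only [Int.cast_natCast] at this
      rw [this, jacobiSym.legendreSym.to_jacobiSym, jacobiSym.quadratic_reciprocity_one_mod_four hD4 hpodd]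
    · have : |(((D : ℤ) : ℤ) : ℝ)| = D := by simp
      rw [this]; linarith
  · obtain ⟨χ, hχ⟩ := pb_char4 D
    have hχ1 : χ ≠ 1 := by
      intro h
      have := hχ n
      have hn4 : ((n : ℤ) : ZMod 4) = ((1 : ℤ) : ZMod 4) := by
        rw [ZMod.intCast_eq_intCast_iff]
        push_cast at hn1
        exact Int.ModEq.of_mul_right _ hn1
      rw [hn2, h, hn4] at this
      simp only [Int.cast_one, map_one] at this
      by_cases hu : IsUnit ((n : ℤ) : ZMod (4 * D))
      · rw [MulChar.one_apply hu] at this; norm_num at this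
      · rw [MulChar.map_nonunit _ hu] at this; norm_num at this
    have hχ2 : χ ^ 2 = 1 := by
      apply pb_quad_sq
      intro a
      rw [hχ]
      have h4 : ∀ z : ZMod 4, ZMod.χ₄ z = 0 ∨ ZMod.χ₄ z = 1 ∨ ZMod.χ₄ z = -1 := by decide
      rcases jacobiSym.trichotomy a D with h | h | h <;> rw [h] <;>
      rcases h4 (a : ZMod 4) with h | h | h <;> rw [h] <;> simp
    apply pb_sum_conv χ (fun a => ZMod.χ₄ (a : ZMod 4) * jacobiSym a D) hχ
    refine hΛ₀ Λ hΛL (4 * D) χ hχ1 hχ2 hlogq4 ?_ a b ha hab hb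
    intro β hβ0 hβ1
    refine pb_nonzero cL hcL0 hcL (-(D : ℤ)) (fun y hy => hsqZ y (dvd_neg.1 hy)) (by omega) (by omega) hS2
      ⟨-1, by push_cast; ring⟩ χ hχ1 ?_ β ?_ hβ1
    · intro p hp hp2 hpD
      have := hχ p
      have hpodd : Odd p := hp.odd_of_ne_two hp2
      simp only [Int.cast_natCast] at this
      rw [this, jacobiSym.legendreSym.to_jacobiSym, jacobiSym.neg _ hpodd,
        jacobiSym.quadratic_reciprocity_one_mod_four hD4 hpodd]
    · have : |((-(D : ℤ) : ℤ) : ℝ)| = D := by simp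
      rw [this]; linarith

end

section

theorem pb_jac_prod (a : ℤ) (T : Finset ℕ) (hT : ∀ p ∈ T, p ≠ 0) :
    jacobiSym a (∏ p ∈ T, p) = ∏ p ∈ T, jacobiSym a p := by
  induction T using Finset.induction_on with
  | empty => simp [jacobiSym.one_right]
  | insert x S hx ih =>
    rw [Finset.prod_insert hx, Finset.prod_insert hx, jacobiSym.mul_right', ih]
    · intro p hp; exact hT p (Finset.mem_insert_of_mem hp)
    · exact hT x (Finset.mem_insert_self _ _)
    · rw [Finset.prod_ne_zero_iff]; intro p hp; exact hT p (Finset.mem_insert_of_mem hp)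

theorem pb_jac_pm (p q : ℕ) (hp : p.Prime) (hq : q.Prime) (h : p ≠ q) : jacobiSym p q = 1 ∨ jacobiSym p q = -1 := by
  apply jacobiSym.eq_one_or_neg_one
  rw [Int.gcd_natCast_natCast]
  exact (Nat.coprime_primes hp hq).2 h

theorem pb_large_sum (x : ℕ) (hx : x.Prime) (Q : Finset ℕ) (hQ : ∀ p ∈ Q, p.Prime) (b : ℕ → ℤ)
    (hb : ∀ p ∈ Q, b p = 1 ∨ b p = -1) (u v : ℕ) (hu2 : 2 ≤ u) (huQ : ∀ p ∈ Q, p ≤ u)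
    (Y : Finset ℕ) (hY : ∀ p, p ∈ Y ↔ p.Prime ∧ p % 4 = 1 ∧ u < p ∧ p ≤ v ∧ ∀ p' ∈ Q, jacobiSym p p' = b p')
    (E : ℝ)
    (hE : ∀ T ∈ Q.powerset,
      |((∑ n ∈ (Finset.Ioc u v).filter Nat.Prime, jacobiSym n (x * ∏ p ∈ T, p) : ℤ) : ℝ)| ≤ E ∧
      |((∑ n ∈ (Finset.Ioc u v).filter Nat.Prime, ZMod.χ₄ (n : ZMod 4) * jacobiSym n (x * ∏ p ∈ T, p) : ℤ) : ℝ)| ≤ E) :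
    |((∑ p ∈ Y, jacobiSym p x : ℤ) : ℝ)| ≤ E := by
  have hYsub : Y = ((Finset.Ioc u v).filter Nat.Prime).filter (fun p : ℕ => p % 4 = 1 ∧ ∀ p' ∈ Q, jacobiSym p p' = b p') := by
    ext p
    rw [hY, Finset.mem_filter, Finset.mem_filter, Finset.mem_Ioc]
    tauto
  have key : ∀ n ∈ (Finset.Ioc u v).filter Nat.Prime,
      2 ^ (Q.card + 1) * (if (n % 4 = 1 ∧ ∀ p' ∈ Q, jacobiSym n p' = b p') then jacobiSym n x else 0)
      = ∑ T ∈ Q.powerset, (∏ p ∈ T, b p) * (jacobiSym n (x * ∏ p ∈ T, p)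
          + ZMod.χ₄ (n : ZMod 4) * jacobiSym n (x * ∏ p ∈ T, p)) := by
    intro n hn
    rw [Finset.mem_filter, Finset.mem_Ioc] at hn
    have e1 : ∀ T ∈ Q.powerset, (∏ p ∈ T, b p) * (jacobiSym n (x * ∏ p ∈ T, p)
          + ZMod.χ₄ (n : ZMod 4) * jacobiSym n (x * ∏ p ∈ T, p))
        = (jacobiSym n x * (1 + ZMod.χ₄ (n : ZMod 4))) * ∏ p ∈ T, (b p * jacobiSym n p) := by
      intro T hT
      rw [Finset.mem_powerset] at hT
      have hT0 : ∀ p ∈ T, p ≠ 0 := fun p hp => (hQ p (hT hp)).ne_zero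
      rw [jacobiSym.mul_right' _ hx.ne_zero (Finset.prod_ne_zero_iff.2 hT0), pb_jac_prod _ T hT0,
        Finset.prod_mul_distrib]
      ring
    rw [Finset.sum_congr rfl e1, ← Finset.mul_sum, ← Finset.prod_one_add]
    have hodd : n % 2 = 1 := by
      rcases hn.2.eq_two_or_odd with h | h
      · omega
      · exact h
    by_cases h4 : n % 4 = 1
    · have hχ : ZMod.χ₄ (n : ZMod 4) = 1 := ZMod.χ₄_nat_one_mod_four h4
      rw [hχ]
      by_cases hall : ∀ p' ∈ Q, jacobiSym n p' = b p'
      · rw [if_pos ⟨h4, hall⟩]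
        have : ∏ p ∈ Q, (1 + b p * jacobiSym n p) = 2 ^ Q.card := by
          rw [Finset.prod_congr rfl (g := fun _ => (2:ℤ)), Finset.prod_const]
          intro p hp
          rw [hall p hp]
          rcases hb p hp with h | h <;> rw [h] <;> norm_num
        rw [this]; ring
      · rw [if_neg (fun h => hall h.2)]
        push Not at hall
        obtain ⟨p, hp, hne⟩ := hall
        have : ∏ p ∈ Q, (1 + b p * jacobiSym n p) = 0 := by
          apply Finset.prod_eq_zero hp
          have hnp : n ≠ p := by have := huQ p hp; omega
          rcases pb_jac_pm n p hn.2 (hQ p hp) hnp with h | h <;> rcases hb p hp with h' | h' <;>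
            simp [h, h'] at hne ⊢
        rw [this]; simp
    · have hχ : ZMod.χ₄ (n : ZMod 4) = -1 := ZMod.χ₄_nat_three_mod_four (by omega)
      rw [if_neg (fun h => h4 h.1), hχ]; simp
  have e2 : 2 ^ (Q.card + 1) * (∑ p ∈ Y, jacobiSym p x) = ∑ T ∈ Q.powerset, (∏ p ∈ T, b p) *
      ((∑ n ∈ (Finset.Ioc u v).filter Nat.Prime, jacobiSym n (x * ∏ p ∈ T, p))
       + ∑ n ∈ (Finset.Ioc u v).filter Nat.Prime, ZMod.χ₄ (n : ZMod 4) * jacobiSym n (x * ∏ p ∈ T, p)) := by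
    rw [hYsub, Finset.sum_filter, Finset.mul_sum, Finset.sum_congr rfl key, Finset.sum_comm]
    apply Finset.sum_congr rfl
    intro T _
    rw [← Finset.sum_add_distrib, Finset.mul_sum]
  have e3 : (2:ℝ) ^ (Q.card + 1) * |((∑ p ∈ Y, jacobiSym p x : ℤ) : ℝ)| ≤ 2 ^ (Q.card + 1) * E := by
    have e4 := congrArg (fun z : ℤ => |(z : ℝ)|) e2
    rw [Int.cast_mul, abs_mul] at e4
    have : |(((2:ℤ) ^ (Q.card + 1) : ℤ) : ℝ)| = 2 ^ (Q.card + 1) := by push_cast; exact abs_of_pos (by positivity)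
    rw [this] at e4
    rw [e4, Int.cast_sum]
    refine (Finset.abs_sum_le_sum_abs _ _).trans ?_
    calc _ ≤ ∑ T ∈ Q.powerset, 2 * E := by
          apply Finset.sum_le_sum
          intro T hT
          have hbT : |((∏ p ∈ T, b p : ℤ) : ℝ)| = 1 := by
            push_cast
            rw [Finset.abs_prod]
            apply Finset.prod_eq_one
            intro p hp
            rcases hb p ((Finset.mem_powerset.1 hT) hp) with h | h <;> rw [h] <;> simp
          rw [Int.cast_mul, abs_mul, hbT, one_mul, Int.cast_add]
          refine (abs_add_le _ _).trans ?_
          have := hE T hT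
          linarith [this.1, this.2]
      _ = _ := by rw [Finset.sum_const, Finset.card_powerset, nsmul_eq_mul]; push_cast; ring
  exact le_of_mul_le_mul_left e3 (by positivity)

end

section

theorem pb_two_reps (Y : Finset ℕ) (hY : ∀ y ∈ Y, y.Prime) (K : ℕ) (hK : ∀ y ∈ Y, ∀ y' ∈ Y, y * y' < K)
    (G : ℕ → ℝ) (hG : ∀ n, 0 ≤ G n) :
    ∑ z ∈ Y ×ˢ Y, G (z.1 * z.2) ≤ 2 * ∑ n ∈ Finset.range K, G n := by
  have hmaps : ∀ z ∈ Y ×ˢ Y, z.1 * z.2 ∈ Finset.range K := by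
    intro z hz
    rw [Finset.mem_product] at hz
    exact Finset.mem_range.2 (hK _ hz.1 _ hz.2)
  rw [← Finset.sum_fiberwise_of_maps_to hmaps, Finset.mul_sum]
  apply Finset.sum_le_sum
  intro n _
  have h1 : ∑ z ∈ (Y ×ˢ Y).filter (fun z => z.1 * z.2 = n), G (z.1 * z.2)
      = ((Y ×ˢ Y).filter (fun z => z.1 * z.2 = n)).card * G n := by
    rw [Finset.sum_congr rfl (g := fun _ => G n), Finset.sum_const, nsmul_eq_mul]
    intro z hz
    rw [(Finset.mem_filter.1 hz).2]
  rw [h1]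
  have hcard : ((Y ×ˢ Y).filter (fun z => z.1 * z.2 = n)).card ≤ 2 := by
    rcases Finset.eq_empty_or_nonempty ((Y ×ˢ Y).filter (fun z => z.1 * z.2 = n)) with h | ⟨w, hw⟩
    · rw [h]; simp
    · have hsub : (Y ×ˢ Y).filter (fun z => z.1 * z.2 = n) ⊆ {w, (w.2, w.1)} := by
        intro z hz
        simp only [Finset.mem_filter, Finset.mem_product] at hz hw
        have p1 := hY _ hz.1.1
        have p2 := hY _ hz.1.2
        have q1 := hY _ hw.1.1
        have q2 := hY _ hw.1.2
        have e : z.1 * z.2 = w.1 * w.2 := hz.2.trans hw.2.symm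
        have hd : z.1 ∣ w.1 * w.2 := ⟨z.2, e.symm⟩
        rw [Finset.mem_insert, Finset.mem_singleton]
        rcases (Nat.Prime.dvd_mul p1).1 hd with h | h
        · left
          have e1 := (Nat.prime_dvd_prime_iff_eq p1 q1).1 h
          rw [e1] at e
          exact Prod.ext e1 (Nat.eq_of_mul_eq_mul_left q1.pos e)
        · right
          have e1 := (Nat.prime_dvd_prime_iff_eq p1 q2).1 h
          rw [e1, mul_comm w.1] at e
          exact Prod.ext e1 (Nat.eq_of_mul_eq_mul_left q2.pos e)
      exact (Finset.card_le_card hsub).trans Finset.card_le_two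
  have : (((Y ×ˢ Y).filter (fun z => z.1 * z.2 = n)).card : ℝ) ≤ 2 := by exact_mod_cast hcard
  exact mul_le_mul_of_nonneg_right this (hG n)

theorem pb_PV_pair (x x' M : ℕ) (hx : x.Prime) (hx' : x'.Prime) (h2 : x ≠ 2) (h2' : x' ≠ 2) (hne : x ≠ x')
    (hM : x ≤ M) (hM' : x' ≤ M) (K : ℕ) :
    ∑ n ∈ Finset.range K, ((jacobiSym n x : ℤ) : ℝ) * ((jacobiSym n x' : ℤ) : ℝ) ≤ M * (1 + 2 * Real.log M) := by
  have hNZ : NeZero (x * x') := ⟨mul_ne_zero hx.ne_zero hx'.ne_zero⟩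
  have hodd : Odd (x * x') := (hx.odd_of_ne_two h2).mul (hx'.odd_of_ne_two h2')
  have hcop : Nat.Coprime x x' := (Nat.coprime_primes hx hx').2 hne
  have hsq : Squarefree (x * x') := (Nat.squarefree_mul hcop).2 ⟨hx.squarefree, hx'.squarefree⟩
  obtain ⟨χ, hχ⟩ := pb_char1 (x * x')
  have hprim := pb_prim (x * x') hodd hsq χ hχ
  have hχ2 : χ ^ 2 = 1 := by
    apply pb_quad_sq
    intro a
    rw [hχ]
    rcases jacobiSym.trichotomy a (x * x') with h | h | h <;> rw [h] <;> simp
  obtain ⟨n, hn1, hn2⟩ := pb_nonres (x * x') x hodd hsq hx ⟨x', rfl⟩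
  have hχ1 : χ ≠ 1 := by
    intro h
    have := hχ n
    rw [hn2, h] at this
    by_cases hu : IsUnit ((n : ℤ) : ZMod (x * x'))
    · rw [MulChar.one_apply hu] at this; norm_num at this
    · rw [MulChar.map_nonunit _ hu] at this; norm_num at this
  have hPV := pb_PV χ hχ1 hprim hχ2 K
  have e : ∑ n ∈ Finset.range K, χ (n : ZMod (x * x'))
      = ((∑ n ∈ Finset.range K, ((jacobiSym n x : ℤ) : ℝ) * ((jacobiSym n x' : ℤ) : ℝ) : ℝ) : ℂ) := by
    push_cast
    apply Finset.sum_congr rfl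
    intro n _
    have := hχ (n : ℤ)
    rw [Int.cast_natCast] at this
    rw [this, jacobiSym.mul_right' _ hx.ne_zero hx'.ne_zero]
    push_cast; rfl
  rw [e, Complex.norm_real] at hPV
  refine (le_abs_self _).trans (hPV.trans ?_)
  have hMR : (x : ℝ) ≤ M := by exact_mod_cast hM
  have hMR' : (x' : ℝ) ≤ M := by exact_mod_cast hM'
  have hx1 : (1:ℝ) ≤ x := by exact_mod_cast hx.one_lt.le
  have hx1' : (1:ℝ) ≤ x' := by exact_mod_cast hx'.one_lt.le
  have hle : ((x * x' : ℕ) : ℝ) ≤ M ^ 2 := by push_cast; nlinarith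
  have hpos : (1:ℝ) ≤ ((x * x' : ℕ) : ℝ) := by push_cast; nlinarith
  have h1 : Real.sqrt ((x * x' : ℕ) : ℝ) ≤ M := by
    rw [Real.sqrt_le_left (by positivity)]; exact hle
  have h2 : Real.log ((x * x' : ℕ) : ℝ) ≤ 2 * Real.log M := by
    have := Real.log_le_log (by linarith) hle
    rwa [Real.log_pow] at this
  have h3 : 0 ≤ Real.log ((x * x' : ℕ) : ℝ) := Real.log_nonneg hpos
  gcongr

theorem pb_bilinear (M N : ℕ) (hM1 : 1 ≤ M) (hMN : M ≤ N) (X Y : Finset ℕ) (hX : ∀ x ∈ X, x.Prime ∧ x ≠ 2 ∧ x ≤ M)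
    (hY : ∀ y ∈ Y, y.Prime ∧ y ≤ N) :
    (∑ x ∈ X, |((∑ y ∈ Y, jacobiSym y x : ℤ) : ℝ)|) ^ 4 ≤
      6 * (X.card : ℝ) ^ 3 * (Y.card : ℝ) ^ 2 * (N : ℝ) ^ 2 * (1 + Real.log M) := by
  set j : ℕ → ℕ → ℝ := fun y x => ((jacobiSym y x : ℤ) : ℝ) with hj
  have hjm : ∀ y y' x, j y x * j y' x = j (y * y') x := by
    intro y y' x; simp only [hj]; push_cast; rw [jacobiSym.mul_left]; push_cast; ring
  have hj1 : ∀ y x, |j y x| ≤ 1 := by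
    intro y x
    rcases jacobiSym.trichotomy y x with h | h | h <;> simp [hj, h]
  set g : ℕ → ℝ := fun n => ∑ x ∈ X, j n x with hg
  have hS : ∀ x, ((∑ y ∈ Y, jacobiSym y x : ℤ) : ℝ) = ∑ y ∈ Y, j y x := by intro x; push_cast; rfl
  simp_rw [hS]
  set S := ∑ x ∈ X, |∑ y ∈ Y, j y x| with hSdef
  have s1 : S ^ 2 ≤ X.card * ∑ z ∈ Y ×ˢ Y, g (z.1 * z.2) := by
    refine (sq_sum_le_card_mul_sum_sq (s := X) (f := fun x => |∑ y ∈ Y, j y x|)).trans (le_of_eq ?_)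
    congr 1
    simp only [hg]
    rw [Finset.sum_comm]
    apply Finset.sum_congr rfl
    intro x _
    rw [sq_abs, pow_two, Finset.sum_mul_sum, Finset.sum_product]
    simp_rw [hjm]
  have s2 : (∑ z ∈ Y ×ˢ Y, g (z.1 * z.2)) ^ 2 ≤ (Y.card : ℝ) ^ 2 * ∑ z ∈ Y ×ˢ Y, (g (z.1 * z.2)) ^ 2 := by
    refine (sq_sum_le_card_mul_sum_sq (s := Y ×ˢ Y) (f := fun z => g (z.1 * z.2))).trans (le_of_eq ?_)
    rw [Finset.card_product]; push_cast; ring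
  have s3 := pb_two_reps Y (fun y hy => (hY y hy).1) (N ^ 2 + 1) (by
    intro y hy y' hy'
    have h1 := (hY y hy).2
    have h2 := (hY y' hy').2
    nlinarith [Nat.mul_le_mul h1 h2]) (fun n => (g n) ^ 2) (fun n => sq_nonneg _)
  have hMR : (1:ℝ) ≤ M := by exact_mod_cast hM1
  have hNR : (M:ℝ) ≤ N := by exact_mod_cast hMN
  have hlog : 0 ≤ Real.log M := Real.log_nonneg hMR
  have hXM : (X.card : ℝ) ≤ M := by
    have : X ⊆ Finset.Icc 1 M := by
      intro x hx
      exact Finset.mem_Icc.2 ⟨(hX x hx).1.one_lt.le, (hX x hx).2.2⟩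
    have := Finset.card_le_card this
    rw [Nat.card_Icc] at this
    exact_mod_cast this
  have s4 : ∑ n ∈ Finset.range (N ^ 2 + 1), (g n) ^ 2 ≤ X.card * (3 * (N:ℝ) ^ 2 * (1 + Real.log M)) := by
    have e1 : ∑ n ∈ Finset.range (N ^ 2 + 1), (g n) ^ 2
        = ∑ x ∈ X, ∑ x' ∈ X, ∑ n ∈ Finset.range (N ^ 2 + 1), j n x * j n x' := by
      simp only [hg]
      simp_rw [pow_two (∑ x ∈ X, _), Finset.sum_mul_sum]
      rw [Finset.sum_comm]
      apply Finset.sum_congr rfl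
      intro x _
      rw [Finset.sum_comm]
    rw [e1]
    have e2 : ∀ x ∈ X, ∑ x' ∈ X, ∑ n ∈ Finset.range (N ^ 2 + 1), j n x * j n x'
        ≤ 3 * (N:ℝ) ^ 2 * (1 + Real.log M) := by
      intro x hx
      rw [← Finset.add_sum_erase _ _ hx]
      have d1 : ∑ n ∈ Finset.range (N ^ 2 + 1), j n x * j n x ≤ 2 * (N:ℝ) ^ 2 := by
        calc _ ≤ ∑ n ∈ Finset.range (N ^ 2 + 1), (1:ℝ) := by
              apply Finset.sum_le_sum
              intro n _
              have := hj1 n x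
              rw [abs_le] at this
              nlinarith
          _ = (N:ℝ) ^ 2 + 1 := by simp
          _ ≤ _ := by nlinarith
      have d2 : ∑ x' ∈ X.erase x, ∑ n ∈ Finset.range (N ^ 2 + 1), j n x * j n x'
          ≤ M * (M * (1 + 2 * Real.log M)) := by
        calc _ ≤ ∑ x' ∈ X.erase x, (M * (1 + 2 * Real.log M) : ℝ) := by
              apply Finset.sum_le_sum
              intro x' hx'
              rw [Finset.mem_erase] at hx'
              exact pb_PV_pair x x' M (hX x hx).1 (hX x' hx'.2).1 (hX x hx).2.1 (hX x' hx'.2).2.1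
                (Ne.symm hx'.1) (hX x hx).2.2 (hX x' hx'.2).2.2 _
          _ = (X.erase x).card * (M * (1 + 2 * Real.log M)) := by rw [Finset.sum_const, nsmul_eq_mul]
          _ ≤ _ := by
              have : ((X.erase x).card : ℝ) ≤ M := by
                refine le_trans ?_ hXM
                exact_mod_cast Finset.card_le_card (Finset.erase_subset _ _)
              gcongr
      have d3 : (M:ℝ) * (M * (1 + 2 * Real.log M)) ≤ N ^ 2 * (1 + 2 * Real.log M) := by
        rw [← mul_assoc, ← pow_two]; gcongr
      have : 0 ≤ (N:ℝ) ^ 2 * Real.log M := by positivity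
      nlinarith
    calc _ ≤ ∑ x ∈ X, (3 * (N:ℝ) ^ 2 * (1 + Real.log M)) := Finset.sum_le_sum e2
      _ = _ := by rw [Finset.sum_const, nsmul_eq_mul]
  have hx0 : (0:ℝ) ≤ X.card := by positivity
  calc S ^ 4 = (S ^ 2) ^ 2 := by ring
    _ ≤ (X.card * ∑ z ∈ Y ×ˢ Y, g (z.1 * z.2)) ^ 2 := by gcongr
    _ = (X.card : ℝ) ^ 2 * (∑ z ∈ Y ×ˢ Y, g (z.1 * z.2)) ^ 2 := by ring
    _ ≤ (X.card : ℝ) ^ 2 * ((Y.card : ℝ) ^ 2 * (2 * (X.card * (3 * (N:ℝ) ^ 2 * (1 + Real.log M))))) := by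
        have : ∑ z ∈ Y ×ˢ Y, (g (z.1 * z.2)) ^ 2 ≤ 2 * (X.card * (3 * (N:ℝ) ^ 2 * (1 + Real.log M))) := by
          refine s3.trans ?_
          gcongr
        refine mul_le_mul_of_nonneg_left (s2.trans ?_) (by positivity)
        gcongr
    _ = _ := by ring

end

section

/-- Recursive count of the points. -/
noncomputable def pbcnt : ℕ → (ℕ → Finset ℕ) → (ℕ → ℕ → ℕ → ℕ → Prop) → ℕ
  | 0, _, _ => 1
  | r + 1, X, R => ∑ x ∈ X 0, pbcnt r (fun j => (X (j + 1)).filter (fun y => R 0 (j + 1) x y))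
      (fun i j => R (i + 1) (j + 1))

/-- Recursive count of the conditions. -/
noncomputable def pbm : ℕ → (ℕ → ℕ → Prop) → ℕ
  | 0, _ => 0
  | r + 1, M => ((Finset.range r).filter (fun j => M 0 (j + 1))).card + pbm r (fun i j => M (i + 1) (j + 1))

theorem pbcnt_mono (r : ℕ) : ∀ (X X' : ℕ → Finset ℕ) (R : ℕ → ℕ → ℕ → ℕ → Prop),
    (∀ j < r, X j ⊆ X' j) → pbcnt r X R ≤ pbcnt r X' R := by
  induction r with
  | zero => intro X X' R _; simp [pbcnt]
  | succ r ih =>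
    intro X X' R h
    simp only [pbcnt]
    calc _ ≤ ∑ x ∈ X 0, pbcnt r (fun j => (X' (j + 1)).filter (fun y => R 0 (j + 1) x y))
            (fun i j => R (i + 1) (j + 1)) := by
          apply Finset.sum_le_sum
          intro x _
          apply ih
          intro j hj
          exact Finset.filter_subset_filter _ (h (j + 1) (by omega))
      _ ≤ _ := Finset.sum_le_sum_of_subset (h 0 (by omega))

structure PbHyp (c₁ c₂ c₃ c₄ c₅ c₇ cL A : ℝ) (r k : ℕ) (X : ℕ → Finset ℕ) (P : Finset ℕ)
    (s tt : ℕ → ℝ) (t : ℝ) : Prop where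
  hr : 1 ≤ r
  hk1 : 1 ≤ k
  hkr : k ≤ r
  prX : ∀ i < r, ∀ p ∈ X i, p.Prime ∧ p % 4 = 1 ∧ s i < (p : ℝ) ∧ (p : ℝ) ≤ tt i
  prP : ∀ p ∈ P, p.Prime ∧ (p % 4 = 1 ∨ p = 2) ∧ (p : ℝ) ≤ s 0
  st : ∀ i < r, s i < tt i
  ts : ∀ i j, i < j → j < r → tt i < s j
  As : A < s 0
  tls : t < s 0
  sieg : ∀ x : ℕ → ℕ, (∀ i < r, x i ∈ X i) → ∀ d : ℤ, t < |(d : ℝ)| →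
    d ∣ (∏ i ∈ Finset.range r, (x i : ℤ)) * ∏ p ∈ P, (p : ℤ) → d ∉ SiegelSet cL
  big : ∀ i < r, k ≤ i → ∃ Q ⊆ P, ∃ b : ℕ → ℤ, 2 ∉ Q ∧ (∀ p ∈ Q, b p = 1 ∨ b p = -1) ∧
    ∀ p : ℕ, p ∈ X i ↔ p.Prime ∧ p % 4 = 1 ∧ s i < (p : ℝ) ∧ (p : ℝ) ≤ tt i ∧
      ∀ p' ∈ Q, jacobiSym p p' = b p'
  h1 : ∀ i < r, (P.card : ℝ) ≤ Real.log (tt i) - ((i : ℝ) + 1)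
  h2 : (r : ℝ) ^ c₁ < tt 0
  h2' : tt (k - 1) < Real.exp (tt 0 ^ c₂)
  h3 : ∀ i < r, (2 : ℝ) ^ (c₃ * ((i : ℝ) + 1)) * tt i / (Real.log (tt i)) ^ c₄ ≤ ((X i).card : ℝ)
  h4 : k < r → Real.exp ((Real.log (tt 0)) ^ c₅) < tt k
  h5 : (k : ℝ) ≤ (⌈c₇ * Real.log (tt 0)⌉ : ℤ)
  h5' : ∀ i < r, ∀ j < r, (i : ℝ) + c₇ * Real.log (tt i) ≤ (j : ℝ) →
    Real.exp ((Real.log (tt i)) ^ c₅) < tt j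

theorem PbHyp.tt_mono {c₁ c₂ c₃ c₄ c₅ c₇ cL A : ℝ} {r k : ℕ} {X : ℕ → Finset ℕ} {P : Finset ℕ}
    {s tt : ℕ → ℝ} {t : ℝ} (h : PbHyp c₁ c₂ c₃ c₄ c₅ c₇ cL A r k X P s tt t) (i j : ℕ) (hij : i ≤ j) (hj : j < r) :
    tt i ≤ tt j := by
  rcases hij.eq_or_lt with rfl | h'
  · exact le_rfl
  · exact ((h.ts i j h' hj).trans (h.st j hj)).le

theorem pb_step_hyp (c₁ c₂ c₃ c₄ c₅ c₇ cL A : ℝ) (hc₁ : 0 < c₁) (hc₂ : 0 < c₂) (hc₅ : 3 < c₅) (hc₇ : 0 < c₇)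
    (hA3 : 3 ≤ A) (hA : ∀ T > A, (Real.log T) ^ c₅ < T ^ c₂)
    {r k : ℕ} {X : ℕ → Finset ℕ} {P : Finset ℕ} {s tt : ℕ → ℝ} {t : ℝ} (hr : 1 ≤ r)
    (h : PbHyp c₁ c₂ c₃ c₄ c₅ c₇ cL A (r + 1) k X P s tt t) (x : ℕ) (hx : x ∈ X 0) (X' : ℕ → Finset ℕ)
    (hX' : ∀ j < r, X' j = X (j + 1) ∨ ∃ β : ℤ, (β = 1 ∨ β = -1) ∧
      X' j = (X (j + 1)).filter (fun y : ℕ => jacobiSym x y = β))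
    (hcard : ∀ j < r, (2:ℝ) ^ (-c₃) * (X (j + 1)).card ≤ (X' j).card) :
    ∃ k', PbHyp c₁ c₂ c₃ c₄ c₅ c₇ cL A r k' X' (insert x P) (fun i => s (i + 1)) (fun i => tt (i + 1)) t := by
  have hA1 : A < tt 1 := by
    have := h.As; have := h.st 0 (by omega); have := h.ts 0 1 (by omega) (by omega); have := h.st 1 (by omega)
    linarith
  have hA0 : A < tt 0 := by have := h.As; have := h.st 0 (by omega); linarith
  have hs01 : s 0 < s 1 := by
    have := h.st 0 (by omega); have := h.ts 0 1 (by omega) (by omega); linarith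
  have h01 : tt 0 ≤ tt 1 := h.tt_mono 0 1 (by omega) (by omega)
  have hlog1 : 1 ≤ Real.log (tt 1) := by
    rw [Real.le_log_iff_exp_le (by linarith)]
    have := Real.exp_one_lt_d9
    linarith
  have hsub : ∀ j < r, X' j ⊆ X (j + 1) := by
    intro j hj
    rcases hX' j hj with e | ⟨β, _, e⟩
    · rw [e]
    · rw [e]; exact Finset.filter_subset _ _
  obtain ⟨hxp, hx4, hxs, hxt⟩ := h.prX 0 (by omega) x hx
  have hxP : x ∉ P := by
    intro hmem
    have := (h.prP x hmem).2.2
    linarith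
  set S := (Finset.range r).filter (fun j => j + 1 < k ∨ tt (j + 1) ≤ Real.exp ((Real.log (tt 1)) ^ c₅)) with hS
  have hS0 : 0 ∈ S := by
    rw [hS, Finset.mem_filter, Finset.mem_range]
    refine ⟨by omega, Or.inr ?_⟩
    have : Real.log (tt 1) ≤ (Real.log (tt 1)) ^ c₅ := by
      conv_lhs => rw [← Real.rpow_one (Real.log (tt 1))]
      exact Real.rpow_le_rpow_of_exponent_le hlog1 (by linarith)
    calc tt (0 + 1) = Real.exp (Real.log (tt 1)) := by rw [Real.exp_log (by linarith)]
      _ ≤ _ := Real.exp_le_exp.2 this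
  obtain ⟨j₀, hj₀, hk'⟩ := Finset.exists_mem_eq_sup S ⟨0, hS0⟩ (fun j => j + 1)
  have hnot : ∀ i < r, j₀ + 1 ≤ i → i ∉ S := by
    intro i hi hji hmem
    have : i + 1 ≤ S.sup (fun j => j + 1) := Finset.le_sup (f := fun j => j + 1) hmem
    rw [hk'] at this
    omega
  rw [hS, Finset.mem_filter, Finset.mem_range] at hj₀
  have hnot' : ∀ i < r, j₀ + 1 ≤ i → k ≤ i + 1 ∧ Real.exp ((Real.log (tt 1)) ^ c₅) < tt (i + 1) := by
    intro i hi hji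
    have := hnot i hi hji
    rw [hS, Finset.mem_filter, Finset.mem_range] at this
    push Not at this
    exact this hi
  refine ⟨j₀ + 1, ?_⟩
  constructor
  · exact hr
  · omega
  · omega
  · intro i hi p hp
    exact h.prX (i + 1) (by omega) p (hsub i hi hp)
  · intro p hp
    rw [Finset.mem_insert] at hp
    rcases hp with rfl | hp
    · refine ⟨hxp, Or.inl hx4, ?_⟩
      have := h.ts 0 1 (by omega) (by omega)
      simp only [zero_add]; linarith
    · obtain ⟨a, b, c⟩ := h.prP p hp
      refine ⟨a, b, ?_⟩
      simp only [zero_add]; linarith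
  · intro i hi; exact h.st (i + 1) (by omega)
  · intro i j hij hj; exact h.ts (i + 1) (j + 1) (by omega) (by omega)
  · have := h.As; simp only [zero_add]; linarith
  · have := h.tls; simp only [zero_add]; linarith
  · intro z hz d hd hdvd
    refine h.sieg (fun i => if i = 0 then x else z (i - 1)) ?_ d hd ?_
    · intro i hi
      rcases i with _ | i
      · simpa using hx
      · simpa using hsub i (by omega) (hz i (by omega))
    · rw [Finset.prod_range_succ']
      rw [Finset.prod_insert hxP] at hdvd
      simp only [Nat.add_eq_zero_iff, one_ne_zero, and_false, if_false, if_true, Nat.add_sub_cancel]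
      rw [mul_assoc]; exact hdvd
  · intro i hi hki
    obtain ⟨Q, hQP, b, hQ2, hb, hiff⟩ := h.big (i + 1) (by omega) (hnot' i hi hki).1
    rcases hX' i hi with e | ⟨β, hβ, e⟩
    · refine ⟨Q, hQP.trans (Finset.subset_insert _ _), b, hQ2, hb, ?_⟩
      intro p
      rw [e]; exact hiff p
    · have hxQ : x ∉ Q := fun hm => hxP (hQP hm)
      refine ⟨insert x Q, Finset.insert_subset_insert _ hQP, Function.update b x β, ?_, ?_, ?_⟩
      · rw [Finset.mem_insert]
        push Not
        refine ⟨?_, hQ2⟩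
        rintro rfl; norm_num at hx4
      · intro p hp
        rw [Finset.mem_insert] at hp
        by_cases hpx : p = x
        · rw [hpx, Function.update_self]; exact hβ
        · rw [Function.update_of_ne hpx]; exact hb p (hp.resolve_left hpx)
      · intro p
        rw [e, Finset.mem_filter, hiff p]
        have hQeq : (∀ p' ∈ insert x Q, jacobiSym p p' = Function.update b x β p') ↔
            (jacobiSym p x = β ∧ ∀ p' ∈ Q, jacobiSym p p' = b p') := by
          rw [Finset.forall_mem_insert, Function.update_self]
          have : ∀ p' ∈ Q, Function.update b x β p' = b p' := by
            intro p' hp'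
            exact Function.update_of_ne (by rintro rfl; exact hxQ hp') _ _
          constructor
          · rintro ⟨a, b⟩; exact ⟨a, fun p' hp' => by rw [b p' hp', this p' hp']⟩
          · rintro ⟨a, b⟩; exact ⟨a, fun p' hp' => by rw [b p' hp', this p' hp']⟩
        rw [hQeq]
        constructor
        · rintro ⟨⟨a, b, c, d, e⟩, f⟩
          refine ⟨a, b, c, d, ?_, e⟩
          rw [← f]
          exact (jacobiSym.quadratic_reciprocity_one_mod_four hx4 (by rw [Nat.odd_iff]; omega)).symm
        · rintro ⟨a, b, c, d, f, e⟩
          refine ⟨⟨a, b, c, d, e⟩, ?_⟩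
          rw [← f]
          exact (jacobiSym.quadratic_reciprocity_one_mod_four hx4 (by rw [Nat.odd_iff]; omega))
  · intro i hi
    have := h.h1 (i + 1) (by omega)
    rw [Finset.card_insert_of_notMem hxP]
    push_cast at this ⊢
    linarith
  · have := h.h2
    have h2 : (r:ℝ) ^ c₁ ≤ ((r + 1 : ℕ) : ℝ) ^ c₁ := by
      apply Real.rpow_le_rpow (by positivity) _ hc₁.le
      push_cast; linarith
    simp only [zero_add]
    linarith
  · simp only [Nat.add_sub_cancel, zero_add]
    rcases hj₀.2 with hj | hj
    · have a1 := h.h2'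
      have a2 := h.tt_mono (j₀ + 1) (k - 1) (by omega) (by have := h.hkr; omega)
      refine lt_of_le_of_lt a2 (lt_of_lt_of_le a1 ?_)
      apply Real.exp_le_exp.2
      exact Real.rpow_le_rpow (by linarith) h01 hc₂.le
    · refine lt_of_le_of_lt hj ?_
      exact Real.exp_lt_exp.2 (hA _ hA1)
  · intro i hi
    have a1 := h.h3 (i + 1) (by omega)
    refine le_trans ?_ (hcard i hi)
    refine le_trans (le_of_eq ?_) (mul_le_mul_of_nonneg_left a1 (by positivity))
    push_cast
    have : (2:ℝ) ^ (c₃ * ((i:ℝ) + 1)) = 2 ^ (-c₃) * 2 ^ (c₃ * ((i:ℝ) + 1 + 1)) := by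
      rw [← Real.rpow_add (by norm_num)]; congr 1; ring
    rw [this]; ring
  · intro hlt
    exact (hnot' (j₀ + 1) hlt le_rfl).2
  · simp only [zero_add]
    rcases hj₀.2 with hj | hj
    · have a1 := h.h5
      have a2 : ⌈c₇ * Real.log (tt 0)⌉ ≤ ⌈c₇ * Real.log (tt 1)⌉ := by
        apply Int.ceil_le_ceil
        apply mul_le_mul_of_nonneg_left _ hc₇.le
        exact Real.log_le_log (by linarith) h01
      have a3 : ((⌈c₇ * Real.log (tt 0)⌉ : ℤ) : ℝ) ≤ (⌈c₇ * Real.log (tt 1)⌉ : ℤ) := by exact_mod_cast a2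
      have a4 : ((j₀ + 1 : ℕ) : ℝ) ≤ k := by exact_mod_cast hj.le
      linarith
    · have a1 := h.h5' 1 (by omega) (j₀ + 1) (by omega)
      have a2 : ¬ (((1 : ℕ) : ℝ) + c₇ * Real.log (tt 1) ≤ ((j₀ + 1 : ℕ) : ℝ)) := by
        intro hle
        have := a1 hle
        linarith
      push Not at a2
      push_cast at a2
      have a3 : ((j₀ : ℤ) : ℝ) < c₇ * Real.log (tt 1) := by push_cast; linarith
      have a4 := Int.lt_ceil.2 a3
      have a5 : (j₀ : ℤ) + 1 ≤ ⌈c₇ * Real.log (tt 1)⌉ := by omega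
      exact_mod_cast a5
  · intro i hi j hj hle
    apply h.h5' (i + 1) (by omega) (j + 1) (by omega)
    push_cast
    linarith

end

section

theorem pb_asym_near (c₄ ε : ℝ) (hε : 0 < ε) : ∃ A : ℝ, 3 ≤ A ∧ ∀ T > A,
    6 * (1 + Real.log T) * (Real.log T) ^ c₄ ≤ T ^ (4 * ε) := by
  have h1 : (fun x : ℝ => Real.log x ^ c₄) =o[Filter.atTop] (fun x : ℝ => x ^ (2 * ε)) :=
    isLittleO_log_rpow_rpow_atTop c₄ (by positivity)
  have h2 : (fun x : ℝ => Real.log x ^ (1:ℝ)) =o[Filter.atTop] (fun x : ℝ => x ^ (2 * ε)) :=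
    isLittleO_log_rpow_rpow_atTop 1 (by positivity)
  have e1 := h1.bound (show (0:ℝ) < 1 by norm_num)
  have e2 := h2.bound (show (0:ℝ) < 1/12 by norm_num)
  obtain ⟨A, hA⟩ := Filter.eventually_atTop.1 (e1.and e2)
  refine ⟨max A 3, le_max_right _ _, ?_⟩
  intro T hT
  have hTA : A ≤ T := (le_max_left _ _).trans hT.le
  have hT3 : 3 < T := lt_of_le_of_lt (le_max_right _ _) hT
  have hlog1 : 1 ≤ Real.log T := by
    rw [Real.le_log_iff_exp_le (by linarith)]
    have := Real.exp_one_lt_d9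
    linarith
  obtain ⟨a1, a2⟩ := hA T hTA
  have p0 : 0 < T ^ (2 * ε) := by apply Real.rpow_pos_of_pos; linarith
  rw [Real.rpow_one, Real.norm_of_nonneg (by linarith), Real.norm_of_nonneg p0.le] at a2
  rw [Real.norm_of_nonneg (by positivity), Real.norm_of_nonneg p0.le] at a1
  have : T ^ (4 * ε) = T ^ (2 * ε) * T ^ (2 * ε) := by
    rw [← Real.rpow_add (by linarith)]; congr 1; ring
  rw [this]
  apply mul_le_mul _ (by linarith) (by positivity) p0.le
  linarith

theorem pb_asym_far (c₄ c₅ K : ℝ) (hc₅ : 3 < c₅) : ∃ A : ℝ, 1 ≤ A ∧ ∀ Λ ≥ A,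
    Λ ^ c₄ * Real.exp (-Λ ^ (1/3:ℝ)) ≤ Real.exp (-(K * Λ ^ (1 / c₅))) := by
  have h1 : Real.log =o[Filter.atTop] (fun x : ℝ => x ^ (1/3:ℝ)) := isLittleO_log_rpow_atTop (by norm_num)
  have h2 : (fun x : ℝ => x ^ (1 / c₅)) =o[Filter.atTop] (fun x : ℝ => x ^ (1/3:ℝ)) := by
    have hlt : 1 / c₅ < (1/3:ℝ) := by
      rw [div_lt_div_iff₀ (by linarith) (by norm_num)]; linarith
    apply Asymptotics.isLittleO_of_tendsto'
    · filter_upwards [Filter.eventually_gt_atTop (0:ℝ)] with x hx hx0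
      exact absurd hx0 (Real.rpow_pos_of_pos hx _).ne'
    · have ht := tendsto_rpow_neg_atTop (show 0 < (1/3:ℝ) - 1 / c₅ by linarith)
      refine ht.congr' ?_
      filter_upwards [Filter.eventually_gt_atTop (0:ℝ)] with x hx
      rw [← Real.rpow_sub hx]; congr 1; ring
  have e1 := h1.bound (show (0:ℝ) < 1 / (2 * (|c₄| + 1)) by positivity)
  have e2 := h2.bound (show (0:ℝ) < 1 / (2 * (|K| + 1)) by positivity)
  obtain ⟨A, hA⟩ := Filter.eventually_atTop.1 (e1.and e2)
  refine ⟨max A 1, le_max_right _ _, ?_⟩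
  intro Λ hΛ
  have hΛA : A ≤ Λ := (le_max_left _ _).trans hΛ
  have hΛ1 : 1 ≤ Λ := (le_max_right _ _).trans hΛ
  obtain ⟨a1, a2⟩ := hA Λ hΛA
  have p0 : 0 < Λ ^ (1/3:ℝ) := by apply Real.rpow_pos_of_pos; linarith
  have p1 : 0 < Λ ^ (1/c₅) := by apply Real.rpow_pos_of_pos; linarith
  have p2 : 0 ≤ Real.log Λ := Real.log_nonneg hΛ1
  rw [Real.norm_of_nonneg p2, Real.norm_of_nonneg p0.le] at a1
  rw [Real.norm_of_nonneg p1.le, Real.norm_of_nonneg p0.le] at a2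
  rw [one_div_mul_eq_div, le_div_iff₀ (by positivity)] at a1 a2
  rw [Real.rpow_def_of_pos (by linarith : (0:ℝ) < Λ) c₄, ← Real.exp_add]
  apply Real.exp_le_exp.2
  have b1 : Real.log Λ * c₄ ≤ Real.log Λ * |c₄| := mul_le_mul_of_nonneg_left (le_abs_self _) p2
  have b2 : K * Λ ^ (1/c₅) ≤ |K| * Λ ^ (1/c₅) := mul_le_mul_of_nonneg_right (le_abs_self _) p1.le
  nlinarith

section
variable {c₁ c₂ c₃ c₄ c₅ c₇ cL A : ℝ} {r k : ℕ} {X : ℕ → Finset ℕ} {P : Finset ℕ} {s tt : ℕ → ℝ} {t : ℝ}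

theorem PbHyp.A_lt (h : PbHyp c₁ c₂ c₃ c₄ c₅ c₇ cL A r k X P s tt t) (i : ℕ) (hi : i < r) : A < tt i := by
  have h1 := h.As
  have h2 := h.st 0 (by omega)
  have h3 := h.tt_mono 0 i (by omega) hi
  linarith

theorem PbHyp.card_low (h : PbHyp c₁ c₂ c₃ c₄ c₅ c₇ cL A r k X P s tt t) (hA : 3 ≤ A) (hc₃ : 0 < c₃)
    (i : ℕ) (hi : i < r) :
    1 ≤ Real.log (tt i) ∧ tt i ≤ (X i).card * (Real.log (tt i)) ^ c₄ ∧ 0 < ((X i).card : ℝ) := by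
  have hAi := h.A_lt i hi
  have hlog1 : 1 ≤ Real.log (tt i) := by
    rw [Real.le_log_iff_exp_le (by linarith)]
    have := Real.exp_one_lt_d9
    linarith
  have h3 := h.h3 i hi
  have hp : 0 < (Real.log (tt i)) ^ c₄ := by apply Real.rpow_pos_of_pos; linarith
  have h2 : (1:ℝ) ≤ 2 ^ (c₃ * ((i:ℝ) + 1)) := Real.one_le_rpow (by norm_num) (by positivity)
  have hle : tt i ≤ (X i).card * (Real.log (tt i)) ^ c₄ := by
    rw [div_le_iff₀ hp] at h3
    refine le_trans ?_ h3
    nlinarith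
  refine ⟨hlog1, hle, ?_⟩
  by_contra hneg
  push Not at hneg
  nlinarith

theorem pb_near (c₁ c₂ c₃ c₄ c₅ c₇ cL ε : ℝ) (hc₃ : 0 < c₃) (hc₄ : 0 < c₄) (hε : 0 < ε) :
    ∃ A₀ : ℝ, 3 ≤ A₀ ∧ ∀ (A : ℝ) (r k : ℕ) (X : ℕ → Finset ℕ) (P : Finset ℕ) (s tt : ℕ → ℝ) (t : ℝ),
      A₀ ≤ A → PbHyp c₁ c₂ c₃ c₄ c₅ c₇ cL A r k X P s tt t → ∀ i, 1 ≤ i → i < k →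
      ∑ x ∈ X 0, |((∑ y ∈ X i, jacobiSym x y : ℤ) : ℝ)| ≤
        (X 0).card * (X i).card * tt 0 ^ (-(1/4) + c₂ * c₄ / 2 + ε) := by
  obtain ⟨A₀, hA₀3, hA₀⟩ := pb_asym_near c₄ ε hε
  refine ⟨A₀, hA₀3, ?_⟩
  intro A r k X P s tt t hA h i hi1 hik
  have hir : i < r := by have := h.hkr; omega
  have h0r : 0 < r := h.hr
  have hT := h.A_lt 0 h0r
  have hTi := h.A_lt i hir
  obtain ⟨l0, c0, p0⟩ := h.card_low (by linarith) hc₃ 0 h0r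
  obtain ⟨li, ci, pi⟩ := h.card_low (by linarith) hc₃ i hir
  have hmono := h.tt_mono 0 i (by omega) hir
  have e0 : ∑ x ∈ X 0, |((∑ y ∈ X i, jacobiSym x y : ℤ) : ℝ)|
      = ∑ x ∈ X 0, |((∑ y ∈ X i, jacobiSym y x : ℤ) : ℝ)| := by
    apply Finset.sum_congr rfl
    intro x hx
    congr 2
    apply Finset.sum_congr rfl
    intro y hy
    have := (h.prX 0 h0r x hx).2.1
    have hy4 := (h.prX i hir y hy).2.1
    exact jacobiSym.quadratic_reciprocity_one_mod_four this (by rw [Nat.odd_iff]; omega)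
  rw [e0]
  have hB := pb_bilinear ⌊tt 0⌋₊ ⌊tt i⌋₊ (Nat.le_floor (by push_cast; linarith)) (Nat.floor_le_floor hmono) (X 0) (X i)
    (by
      intro x hx
      obtain ⟨a, b, c, d⟩ := h.prX 0 h0r x hx
      exact ⟨a, by rintro rfl; omega, Nat.le_floor d⟩)
    (by
      intro x hx
      obtain ⟨a, b, c, d⟩ := h.prX i hir x hx
      exact ⟨a, Nat.le_floor d⟩)
  have hM : ((⌊tt 0⌋₊ : ℕ) : ℝ) ≤ tt 0 := Nat.floor_le (by linarith)
  have hM1 : (1:ℝ) ≤ ((⌊tt 0⌋₊ : ℕ) : ℝ) := by exact_mod_cast Nat.le_floor (by push_cast; linarith)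
  have hN : ((⌊tt i⌋₊ : ℕ) : ℝ) ≤ tt i := Nat.floor_le (by linarith)
  have hlogM : Real.log ((⌊tt 0⌋₊ : ℕ) : ℝ) ≤ Real.log (tt 0) := Real.log_le_log (by linarith) hM
  have hlogi : Real.log (tt i) ≤ tt 0 ^ c₂ := by
    have a1 := h.tt_mono i (k - 1) (by omega) (by have := h.hkr; omega)
    have a2 := h.h2'
    rw [Real.log_le_iff_le_exp (by linarith)]
    linarith
  have hN2 : ((⌊tt i⌋₊ : ℕ) : ℝ) ≤ (X i).card * tt 0 ^ (c₂ * c₄) := by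
    refine hN.trans (ci.trans ?_)
    have : (Real.log (tt i)) ^ c₄ ≤ tt 0 ^ (c₂ * c₄) := by
      rw [Real.rpow_mul (by linarith)]
      exact Real.rpow_le_rpow (by linarith) hlogi hc₄.le
    gcongr
  set a : ℝ := ((X 0).card : ℝ) with ha
  set b : ℝ := ((X i).card : ℝ) with hb
  set T := tt 0 with hTdef
  have hT0 : 0 < T := by linarith
  have hAs := hA₀ T (by linarith)
  set l := Real.log T with hl
  have hlc : 0 < l ^ c₄ := by apply Real.rpow_pos_of_pos; linarith
  refine le_of_pow_le_pow_left₀ (n := 4) (by norm_num) (by positivity) (hB.trans ?_)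
  have E : (a * b * T ^ (-(1/4) + c₂ * c₄ / 2 + ε)) ^ 4
      = a ^ 4 * b ^ 4 * (T ^ (c₂ * c₄)) ^ 2 * T ^ (4 * ε) / T := by
    have e1 : (T ^ (-(1/4) + c₂ * c₄ / 2 + ε)) ^ 4 = (T ^ (c₂ * c₄)) ^ 2 * T ^ (4 * ε) / T := by
      rw [← Real.rpow_natCast, ← Real.rpow_natCast, ← Real.rpow_mul hT0.le, ← Real.rpow_mul hT0.le,
        ← Real.rpow_add hT0, eq_div_iff hT0.ne']
      nth_rw 2 [← Real.rpow_one T]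
      rw [← Real.rpow_add hT0]
      congr 1; push_cast; ring
    rw [mul_pow, e1]; ring
  rw [E, le_div_iff₀ hT0]
  calc 6 * a ^ 3 * b ^ 2 * ((⌊tt i⌋₊ : ℕ) : ℝ) ^ 2 * (1 + Real.log ((⌊T⌋₊ : ℕ) : ℝ)) * T
      ≤ 6 * a ^ 3 * b ^ 2 * (b * T ^ (c₂ * c₄)) ^ 2 * (1 + l) * (a * l ^ c₄) := by
        have : 0 ≤ Real.log ((⌊T⌋₊ : ℕ) : ℝ) := Real.log_nonneg hM1
        gcongr
    _ = a ^ 4 * b ^ 4 * (T ^ (c₂ * c₄)) ^ 2 * (6 * (1 + l) * l ^ c₄) := by ring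
    _ ≤ _ := by gcongr

theorem pb_far (c₁ c₂ c₃ c₄ c₅ c₇ cL K : ℝ) (hc₃ : 0 < c₃) (hc₅ : 3 < c₅) (hcL0 : 0 < cL)
    (hcL : cL < 1/2) (hK : 0 < K) :
    ∃ A₀ : ℝ, 3 ≤ A₀ ∧ ∀ (A : ℝ) (r k : ℕ) (X : ℕ → Finset ℕ) (P : Finset ℕ) (s tt : ℕ → ℝ) (t : ℝ),
      A₀ ≤ A → PbHyp c₁ c₂ c₃ c₄ c₅ c₇ cL A r k X P s tt t → ∀ i, k ≤ i → i < r → ∀ x ∈ X 0,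
      |((∑ y ∈ X i, jacobiSym x y : ℤ) : ℝ)| ≤ (X i).card * tt 0 ^ (-K) := by
  obtain ⟨A₁, hA₁1, hA₁⟩ := pb_jac_sum cL c₅ hcL0 hcL hc₅
  obtain ⟨A₂, hA₂1, hA₂⟩ := pb_asym_far c₄ c₅ K hc₅
  refine ⟨max 3 (max (Real.exp A₁) (Real.exp A₂)), le_max_left _ _, ?_⟩
  intro A r k X P s tt t hA h i hki hir x hx
  have hA3 : 3 ≤ A := (le_max_left _ _).trans hA
  have hAe1 : Real.exp A₁ ≤ A := ((le_max_left _ _).trans (le_max_right _ _)).trans hA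
  have hAe2 : Real.exp A₂ ≤ A := ((le_max_right _ _).trans (le_max_right _ _)).trans hA
  have hk1 := h.hk1
  have h0r : 0 < r := h.hr
  have hT := h.A_lt 0 h0r
  have hTi := h.A_lt i hir
  obtain ⟨l0, c0, p0⟩ := h.card_low hA3 hc₃ 0 h0r
  obtain ⟨li, ci, pi⟩ := h.card_low hA3 hc₃ i hir
  set L := Real.log (tt 0) with hL
  set Λ := Real.log (tt i) with hΛ
  have hLA : A₁ ≤ L := by rw [hL, Real.le_log_iff_exp_le (by linarith)]; linarith
  have hLA2 : A₂ ≤ L := by rw [hL, Real.le_log_iff_exp_le (by linarith)]; linarith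
  have hΛL : L ^ c₅ ≤ Λ := by
    have a1 := h.h4 (by omega)
    have a2 := h.tt_mono k i hki hir
    rw [hΛ, Real.le_log_iff_exp_le (by linarith)]
    linarith
  have hLL : L ≤ L ^ c₅ := by
    conv_lhs => rw [← Real.rpow_one L]
    exact Real.rpow_le_rpow_of_exponent_le l0 (by linarith)
  have hexpΛ : Real.exp Λ = tt i := Real.exp_log (by linarith)
  obtain ⟨hxp, hx4, hxs, hxt⟩ := h.prX 0 h0r x hx
  have hxP : x ∉ P := by
    intro hmem
    have := (h.prP x hmem).2.2
    linarith
  obtain ⟨Q, hQP, b, hQ2, hb, hiff⟩ := h.big i hir hki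
  have hs0i : s 0 < s i := by
    have := h.st 0 h0r; have := h.ts 0 i (by omega) hir; linarith
  have hAs := h.As
  have hsum : ∑ y ∈ X i, jacobiSym x y = ∑ y ∈ X i, jacobiSym y x := by
    apply Finset.sum_congr rfl
    intro y hy
    have hy4 := (h.prX i hir y hy).2.1
    exact jacobiSym.quadratic_reciprocity_one_mod_four hx4 (by rw [Nat.odd_iff]; omega)
  rw [hsum]
  have hE : |((∑ y ∈ X i, jacobiSym y x : ℤ) : ℝ)| ≤ Real.exp (Λ - Λ ^ (1/3:ℝ)) := by
    apply pb_large_sum x hxp Q (fun p hp => (h.prP p (hQP hp)).1) b hb ⌊s i⌋₊ ⌊tt i⌋₊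
      (Nat.le_floor (by push_cast; linarith))
    · intro p hp
      apply Nat.le_floor
      have := (h.prP p (hQP hp)).2.2
      linarith
    · intro p
      rw [hiff p, Nat.floor_lt (by linarith), Nat.le_floor_iff (by linarith)]
    · intro T hTQ
      rw [Finset.mem_powerset] at hTQ
      have hTprime : ∀ p ∈ T, p.Prime := fun p hp => (h.prP p (hQP (hTQ hp))).1
      have hT4 : ∀ p ∈ T, p % 4 = 1 := by
        intro p hp
        rcases (h.prP p (hQP (hTQ hp))).2.1 with h' | h'
        · exact h'
        · subst h'; exact absurd (hTQ hp) hQ2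
      have hxT : x ∉ T := fun hm => hxP (hQP (hTQ hm))
      have hD : x * ∏ p ∈ T, p = ∏ p ∈ insert x T, p := by rw [Finset.prod_insert hxT]
      have hDsq : Squarefree (x * ∏ p ∈ T, p) := by
        rw [hD]
        refine Finset.squarefree_prod_of_pairwise_isCoprime ?_ ?_
        rotate_left
        · intro p hp
          rw [Finset.mem_insert] at hp
          rcases hp with rfl | hp
          · exact hxp.squarefree
          · exact (hTprime p hp).squarefree
        · intro p hp q hq hpq
          have hpr : ∀ p ∈ insert x T, p.Prime := by
            intro p hp
            rw [Finset.mem_insert] at hp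
            rcases hp with rfl | hp
            · exact hxp
            · exact hTprime p hp
          exact Nat.coprime_iff_isRelPrime.1 ((Nat.coprime_primes (hpr p hp) (hpr q hq)).2 hpq)
      have hD4 : (x * ∏ p ∈ T, p) % 4 = 1 := by
        have hT1 : ∀ S : Finset ℕ, (∀ p ∈ S, p % 4 = 1) → (∏ p ∈ S, p) % 4 = 1 := by
          intro S hS
          rw [Finset.prod_nat_mod, Finset.prod_congr rfl hS]
          simp
        rw [Nat.mul_mod, hT1 T hT4, (h.prX 0 h0r x hx).2.1]
      have hprodpos : 1 ≤ ∏ p ∈ T, p := Finset.one_le_prod' (fun p hp => (hTprime p hp).one_lt.le)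
      have hxD : x ≤ x * ∏ p ∈ T, p := Nat.le_mul_of_pos_right x hprodpos
      have hD1 : x * ∏ p ∈ T, p ≠ 1 := by have := hxp.one_lt; omega
      have hlogD : Real.log ((x * ∏ p ∈ T, p : ℕ) : ℝ) ≤ L ^ 2 := by
        have hx0 : (0:ℝ) < x := by exact_mod_cast hxp.pos
        have hle : ((x * ∏ p ∈ T, p : ℕ) : ℝ) ≤ tt 0 ^ (T.card + 1) := by
          push_cast
          rw [pow_succ, mul_comm]
          apply mul_le_mul _ hxt hx0.le (by apply pow_nonneg; linarith)
          rw [← Finset.prod_const]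
          apply Finset.prod_le_prod
          · intro p _; positivity
          · intro p hp
            have := (h.prP p (hQP (hTQ hp))).2.2
            have := h.st 0 h0r
            linarith
        have hpos : (0:ℝ) < ((x * ∏ p ∈ T, p : ℕ) : ℝ) := by
          exact_mod_cast Nat.mul_pos hxp.pos hprodpos
        have a1 := Real.log_le_log hpos hle
        rw [Real.log_pow, Nat.cast_add, Nat.cast_one] at a1
        have a2 := h.h1 0 h0r
        have a3 : (T.card : ℝ) ≤ P.card := by exact_mod_cast Finset.card_le_card (hTQ.trans hQP)
        push_cast at a2
        have a4 : (T.card : ℝ) + 1 ≤ L := by linarith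
        nlinarith
      have hne : ∀ j < r, ∃ z, z ∈ X j := by
        intro j hj
        have := (h.card_low hA3 hc₃ j hj).2.2
        have : 0 < (X j).card := by exact_mod_cast this
        exact Finset.card_pos.1 this
      choose! z hz using hne
      have hSieg : ∀ d : ℤ, (d = ((x * ∏ p ∈ T, p : ℕ) : ℤ) ∨ d = -((x * ∏ p ∈ T, p : ℕ) : ℤ)) →
          d ∉ SiegelSet cL := by
        intro d hd
        refine h.sieg (fun j => if j = 0 then x else z j) ?_ d ?_ ?_
        · intro j hj
          by_cases hj0 : j = 0
          · subst hj0; simpa using hx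
          · simpa [hj0] using hz j hj
        · have habs : |(d : ℝ)| = ((x * ∏ p ∈ T, p : ℕ) : ℝ) := by
            rcases hd with rfl | rfl
            · rw [Int.cast_natCast, Nat.abs_cast]
            · rw [Int.cast_neg, abs_neg, Int.cast_natCast, Nat.abs_cast]
          rw [habs]
          have : (x:ℝ) ≤ ((x * ∏ p ∈ T, p : ℕ) : ℝ) := by exact_mod_cast hxD
          have := h.tls
          linarith
        · have hdv : ((x * ∏ p ∈ T, p : ℕ) : ℤ) ∣
              (∏ i ∈ Finset.range r, ((if i = 0 then x else z i : ℕ) : ℤ)) * ∏ p ∈ P, (p : ℤ) := by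
            push_cast
            apply mul_dvd_mul
            · have := Finset.dvd_prod_of_mem (fun i => (if i = 0 then (x:ℤ) else (z i : ℤ))) (Finset.mem_range.2 h0r)
              simpa using this
            · exact Finset.prod_dvd_prod_of_subset _ _ _ (hTQ.trans hQP)
          rcases hd with rfl | rfl
          · exact hdv
          · exact (neg_dvd).2 hdv
      refine hA₁ L Λ hLA hΛL _ hDsq hD4 hD1 hlogD (hSieg _ (Or.inl rfl)) (hSieg _ (Or.inr rfl)) _ _
        (Nat.le_floor (by push_cast; linarith)) (Nat.floor_le_floor (h.st i hir).le) ?_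
      rw [hexpΛ]; exact Nat.floor_le (by linarith)
  refine hE.trans ?_
  have hB := hA₂ Λ (by linarith)
  rw [sub_eq_add_neg, Real.exp_add, hexpΛ]
  calc tt i * Real.exp (-Λ ^ (1/3:ℝ)) ≤ ((X i).card * Λ ^ c₄) * Real.exp (-Λ ^ (1/3:ℝ)) := by gcongr
    _ = (X i).card * (Λ ^ c₄ * Real.exp (-Λ ^ (1/3:ℝ))) := by ring
    _ ≤ (X i).card * Real.exp (-(K * Λ ^ (1 / c₅))) := by gcongr
    _ ≤ (X i).card * tt 0 ^ (-K) := by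
        gcongr
        rw [Real.rpow_def_of_pos (show (0:ℝ) < tt 0 by linarith) (-K)]
        apply Real.exp_le_exp.2
        have : L ≤ Λ ^ (1/c₅) := by
          have a1 := Real.rpow_le_rpow (by positivity) hΛL (show 0 ≤ 1/c₅ by positivity)
          rwa [← Real.rpow_mul (by linarith), mul_one_div_cancel (by linarith), Real.rpow_one] at a1
        nlinarith
end

end

section

theorem pbcnt_congr (r : ℕ) (X X' : ℕ → Finset ℕ) (R : ℕ → ℕ → ℕ → ℕ → Prop)
    (h : ∀ j < r, X j = X' j) : pbcnt r X R = pbcnt r X' R :=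
  le_antisymm (pbcnt_mono r X X' R (fun j hj => (h j hj).le))
    (pbcnt_mono r X' X R (fun j hj => (h j hj).ge))

theorem pb_filter_card (Y : Finset ℕ) (x : ℕ) (β : ℤ) (hβ : β = 1 ∨ β = -1)
    (hY : ∀ y ∈ Y, jacobiSym x y = 1 ∨ jacobiSym x y = -1) :
    (2:ℝ) * ((Y.filter (fun y : ℕ => jacobiSym x y = β)).card : ℝ)
      = Y.card + β * ((∑ y ∈ Y, jacobiSym x y : ℤ) : ℝ) := by
  have h : (2:ℤ) * ((Y.filter (fun y : ℕ => jacobiSym x y = β)).card : ℤ)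
      = Y.card + β * (∑ y ∈ Y, jacobiSym x y) := by
    rw [Finset.card_filter, Finset.card_eq_sum_ones]
    push_cast
    rw [Finset.mul_sum, Finset.mul_sum, ← Finset.sum_add_distrib]
    apply Finset.sum_congr rfl
    intro y hy
    rcases hβ with rfl | rfl <;> rcases hY y hy with h' | h' <;> rw [h'] <;> norm_num
  exact_mod_cast h

theorem pb_prod_close (J : Finset ℕ) (e : ℕ → ℝ) (σ : ℝ) (hσ1 : σ ≤ 1) (h : ∑ j ∈ J, |e j| ≤ σ) :
    |∏ j ∈ J, (1 + e j) - 1| ≤ 2 * σ := by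
  have h1 := Finset.norm_prod_one_add_sub_one_le J e
  simp only [Real.norm_eq_abs] at h1
  refine h1.trans ?_
  have h0 : 0 ≤ ∑ j ∈ J, |e j| := Finset.sum_nonneg (fun j _ => abs_nonneg _)
  have h2 := Real.abs_exp_sub_one_le (x := ∑ j ∈ J, |e j|) (by rw [abs_of_nonneg h0]; linarith)
  rw [abs_of_nonneg h0] at h2
  have := le_abs_self (Real.exp (∑ j ∈ J, |e j|) - 1)
  linarith

theorem pb_arith (n W V η σ : ℝ) (hη0 : 0 ≤ η) (hη : η ≤ 1) (hσ0 : 0 ≤ σ) (hV0 : 0 ≤ V)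
    (hWc : |W - 1| ≤ 2 * σ) (hih2 : |n - W * V| ≤ η * (W * V)) : |n - V| ≤ (η + 4 * σ) * V := by
  have hWV : |W * V - V| ≤ 2 * σ * V := by
    have : W * V - V = (W - 1) * V := by ring
    rw [this, abs_mul, abs_of_nonneg hV0]
    exact mul_le_mul_of_nonneg_right hWc hV0
  have hW2 : W ≤ 1 + 2 * σ := by have := (abs_le.1 hWc).2; linarith
  have := abs_sub_le n (W * V) V
  have h5 : η * (W * V) ≤ (η + 2 * σ) * V := by
    have : η * W ≤ η + 2 * σ := by nlinarith
    nlinarith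
  nlinarith

set_option maxHeartbeats 1000000 in
theorem pb_one (c₁ c₂ c₃ c₄ c₅ c₇ cL A κ σ : ℝ) (hc₁ : 0 < c₁) (hc₂ : 0 < c₂) (hc₃ : 0 < c₃) (hc₅ : 3 < c₅) (hc₇ : 0 < c₇)
    (hA3 : 3 ≤ A) (hA : ∀ T > A, (Real.log T) ^ c₅ < T ^ c₂) (hσ1 : σ ≤ 1)
    (hσ2 : 2 * (2:ℝ) ^ (-c₃) ≤ 1 - σ) (hκ : 0 ≤ κ)
    {r k : ℕ} {X : ℕ → Finset ℕ} {P : Finset ℕ} {s tt : ℕ → ℝ} {t : ℝ} (hr : 1 ≤ r)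
    (h : PbHyp c₁ c₂ c₃ c₄ c₅ c₇ cL A (r + 1) k X P s tt t)
    (hη : (r:ℝ) / tt 0 ^ κ ≤ 1)
    (ih : ∀ (k : ℕ) (X : ℕ → Finset ℕ) (P : Finset ℕ) (s tt : ℕ → ℝ) (t : ℝ),
      PbHyp c₁ c₂ c₃ c₄ c₅ c₇ cL A r k X P s tt t → ∀ (M : ℕ → ℕ → Prop) (a : ℕ → ℕ → ℤ),
      (∀ i j, a i j = 1 ∨ a i j = -1) →
      |(pbcnt r X (fun i j x y => M i j → jacobiSym x y = a i j) : ℝ) -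
        (∏ i ∈ Finset.range r, ((X i).card : ℝ)) / 2 ^ pbm r M| ≤
        r / tt 0 ^ κ * ((∏ i ∈ Finset.range r, ((X i).card : ℝ)) / 2 ^ pbm r M))
    (M : ℕ → ℕ → Prop) (a : ℕ → ℕ → ℤ) (ha : ∀ i j, a i j = 1 ∨ a i j = -1)
    (x : ℕ) (hx : x ∈ X 0) (J : Finset ℕ) (hJ : J ⊆ Finset.range r) (b : ℕ → ℤ) (hb : ∀ j, b j = 1 ∨ b j = -1)
    (hD : ∑ j ∈ J, |((∑ y ∈ X (j+1), jacobiSym x y : ℤ) : ℝ)| / (X (j+1)).card ≤ σ) :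
    |(pbcnt r (fun j => (X (j+1)).filter (fun y => j ∈ J → jacobiSym x y = b j))
        (fun i j x y => M i j → jacobiSym x y = a i j) : ℝ) -
        (∏ i ∈ Finset.range r, ((X (i+1)).card : ℝ)) / 2 ^ (J.card + pbm r M)| ≤
        (r / tt 0 ^ κ + 4 * σ) * ((∏ i ∈ Finset.range r, ((X (i+1)).card : ℝ)) / 2 ^ (J.card + pbm r M)) := by
  set X' : ℕ → Finset ℕ := fun j => (X (j+1)).filter (fun y => j ∈ J → jacobiSym x y = b j) with hX'def
  have h0r : 0 < r + 1 := by omega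
  have hxp := h.prX 0 h0r x hx
  have hpos : ∀ j < r, (0:ℝ) < (X (j+1)).card := fun j hj => (h.card_low hA3 hc₃ (j+1) (by omega)).2.2
  have hJX : ∀ j ∈ J, X' j = (X (j+1)).filter (fun y : ℕ => jacobiSym x y = b j) := by
    intro j hj; simp only [hX'def]; apply Finset.filter_congr; intro y _; simp [hj]
  have hJX2 : ∀ j, j ∉ J → X' j = X (j+1) := by
    intro j hj; simp only [hX'def]; rw [Finset.filter_true_of_mem]; intro y _ hj'; exact absurd hj' hj
  set e : ℕ → ℝ := fun j => b j * (((∑ y ∈ X (j+1), jacobiSym x y : ℤ) : ℝ) / (X (j+1)).card) with he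
  have hb1 : ∀ j, |(b j : ℝ)| = 1 := by
    intro j; rcases hb j with h' | h' <;> rw [h'] <;> simp
  have heabs : ∀ j, |e j| = |((∑ y ∈ X (j+1), jacobiSym x y : ℤ) : ℝ)| / (X (j+1)).card := by
    intro j; simp only [he]
    rw [abs_mul, hb1, one_mul, abs_div, Nat.abs_cast]
  have hsum : ∑ j ∈ J, |e j| ≤ σ := by
    rw [Finset.sum_congr rfl (fun j _ => heabs j)]; exact hD
  have hej : ∀ j ∈ J, |e j| ≤ σ := fun j hj =>
    (Finset.single_le_sum (f := fun j => |e j|) (fun i _ => abs_nonneg _) hj).trans hsum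
  have hσ0 : 0 ≤ σ := (Finset.sum_nonneg (fun j _ => abs_nonneg _)).trans hsum
  have hcardJ : ∀ j ∈ J, ((X' j).card : ℝ) = (X (j+1)).card * ((1/2) * (1 + e j)) := by
    intro j hj
    have hjr : j < r := Finset.mem_range.1 (hJ hj)
    rw [hJX j hj]
    have := pb_filter_card (X (j+1)) x (b j) (hb j) (by
      intro y hy
      have hy' := h.prX (j+1) (by omega) y hy
      apply pb_jac_pm x y hxp.1 hy'.1
      rintro rfl
      have := h.ts 0 (j+1) (by omega) (by omega)
      linarith [hxp.2.2.2, hy'.2.2.1])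
    have hp := hpos j hjr
    simp only [he]
    field_simp
    linarith
  obtain ⟨k', hk'⟩ := pb_step_hyp c₁ c₂ c₃ c₄ c₅ c₇ cL A hc₁ hc₂ hc₅ hc₇ hA3 hA hr h x hx X' (by
      intro j hj
      by_cases hjJ : j ∈ J
      · right; exact ⟨b j, hb j, hJX j hjJ⟩
      · left; exact hJX2 j hjJ) (by
      intro j hj
      have hp := hpos j hj
      by_cases hjJ : j ∈ J
      · rw [hcardJ j hjJ, mul_comm]
        apply mul_le_mul_of_nonneg_left _ hp.le
        have := abs_le.1 (hej j hjJ)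
        linarith [this.1]
      · rw [hJX2 j hjJ]
        have : (2:ℝ) ^ (-c₃) ≤ 1 := by linarith
        nlinarith)
  have hih := ih k' X' _ _ _ t hk' M a ha
  set W : ℝ := ∏ j ∈ J, (1 + e j) with hW
  have hWc : |W - 1| ≤ 2 * σ := pb_prod_close J e σ hσ1 hsum
  set V : ℝ := (∏ i ∈ Finset.range r, ((X (i+1)).card : ℝ)) / 2 ^ (J.card + pbm r M) with hV
  have hVX : (∏ i ∈ Finset.range r, ((X' i).card : ℝ)) / 2 ^ pbm r M = W * V := by
    have e1 : ∏ i ∈ Finset.range r, ((X' i).card : ℝ) =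
        ∏ i ∈ Finset.range r, ((X (i+1)).card : ℝ) * (if i ∈ J then (1/2) * (1 + e i) else 1) := by
      apply Finset.prod_congr rfl
      intro j _
      by_cases hjJ : j ∈ J
      · rw [if_pos hjJ, hcardJ j hjJ]
      · rw [if_neg hjJ, hJX2 j hjJ, mul_one]
    rw [e1, Finset.prod_mul_distrib, Finset.prod_ite_mem, Finset.inter_eq_right.2 hJ, Finset.prod_mul_distrib,
      Finset.prod_const, hV, pow_add, ← hW, one_div, inv_pow]
    have gen : ∀ (Q W : ℝ) (m n : ℕ), Q * (((2:ℝ) ^ n)⁻¹ * W) / 2 ^ m = W * (Q / (2 ^ n * 2 ^ m)) := by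
      intro Q W m n; field_simp
    exact gen _ _ _ _
  rw [hVX] at hih
  have hV0 : 0 ≤ V := by
    apply div_nonneg _ (by positivity)
    exact Finset.prod_nonneg (fun i _ => Nat.cast_nonneg _)
  have hW0 : 0 ≤ W := by
    apply Finset.prod_nonneg
    intro j hj
    have := abs_le.1 (hej j hj); linarith [this.1]
  have ht0 : 0 < tt 0 := by have := h.A_lt 0 h0r; linarith
  have hηle : (r:ℝ) / tt (0+1) ^ κ ≤ r / tt 0 ^ κ := by
    have := h.tt_mono 0 1 (by omega) (by omega)
    apply div_le_div_of_nonneg_left (by positivity) (Real.rpow_pos_of_pos ht0 _)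
    exact Real.rpow_le_rpow ht0.le this hκ
  have hη0 : 0 ≤ (r:ℝ) / tt 0 ^ κ := div_nonneg (Nat.cast_nonneg _) (Real.rpow_nonneg ht0.le _)
  set η : ℝ := (r:ℝ) / tt 0 ^ κ
  have hih2 : |(pbcnt r X' (fun i j x y => M i j → jacobiSym x y = a i j) : ℝ) - W * V| ≤ η * (W * V) :=
    hih.trans (mul_le_mul_of_nonneg_right hηle (mul_nonneg hW0 hV0))
  exact pb_arith _ W V η σ hη0 hη hσ0 hV0 hWc hih2

end

section

theorem pb_asym_main (c₂ c₃ c₅ c₇ κ ε : ℝ) (hc₂ : 0 < c₂) (hc₃ : 1 < c₃) (hκ : 0 < κ) (hε : 0 < ε) :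
    ∃ A : ℝ, 3 ≤ A ∧ ∀ T > A, (Real.log T) ^ c₅ < T ^ c₂ ∧ 16 * (c₇ * Real.log T + 1) + 4 ≤ T ^ ε ∧
      T ^ (-κ) ≤ 1 - 2 * (2:ℝ) ^ (-c₃) := by
  have h1 := (isLittleO_log_rpow_rpow_atTop c₅ hc₂).bound (show (0:ℝ) < 1/2 by norm_num)
  have h2 := (isLittleO_log_rpow_atTop hε).bound (show (0:ℝ) < 1 / (32 * (|c₇| + 1)) by positivity)
  have h3 := (tendsto_rpow_atTop hε).eventually (Filter.eventually_ge_atTop (40:ℝ))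
  have hpos : 0 < 1 - 2 * (2:ℝ) ^ (-c₃) := by
    have : (2:ℝ) ^ (-c₃) < 2 ^ (-1:ℝ) := Real.rpow_lt_rpow_of_exponent_lt (by norm_num) (by linarith)
    rw [Real.rpow_neg_one] at this
    linarith
  have h4 := (tendsto_rpow_neg_atTop hκ).eventually (eventually_lt_nhds hpos)
  obtain ⟨A, hA⟩ := Filter.eventually_atTop.1 (((h1.and h2).and h3).and h4)
  refine ⟨max A 3, le_max_right _ _, ?_⟩
  intro T hT
  have hTA : A ≤ T := (le_max_left _ _).trans hT.le
  have hT3 : 3 < T := lt_of_le_of_lt (le_max_right _ _) hT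
  obtain ⟨⟨⟨a1, a2⟩, a3⟩, a4⟩ := hA T hTA
  have hl : 0 ≤ Real.log T := Real.log_nonneg (by linarith)
  have p0 : 0 < T ^ c₂ := Real.rpow_pos_of_pos (by linarith) _
  have p1 : 0 < T ^ ε := Real.rpow_pos_of_pos (by linarith) _
  rw [Real.norm_of_nonneg (Real.rpow_nonneg hl _), Real.norm_of_nonneg p0.le] at a1
  rw [Real.norm_of_nonneg hl, Real.norm_of_nonneg p1.le, one_div_mul_eq_div, le_div_iff₀ (by positivity)] at a2
  refine ⟨by linarith, ?_, le_of_lt a4⟩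
  have : c₇ * Real.log T ≤ |c₇| * Real.log T := mul_le_mul_of_nonneg_right (le_abs_self _) hl
  nlinarith

theorem pb_real (c₁ c₂ c₄ c₇ κ ε T : ℝ) (k r : ℕ) (hT : 3 ≤ T) (hc₇ : 0 < c₇)
    (hk : (k:ℝ) ≤ c₇ * Real.log T + 1) (hr : (r:ℝ) ≤ T ^ (1 / c₁))
    (hb : 16 * (c₇ * Real.log T + 1) + 4 ≤ T ^ ε)
    (hm : c₇ * Real.log 2 - 1/4 + c₂ * c₄ / 2 + 2 * ε + κ ≤ -κ - ε) :
    4 * (k * T ^ (-κ - ε) + r * T ^ (-(κ + 1 / c₁ + ε))) +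
      6 * 2 ^ k * (k * T ^ (-(1/4) + c₂ * c₄ / 2 + ε) * T ^ (κ + ε)) ≤ T ^ (-κ) := by
  have hT0 : 0 < T := by linarith
  have hl : 0 ≤ Real.log T := Real.log_nonneg (by linarith)
  have h2 : (2:ℝ) ^ k ≤ 2 * T ^ (c₇ * Real.log 2) := by
    rw [Real.rpow_def_of_pos hT0, ← Real.rpow_natCast, Real.rpow_def_of_pos (by norm_num : (0:ℝ) < 2)]
    calc Real.exp (Real.log 2 * k) ≤ Real.exp (Real.log 2 + Real.log T * (c₇ * Real.log 2)) := by
          apply Real.exp_le_exp.2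
          have := Real.log_nonneg (show (1:ℝ) ≤ 2 by norm_num)
          nlinarith
      _ = _ := by rw [Real.exp_add, Real.exp_log (by norm_num)]
  set D := T ^ (-κ - ε) with hD
  have hD0 : 0 < D := Real.rpow_pos_of_pos hT0 _
  have e1 : (r:ℝ) * T ^ (-(κ + 1 / c₁ + ε)) ≤ D := by
    calc (r:ℝ) * T ^ (-(κ + 1 / c₁ + ε)) ≤ T ^ (1 / c₁) * T ^ (-(κ + 1 / c₁ + ε)) :=
          mul_le_mul_of_nonneg_right hr (Real.rpow_nonneg hT0.le _)
      _ = D := by rw [← Real.rpow_add hT0, hD]; congr 1; ring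
  have e2 : (2:ℝ) ^ k * (T ^ (-(1/4) + c₂ * c₄ / 2 + ε) * T ^ (κ + ε)) ≤ 2 * D := by
    calc (2:ℝ) ^ k * (T ^ (-(1/4) + c₂ * c₄ / 2 + ε) * T ^ (κ + ε))
        ≤ 2 * T ^ (c₇ * Real.log 2) * (T ^ (-(1/4) + c₂ * c₄ / 2 + ε) * T ^ (κ + ε)) := by
          apply mul_le_mul_of_nonneg_right h2
          exact mul_nonneg (Real.rpow_nonneg hT0.le _) (Real.rpow_nonneg hT0.le _)
      _ = 2 * T ^ (c₇ * Real.log 2 - 1/4 + c₂ * c₄ / 2 + 2 * ε + κ) := by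
          rw [mul_assoc, ← Real.rpow_add hT0, ← Real.rpow_add hT0]; congr 2; ring
      _ ≤ 2 * D := by
          have := Real.rpow_le_rpow_of_exponent_le (show 1 ≤ T by linarith) hm
          linarith
  have e3 : D * T ^ ε = T ^ (-κ) := by rw [hD, ← Real.rpow_add hT0]; congr 1; ring
  have e4 : 6 * 2 ^ k * (k * T ^ (-(1/4) + c₂ * c₄ / 2 + ε) * T ^ (κ + ε)) ≤ 12 * k * D := by
    have : (0:ℝ) ≤ k := Nat.cast_nonneg _
    have := mul_le_mul_of_nonneg_left e2 (show (0:ℝ) ≤ 6 * k by positivity)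
    linarith
  rw [← e3]
  nlinarith

theorem pb_sumD (r k : ℕ) (J : Finset ℕ) (hJ : J ⊆ Finset.range r) (f : ℕ → ℝ) (δ δ' : ℝ) (hδ : 0 ≤ δ) (hδ' : 0 ≤ δ')
    (hf : ∀ j ∈ J, f j ≤ (if j + 1 < k then δ else 0) + δ') : ∑ j ∈ J, f j ≤ k * δ + r * δ' := by
  calc ∑ j ∈ J, f j ≤ ∑ j ∈ J, ((if j + 1 < k then δ else 0) + δ') := Finset.sum_le_sum hf
    _ = ∑ j ∈ J, (if j + 1 < k then δ else 0) + J.card * δ' := by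
        rw [Finset.sum_add_distrib, Finset.sum_const, nsmul_eq_mul]
    _ ≤ k * δ + r * δ' := by
        apply add_le_add
        · rw [← Finset.sum_filter, Finset.sum_const, nsmul_eq_mul]
          apply mul_le_mul_of_nonneg_right _ hδ
          have : (J.filter (fun j => j + 1 < k)) ⊆ Finset.range k := by
            intro j hj; rw [Finset.mem_filter] at hj; rw [Finset.mem_range]; omega
          have := Finset.card_le_card this
          rw [Finset.card_range] at this
          exact_mod_cast this
        · apply mul_le_mul_of_nonneg_right _ hδ'
          have := Finset.card_le_card hJ
          rw [Finset.card_range] at this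
          exact_mod_cast this

theorem pb_bad (k : ℕ) (X : ℕ → Finset ℕ) (S : ℕ → ℕ → ℝ) (δ E : ℝ) (hE : 0 ≤ E)
    (hX : ∀ i < k, (0:ℝ) < (X i).card)
    (h : ∀ i, 1 ≤ i → i < k → ∑ x ∈ X 0, |S i x| ≤ (X 0).card * (X i).card * E) :
    (((X 0).filter (fun x => ∃ i, 1 ≤ i ∧ i < k ∧ δ * (X i).card < |S i x|)).card : ℝ) * δ ≤
      k * (X 0).card * E := by
  calc (((X 0).filter (fun x => ∃ i, 1 ≤ i ∧ i < k ∧ δ * (X i).card < |S i x|)).card : ℝ) * δ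
      = ∑ x ∈ (X 0).filter (fun x => ∃ i, 1 ≤ i ∧ i < k ∧ δ * (X i).card < |S i x|), δ := by
        rw [Finset.sum_const, nsmul_eq_mul]
    _ ≤ ∑ x ∈ (X 0).filter (fun x => ∃ i, 1 ≤ i ∧ i < k ∧ δ * (X i).card < |S i x|),
          ∑ i ∈ Finset.Ico 1 k, |S i x| / (X i).card := by
        apply Finset.sum_le_sum
        intro x hx
        obtain ⟨i, hi1, hik, hi⟩ := (Finset.mem_filter.1 hx).2
        have : δ ≤ |S i x| / (X i).card := by rw [le_div_iff₀ (hX i hik)]; exact hi.le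
        refine this.trans ?_
        exact Finset.single_le_sum (f := fun i => |S i x| / (X i).card) (fun i _ => by positivity)
          (Finset.mem_Ico.2 ⟨hi1, hik⟩)
    _ ≤ ∑ x ∈ X 0, ∑ i ∈ Finset.Ico 1 k, |S i x| / (X i).card := by
        apply Finset.sum_le_sum_of_subset_of_nonneg (Finset.filter_subset _ _)
        intro x _ _
        exact Finset.sum_nonneg (fun i _ => by positivity)
    _ = ∑ i ∈ Finset.Ico 1 k, ∑ x ∈ X 0, |S i x| / (X i).card := Finset.sum_comm
    _ ≤ ∑ i ∈ Finset.Ico 1 k, (X 0).card * E := by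
        apply Finset.sum_le_sum
        intro i hi
        rw [Finset.mem_Ico] at hi
        rw [← Finset.sum_div, div_le_iff₀ (hX i hi.2)]
        have := h i hi.1 hi.2
        linarith
    _ ≤ k * (X 0).card * E := by
        rw [Finset.sum_const, nsmul_eq_mul, Nat.card_Ico, mul_assoc]
        apply mul_le_mul_of_nonneg_right _ (by positivity)
        exact_mod_cast Nat.sub_le k 1

theorem pb_step (c₁ c₂ c₃ c₄ c₅ c₇ cL A κ ε : ℝ) (hc₁ : 0 < c₁) (hc₂ : 0 < c₂) (hc₃ : 0 < c₃) (hc₅ : 3 < c₅)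
    (hc₇ : 0 < c₇) (hκ : 0 ≤ κ) (hκ1 : 1 / c₁ ≤ κ)
    (hm : c₇ * Real.log 2 - 1/4 + c₂ * c₄ / 2 + 2 * ε + κ ≤ -κ - ε)
    (hA3 : 3 ≤ A) (hA : ∀ T > A, (Real.log T) ^ c₅ < T ^ c₂ ∧ 16 * (c₇ * Real.log T + 1) + 4 ≤ T ^ ε ∧
      T ^ (-κ) ≤ 1 - 2 * (2:ℝ) ^ (-c₃))
    {r k : ℕ} {X : ℕ → Finset ℕ} {P : Finset ℕ} {s tt : ℕ → ℝ} {t : ℝ} (hr : 1 ≤ r)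
    (h : PbHyp c₁ c₂ c₃ c₄ c₅ c₇ cL A (r + 1) k X P s tt t)
    (hnear : ∀ i, 1 ≤ i → i < k → ∑ x ∈ X 0, |((∑ y ∈ X i, jacobiSym x y : ℤ) : ℝ)| ≤
        (X 0).card * (X i).card * tt 0 ^ (-(1/4) + c₂ * c₄ / 2 + ε))
    (hfar : ∀ i, k ≤ i → i < r + 1 → ∀ x ∈ X 0,
      |((∑ y ∈ X i, jacobiSym x y : ℤ) : ℝ)| ≤ (X i).card * tt 0 ^ (-(κ + 1 / c₁ + ε)))
    (ih : ∀ (k : ℕ) (X : ℕ → Finset ℕ) (P : Finset ℕ) (s tt : ℕ → ℝ) (t : ℝ),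
      PbHyp c₁ c₂ c₃ c₄ c₅ c₇ cL A r k X P s tt t → ∀ (M : ℕ → ℕ → Prop) (a : ℕ → ℕ → ℤ),
      (∀ i j, a i j = 1 ∨ a i j = -1) →
      |(pbcnt r X (fun i j x y => M i j → jacobiSym x y = a i j) : ℝ) -
        (∏ i ∈ Finset.range r, ((X i).card : ℝ)) / 2 ^ pbm r M| ≤
        r / tt 0 ^ κ * ((∏ i ∈ Finset.range r, ((X i).card : ℝ)) / 2 ^ pbm r M))
    (M : ℕ → ℕ → Prop) (a : ℕ → ℕ → ℤ) (ha : ∀ i j, a i j = 1 ∨ a i j = -1) :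
    |(pbcnt (r+1) X (fun i j x y => M i j → jacobiSym x y = a i j) : ℝ) -
        (∏ i ∈ Finset.range (r+1), ((X i).card : ℝ)) / 2 ^ pbm (r+1) M| ≤
        ((r+1:ℕ):ℝ) / tt 0 ^ κ * ((∏ i ∈ Finset.range (r+1), ((X i).card : ℝ)) / 2 ^ pbm (r+1) M) := by
  have h0r : 0 < r + 1 := by omega
  have hT := h.A_lt 0 h0r
  have hT0 : 0 < tt 0 := by linarith
  have hT1 : 1 ≤ tt 0 := by linarith
  have hl : 0 ≤ Real.log (tt 0) := Real.log_nonneg hT1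
  obtain ⟨-, hA2, hA4⟩ := hA _ hT
  have hk : (k:ℝ) ≤ c₇ * Real.log (tt 0) + 1 := h.h5.trans (Int.ceil_lt_add_one _).le
  have hrT : (r:ℝ) ≤ tt 0 ^ (1 / c₁) := by
    have a1 : ((r:ℝ)) ^ c₁ ≤ tt 0 := by
      have := h.h2
      have h' : (r:ℝ) ^ c₁ ≤ ((r+1:ℕ):ℝ) ^ c₁ :=
        Real.rpow_le_rpow (Nat.cast_nonneg _) (by push_cast; linarith) hc₁.le
      linarith
    have a2 := Real.rpow_le_rpow (Real.rpow_nonneg (Nat.cast_nonneg _) _) a1 (show 0 ≤ 1 / c₁ by positivity)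
    rwa [← Real.rpow_mul (Nat.cast_nonneg _), mul_one_div_cancel hc₁.ne', Real.rpow_one] at a2
  have hreal := pb_real c₁ c₂ c₄ c₇ κ ε (tt 0) k r (by linarith) hc₇ hk hrT hA2 hm
  have hη : (r:ℝ) / tt 0 ^ κ ≤ 1 := by
    rw [div_le_one (Real.rpow_pos_of_pos hT0 _)]
    exact hrT.trans (Real.rpow_le_rpow_of_exponent_le hT1 hκ1)
  have hη0 : 0 ≤ (r:ℝ) / tt 0 ^ κ := div_nonneg (Nat.cast_nonneg _) (Real.rpow_nonneg hT0.le _)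
  have hTκ : tt 0 ^ (-κ) ≤ 1 := Real.rpow_le_one_of_one_le_of_nonpos hT1 (by linarith)
  have hE0 : 0 < tt 0 ^ (-(1/4) + c₂ * c₄ / 2 + ε) := Real.rpow_pos_of_pos hT0 _
  have hδ0 : 0 < tt 0 ^ (-κ - ε) := Real.rpow_pos_of_pos hT0 _
  have hδi : tt 0 ^ (-κ - ε) * tt 0 ^ (κ + ε) = 1 := by
    rw [← Real.rpow_add hT0, ← Real.rpow_zero (tt 0)]; congr 1; ring
  have hδi0 : 0 < tt 0 ^ (κ + ε) := Real.rpow_pos_of_pos hT0 _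
  have hδ'0 : 0 < tt 0 ^ (-(κ + 1 / c₁ + ε)) := Real.rpow_pos_of_pos hT0 _
  have hκi : (1:ℝ) / tt 0 ^ κ = tt 0 ^ (-κ) := by rw [Real.rpow_neg hT0.le, one_div]
  set E := tt 0 ^ (-(1/4) + c₂ * c₄ / 2 + ε) with hEdef
  set δ := tt 0 ^ (-κ - ε) with hδdef
  set δi := tt 0 ^ (κ + ε) with hδidef
  set δ' := tt 0 ^ (-(κ + 1 / c₁ + ε)) with hδ'def
  set σ := (k:ℝ) * δ + r * δ' with hσ
  have hσ0 : 0 ≤ σ := add_nonneg (mul_nonneg (Nat.cast_nonneg _) hδ0.le) (mul_nonneg (Nat.cast_nonneg _) hδ'0.le)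
  have hnn : 0 ≤ 6 * (2:ℝ) ^ k * (k * E * δi) := by
    apply mul_nonneg (by positivity)
    exact mul_nonneg (mul_nonneg (Nat.cast_nonneg _) hE0.le) hδi0.le
  have hσ4 : 4 * σ ≤ tt 0 ^ (-κ) := by linarith
  have hpos : ∀ j < r + 1, (0:ℝ) < (X j).card := fun j hj => (h.card_low hA3 hc₃ j hj).2.2
  -- the bad set
  set Bd := (X 0).filter (fun x : ℕ => ∃ i, 1 ≤ i ∧ i < k ∧
      δ * (X i).card < |((∑ y ∈ X i, jacobiSym x y : ℤ) : ℝ)|) with hBd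
  have hbad : (Bd.card : ℝ) ≤ k * (X 0).card * E * δi := by
    have := pb_bad k X (fun i x => ((∑ y ∈ X i, jacobiSym x y : ℤ) : ℝ)) δ E hE0.le
      (fun i hi => hpos i (by have := h.hkr; omega)) hnear
    calc (Bd.card : ℝ) = Bd.card * δ * δi := by rw [mul_assoc, hδi, mul_one]
      _ ≤ _ := mul_le_mul_of_nonneg_right this hδi0.le
  set J := (Finset.range r).filter (fun j => M 0 (j + 1)) with hJ
  have hJr : J ⊆ Finset.range r := Finset.filter_subset _ _
  set m := pbm r (fun i j => M (i + 1) (j + 1)) with hmdef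
  set V : ℝ := (∏ i ∈ Finset.range r, ((X (i+1)).card : ℝ)) / 2 ^ (J.card + m) with hV
  have hprod0 : 0 ≤ ∏ i ∈ Finset.range r, ((X (i+1)).card : ℝ) := Finset.prod_nonneg (fun i _ => Nat.cast_nonneg _)
  have hV0 : 0 ≤ V := div_nonneg hprod0 (by positivity)
  set cx : ℕ → ℝ := fun x => (pbcnt r (fun j => (X (j+1)).filter (fun y => M 0 (j+1) → jacobiSym x y = a 0 (j+1)))
        (fun i j x y => M (i+1) (j+1) → jacobiSym x y = a (i+1) (j+1)) : ℝ) with hcx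
  have hdivle : ∀ j < r, ∀ x ∈ X 0, k ≤ j + 1 →
      |((∑ y ∈ X (j+1), jacobiSym x y : ℤ) : ℝ)| / (X (j+1)).card ≤ δ' := by
    intro j hj x hx hkj
    rw [div_le_iff₀ (hpos (j+1) (by omega)), mul_comm]
    exact hfar (j+1) hkj (by omega) x hx
  have hgood : ∀ x ∈ X 0, x ∉ Bd → |cx x - V| ≤ ((r:ℝ) / tt 0 ^ κ + 4 * σ) * V := by
    intro x hx hxB
    have := pb_one c₁ c₂ c₃ c₄ c₅ c₇ cL A κ σ hc₁ hc₂ hc₃ hc₅ hc₇ hA3 (fun T hT => (hA T hT).1) (by linarith)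
      (by linarith) hκ hr h hη ih (fun i j => M (i+1) (j+1)) (fun i j => a (i+1) (j+1)) (fun i j => ha _ _)
      x hx J hJr (fun j => a 0 (j+1)) (fun j => ha _ _) (by
        apply pb_sumD r k J hJr _ δ δ' hδ0.le hδ'0.le
        intro j hj
        have hjr : j < r := Finset.mem_range.1 (hJr hj)
        by_cases hjk : j + 1 < k
        · rw [if_pos hjk]
          have : |((∑ y ∈ X (j+1), jacobiSym x y : ℤ) : ℝ)| / (X (j+1)).card ≤ δ := by
            rw [div_le_iff₀ (hpos (j+1) (by omega))]
            by_contra hcon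
            push Not at hcon
            exact hxB (Finset.mem_filter.2 ⟨hx, j+1, by omega, hjk, hcon⟩)
          linarith
        · rw [if_neg hjk, zero_add]
          exact hdivle j hjr x hx (by omega))
    have hcc : cx x = (pbcnt r (fun j => (X (j+1)).filter (fun y => j ∈ J → jacobiSym x y = a 0 (j+1)))
        (fun i j x y => M (i+1) (j+1) → jacobiSym x y = a (i+1) (j+1)) : ℝ) := by
      simp only [hcx]
      congr 1
      apply pbcnt_congr
      intro j hj
      apply Finset.filter_congr
      intro y _
      simp [hJ, hj]
    rw [hcc]
    exact this
  have hbd : ∀ x ∈ X 0, |cx x - V| ≤ 6 * 2 ^ k * V := by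
    intro x hx
    set J' := J.filter (fun j => k ≤ j + 1) with hJ'
    have hJ'J : J' ⊆ J := Finset.filter_subset _ _
    have := pb_one c₁ c₂ c₃ c₄ c₅ c₇ cL A κ σ hc₁ hc₂ hc₃ hc₅ hc₇ hA3 (fun T hT => (hA T hT).1) (by linarith)
      (by linarith) hκ hr h hη ih (fun i j => M (i+1) (j+1)) (fun i j => a (i+1) (j+1)) (fun i j => ha _ _)
      x hx J' (hJ'J.trans hJr) (fun j => a 0 (j+1)) (fun j => ha _ _) (by
        apply pb_sumD r k J' (hJ'J.trans hJr) _ δ δ' hδ0.le hδ'0.le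
        intro j hj
        have hjr : j < r := Finset.mem_range.1 (hJr (hJ'J hj))
        have hjk := (Finset.mem_filter.1 hj).2
        rw [if_neg (by omega), zero_add]
        exact hdivle j hjr x hx hjk)
    have hcc : cx x ≤ (pbcnt r (fun j => (X (j+1)).filter (fun y => j ∈ J' → jacobiSym x y = a 0 (j+1)))
        (fun i j x y => M (i+1) (j+1) → jacobiSym x y = a (i+1) (j+1)) : ℝ) := by
      simp only [hcx]
      rw [Nat.cast_le]
      apply pbcnt_mono
      intro j hj y hy
      rw [Finset.mem_filter] at hy ⊢
      refine ⟨hy.1, fun hjJ => hy.2 ?_⟩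
      exact (Finset.mem_filter.1 (hJ'J hjJ)).2
    set V' : ℝ := (∏ i ∈ Finset.range r, ((X (i+1)).card : ℝ)) / 2 ^ (J'.card + m) with hV'
    have hV'0 : 0 ≤ V' := div_nonneg hprod0 (by positivity)
    have hcardJ : J.card ≤ J'.card + k := by
      have h1 : J ⊆ J' ∪ Finset.range k := by
        intro j hj
        rw [Finset.mem_union, hJ', Finset.mem_filter, Finset.mem_range]
        by_cases hjk : j < k
        · right; exact hjk
        · left; exact ⟨hj, by omega⟩
      calc J.card ≤ (J' ∪ Finset.range k).card := Finset.card_le_card h1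
        _ ≤ J'.card + (Finset.range k).card := Finset.card_union_le _ _
        _ = _ := by rw [Finset.card_range]
    have hV'V : V' ≤ 2 ^ k * V := by
      rw [hV', hV, ← mul_div_assoc, div_le_div_iff₀ (by positivity) (by positivity)]
      have h2 : (2:ℝ) ^ (J.card + m) ≤ 2 ^ k * 2 ^ (J'.card + m) := by
        rw [← pow_add]
        exact pow_le_pow_right₀ (by norm_num) (by omega)
      calc _ ≤ (∏ i ∈ Finset.range r, ((X (i+1)).card : ℝ)) * (2 ^ k * 2 ^ (J'.card + m)) :=
            mul_le_mul_of_nonneg_left h2 hprod0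
        _ = _ := by ring
    have h3 := (abs_le.1 this).2
    have h4 : ((r:ℝ) / tt 0 ^ κ + 4 * σ) * V' ≤ 2 * V' := mul_le_mul_of_nonneg_right (by linarith) hV'0
    have hcx0 : 0 ≤ cx x := Nat.cast_nonneg _
    have h6 : V ≤ 2 ^ k * V := le_mul_of_one_le_left hV0 (one_le_pow₀ (by norm_num))
    rw [abs_le]
    constructor <;> linarith
  have hall : ∀ x ∈ X 0, |cx x - V| ≤ ((r:ℝ) / tt 0 ^ κ + 4 * σ) * V + (if x ∈ Bd then 6 * 2 ^ k * V else 0) := by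
    intro x hx
    by_cases hxB : x ∈ Bd
    · rw [if_pos hxB]
      have := hbd x hx
      have : 0 ≤ ((r:ℝ) / tt 0 ^ κ + 4 * σ) * V := mul_nonneg (by linarith) hV0
      linarith
    · rw [if_neg hxB, add_zero]; exact hgood x hx hxB
  have hlhs : (pbcnt (r+1) X (fun i j x y => M i j → jacobiSym x y = a i j) : ℝ) = ∑ x ∈ X 0, cx x := by
    simp only [pbcnt, hcx]; push_cast; rfl
  have hrhs : (∏ i ∈ Finset.range (r+1), ((X i).card : ℝ)) / 2 ^ pbm (r+1) M = ∑ x ∈ X 0, V := by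
    rw [Finset.sum_const, nsmul_eq_mul, Finset.prod_range_succ', hV, mul_comm, mul_div_assoc]; rfl
  rw [hlhs, hrhs, ← Finset.sum_sub_distrib]
  refine (Finset.abs_sum_le_sum_abs _ _).trans ((Finset.sum_le_sum hall).trans ?_)
  have hBsub : (X 0).filter (fun x => x ∈ Bd) = Bd := by
    ext x; rw [Finset.mem_filter]
    exact ⟨fun h => h.2, fun h => ⟨(Finset.mem_filter.1 h).1, h⟩⟩
  rw [Finset.sum_add_distrib, ← Finset.sum_filter, hBsub, Finset.sum_const, Finset.sum_const, Finset.sum_const]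
  simp only [nsmul_eq_mul]
  have hN : (0:ℝ) ≤ (X 0).card := Nat.cast_nonneg _
  have e5 : ((r+1:ℕ):ℝ) / tt 0 ^ κ = (r:ℝ) / tt 0 ^ κ + tt 0 ^ (-κ) := by
    rw [← hκi]; push_cast; rw [add_div]
  rw [e5]
  have hV6 : 0 ≤ 6 * 2 ^ k * V := mul_nonneg (by positivity) hV0
  have e6 := mul_le_mul_of_nonneg_right hbad hV6
  have e7 := mul_le_mul_of_nonneg_right hreal (mul_nonneg hN hV0)
  linarith

theorem pb_main (c₁ c₂ c₃ c₄ c₅ c₇ c₈ cL : ℝ) (hc₁ : 0 < c₁) (hc₂ : 0 < c₂) (hc₃ : 1 < c₃) (hc₄ : 0 < c₄) (hc₅ : 3 < c₅)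
    (hc₇ : 0 < c₇) (hc₈ : 0 < c₈)
    (hmain : c₈ + c₇ * Real.log 2 / 2 + 1 / c₁ + c₂ * c₄ / 2 < 1 / 8)
    (hcL0 : 0 < cL) (hcL : cL < 1 / 2) :
    ∃ A : ℝ, 3 ≤ A ∧ ∀ (r k : ℕ) (X : ℕ → Finset ℕ) (P : Finset ℕ) (s tt : ℕ → ℝ) (t : ℝ),
      PbHyp c₁ c₂ c₃ c₄ c₅ c₇ cL A r k X P s tt t → ∀ (M : ℕ → ℕ → Prop) (a : ℕ → ℕ → ℤ),
      (∀ i j, a i j = 1 ∨ a i j = -1) →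
      |(pbcnt r X (fun i j x y => M i j → jacobiSym x y = a i j) : ℝ) -
        (∏ i ∈ Finset.range r, ((X i).card : ℝ)) / 2 ^ pbm r M| ≤
        r / tt 0 ^ (c₈ + 1 / c₁) * ((∏ i ∈ Finset.range r, ((X i).card : ℝ)) / 2 ^ pbm r M) := by
  have h24 : 0 < c₂ * c₄ := mul_pos hc₂ hc₄
  have h1c : 0 < 1 / c₁ := by positivity
  set κ := c₈ + 1 / c₁ with hκ
  have hκ0 : 0 < κ := by linarith
  obtain ⟨ε, hε⟩ : ∃ ε, ε = (1/4 - c₂ * c₄ / 2 - c₇ * Real.log 2 - 2 * κ) / 3 := ⟨_, rfl⟩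
  have hε0 : 0 < ε := by rw [hε]; linarith
  obtain ⟨A₁, hA₁3, hA₁⟩ := pb_asym_main c₂ c₃ c₅ c₇ κ ε hc₂ hc₃ hκ0 hε0
  obtain ⟨A₂, hA₂3, hA₂⟩ := pb_near c₁ c₂ c₃ c₄ c₅ c₇ cL ε (by linarith) hc₄ hε0
  obtain ⟨A₃, hA₃3, hA₃⟩ := pb_far c₁ c₂ c₃ c₄ c₅ c₇ cL (κ + 1 / c₁ + ε) (by linarith) hc₅ hcL0 hcL (by linarith)
  set A := max A₁ (max A₂ A₃) with hA
  have g1 : A₁ ≤ A := le_max_left _ _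
  have g2 : A₂ ≤ A := (le_max_left _ _).trans (le_max_right _ _)
  have g3 : A₃ ≤ A := (le_max_right _ _).trans (le_max_right _ _)
  refine ⟨A, by linarith, ?_⟩
  intro r
  induction r with
  | zero => intro k X P s tt t h; exact absurd h.hr (by norm_num)
  | succ r ih =>
    intro k X P s tt t h M a ha
    rcases Nat.eq_zero_or_pos r with hr0 | hr
    · subst hr0
      have hT := h.A_lt 0 (by norm_num)
      have : 0 < tt 0 := by linarith
      have hp := Real.rpow_pos_of_pos this κ
      simp [pbcnt, pbm]
      positivity
    · exact pb_step c₁ c₂ c₃ c₄ c₅ c₇ cL A κ ε hc₁ hc₂ (by linarith) hc₅ hc₇ hκ0.le (by linarith)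
        (by rw [hε]; linarith) (by linarith) (fun T hT => hA₁ T (by linarith)) hr h
        (hA₂ A _ k X P s tt t g2 h) (hA₃ A _ k X P s tt t g3 h) ih M a ha

end

section

/-- The set of points counted by `pbcnt`. -/
def pbset (r : ℕ) (X : ℕ → Finset ℕ) (R : ℕ → ℕ → ℕ → ℕ → Prop) : Set (Fin r → ℕ) :=
  {x | (∀ i : Fin r, x i ∈ X i) ∧ ∀ i j : Fin r, i < j → R i j (x i) (x j)}

theorem pbset_finite (r : ℕ) (X : ℕ → Finset ℕ) (R : ℕ → ℕ → ℕ → ℕ → Prop) : (pbset r X R).Finite := by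
  apply Set.Finite.subset (Set.Finite.pi (fun i : Fin r => (X i).finite_toSet))
  intro x hx i _
  exact hx.1 i

theorem pb_ncard (r : ℕ) : ∀ (X : ℕ → Finset ℕ) (R : ℕ → ℕ → ℕ → ℕ → Prop),
    (pbset r X R).ncard = pbcnt r X R := by
  induction r with
  | zero =>
    intro X R
    have : pbset 0 X R = {fun i => i.elim0} := by
      ext x
      simp only [pbset, Set.mem_ofPred_eq, Set.mem_singleton_iff]
      constructor
      · intro _; funext i; exact i.elim0
      · intro _; exact ⟨fun i => i.elim0, fun i => i.elim0⟩
    rw [this, Set.ncard_singleton]; rfl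
  | succ r ih =>
    intro X R
    have hfin : ∀ x, Finite (pbset r (fun j => (X (j + 1)).filter (fun y => R 0 (j + 1) x y))
      (fun i j => R (i + 1) (j + 1))) := fun x => (pbset_finite _ _ _).to_subtype
    let e : pbset (r+1) X R ≃ (Σ x : {x // x ∈ X 0}, pbset r (fun j => (X (j + 1)).filter (fun y => R 0 (j + 1) x.1 y))
      (fun i j => R (i + 1) (j + 1))) :=
      { toFun := fun x => ⟨⟨x.1 0, x.2.1 0⟩, ⟨fun i => x.1 i.succ, by
          refine ⟨fun i => ?_, fun i j hij => ?_⟩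
          · rw [Finset.mem_filter]
            refine ⟨by simpa using x.2.1 i.succ, ?_⟩
            simpa using x.2.2 0 i.succ (Fin.succ_pos i)
          · simpa using x.2.2 i.succ j.succ (Fin.succ_lt_succ_iff.2 hij)⟩⟩
        invFun := fun z => ⟨Fin.cons z.1.1 z.2.1, by
          refine ⟨fun i => ?_, fun i j hij => ?_⟩
          · refine Fin.cases ?_ (fun i => ?_) i
            · simpa using z.1.2
            · simpa using (Finset.mem_filter.1 (z.2.2.1 i)).1
          · revert hij
            refine Fin.cases ?_ (fun i => ?_) i
            · refine Fin.cases ?_ (fun j => ?_) j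
              · intro h; exact absurd h (lt_irrefl _)
              · intro _
                simpa using (Finset.mem_filter.1 (z.2.2.1 j)).2
            · refine Fin.cases ?_ (fun j => ?_) j
              · intro h; exact absurd h (Fin.not_lt_zero _)
              · intro h
                simpa using z.2.2.2 i j (Fin.succ_lt_succ_iff.1 h)⟩
        left_inv := by
          rintro ⟨x, hx⟩
          apply Subtype.ext
          exact Fin.cons_self_tail x
        right_inv := by
          rintro ⟨⟨x, hx⟩, ⟨y, hy⟩⟩
          rfl }
    rw [← Nat.card_coe_set_eq, Nat.card_congr e, Nat.card_sigma]
    simp only [pbcnt]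
    rw [← Finset.sum_coe_sort (X 0)]
    apply Finset.sum_congr rfl
    intro x _
    rw [← ih, Nat.card_coe_set_eq]

theorem pbm_eq_sum (r : ℕ) : ∀ (M : ℕ → ℕ → Prop),
    pbm r M = ∑ i ∈ Finset.range r, ∑ j ∈ Finset.range r, if i < j ∧ M i j then 1 else 0 := by
  induction r with
  | zero => intro M; simp [pbm]
  | succ r ih =>
    intro M
    rw [pbm, ih, Finset.sum_range_succ', Finset.card_filter]
    simp only [Finset.sum_range_succ' _ r]
    simp [add_comm]

/-- The pair relation on naturals induced by a subset of the index set. -/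
def pbM {r : ℕ} (S : Set (MrIdx r)) (i j : ℕ) : Prop :=
  ∃ (hi : i < r) (hj : j < r) (hij : i < j), (⟨(⟨i, hi⟩, ⟨j, hj⟩), hij⟩ : MrIdx r) ∈ S

theorem pbm_ncard {r : ℕ} (S : Set (MrIdx r)) : S.ncard = pbm r (pbM S) := by
  rw [pbm_eq_sum, ← Finset.sum_product', ← Finset.card_filter, ← Set.ncard_coe_finset]
  have hinj : Function.Injective (fun q : MrIdx r => ((q.1.1 : ℕ), (q.1.2 : ℕ))) := by
    rintro ⟨⟨⟨i, hi⟩, ⟨j, hj⟩⟩, h⟩ ⟨⟨⟨i', hi'⟩, ⟨j', hj'⟩⟩, h'⟩ heq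
    simp only [Prod.mk.injEq] at heq
    obtain ⟨rfl, rfl⟩ := heq
    rfl
  rw [← Set.ncard_image_of_injective S hinj]
  congr 1
  ext ⟨i, j⟩
  simp only [Set.mem_image, Finset.coe_filter, Finset.mem_product, Finset.mem_range, Set.mem_ofPred_eq]
  constructor
  · rintro ⟨⟨⟨⟨i', hi⟩, ⟨j', hj⟩⟩, hij⟩, hS, heq⟩
    simp only [Prod.mk.injEq] at heq
    obtain ⟨rfl, rfl⟩ := heq
    exact ⟨⟨hi, hj⟩, hij, hi, hj, hij, hS⟩
  · rintro ⟨⟨hi, hj⟩, hij, _, _, _, hS⟩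
    exact ⟨_, hS, rfl⟩

theorem pb_iota (e : ZMod 2) : iotaSign e = 1 ∨ iotaSign e = -1 := by
  unfold iotaSign; split_ifs <;> simp

end

/-- Proposition 7.3 (equidistribution of Legendre conditions over a prebox). -/
theorem prebox_equidistribution
    (c₁ c₂ c₃ c₄ c₅ c₆ c₇ c₈ : ℝ)
    (hc₁ : 0 < c₁) (hc₂ : 0 < c₂) (hc₃ : 0 < c₃) (hc₄ : 0 < c₄) (hc₅ : 0 < c₅)
    (hc₆ : 0 < c₆) (hc₇ : 0 < c₇) (hc₈ : 0 < c₈)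
    (hc₃' : 1 < c₃) (hc₅' : 3 < c₅) (hc₆' : 1 < c₆)
    (hmain : c₈ + c₇ * Real.log 2 / 2 + 1 / c₁ + c₂ * c₄ / 2 < 1 / 8)
    (cL : ℝ) (hcL0 : 0 < cL) (hcL : cL < 1 / 2) :
    ∃ A : ℝ, 0 < A ∧
      ∀ (r : ℕ) (B : Prebox r) (t : ℝ),
        (1 ≤ r → A < B.s 1) → A < t → (1 ≤ r → t < B.s 1) →
        SiegelFree B cL t →
        ∀ (𝓜r : Set (MrIdx r)) (𝓜rP : Set (MrPIdx r B.P))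
          (a : MrIdx r ⊕ MrPIdx r B.P → ZMod 2) (k : ℕ),
        1 ≤ k → k ≤ r →
        -- every `(i,p) ∈ 𝓜_{r,P}` has (paper index) `i > k`
        (∀ q ∈ 𝓜rP, k < (q.1 : ℕ) + 1) →
        -- for `i > k`, `Xᵢ` is exactly the primes `≡ 1 (mod 4)` in `(sᵢ, tᵢ]` fulfilling
        -- the Legendre conditions prescribed by `a` on `𝓜_{r,P}`
        (∀ i : Fin r, k < (i : ℕ) + 1 → ∀ p : ℕ,
          (p ∈ B.X ((i : ℕ) + 1) ↔ p.Prime ∧ p % 4 = 1 ∧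
            B.s ((i : ℕ) + 1) < (p : ℝ) ∧ (p : ℝ) ≤ B.t ((i : ℕ) + 1) ∧
            ∀ q ∈ 𝓜rP, q.1 = i →
              jacobiSym (p : ℤ) (q.2 : ℕ) = iotaSign (a (Sum.inr q)))) →
        -- (i)
        (∀ i ∈ Finset.Icc 1 r, (B.P.card : ℝ) ≤ Real.log (B.t i) - (i : ℝ)) →
        -- (ii)
        (1 ≤ r → (r : ℝ) ^ c₁ < B.t 1) → (1 ≤ r → B.t k < Real.exp (B.t 1 ^ c₂)) →
        -- (iii)
        (∀ i ∈ Finset.Icc 1 r,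
          (2 : ℝ) ^ (c₃ * (i : ℝ)) * B.t i / (Real.log (B.t i)) ^ c₄ ≤ ((B.X i).card : ℝ)) →
        -- (iv)
        (k ≠ r →
          max (Real.exp ((Real.log (B.t 1)) ^ c₅)) (Real.exp (t ^ c₆)) < B.t (k + 1)) →
        -- (v)
        ((k : ℝ) ≤ (⌈c₇ * Real.log (B.t 1)⌉ : ℤ)) →
        (∀ i ∈ Finset.Icc 1 r, ∀ j ∈ Finset.Icc 1 r,
          (i : ℝ) + c₇ * Real.log (B.t i) ≤ (j : ℝ) →
          Real.exp ((Real.log (B.t i)) ^ c₅) < B.t j) →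
        -- conclusion
        |((preboxPoints B 𝓜r 𝓜rP a).ncard : ℝ) -
            (∏ i ∈ Finset.Icc 1 r, ((B.X i).card : ℝ)) / 2 ^ 𝓜r.ncard| ≤
          (r : ℝ) * (∏ i ∈ Finset.Icc 1 r, ((B.X i).card : ℝ)) /
            (B.t 1 ^ (c₈ + 1 / c₁) * 2 ^ 𝓜r.ncard) ∧
        (r : ℝ) * (∏ i ∈ Finset.Icc 1 r, ((B.X i).card : ℝ)) /
            (B.t 1 ^ (c₈ + 1 / c₁) * 2 ^ 𝓜r.ncard) ≤
          (∏ i ∈ Finset.Icc 1 r, ((B.X i).card : ℝ)) / (B.t 1 ^ c₈ * 2 ^ 𝓜r.ncard) := by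
  obtain ⟨A, hA3, hA⟩ := pb_main c₁ c₂ c₃ c₄ c₅ c₇ c₈ cL hc₁ hc₂ hc₃' hc₄ hc₅' hc₇ hc₈ hmain hcL0 hcL
  refine ⟨A, by linarith, ?_⟩
  intro r B t hAs hAt hts hS 𝓜r 𝓜rP a k hk1 hkr hqk hX hi hii hii' hiii hiv hv hv'
  have hr : 1 ≤ r := hk1.trans hkr
  have hIcc : ∀ i < r, i + 1 ∈ Finset.Icc 1 r := fun i hi => Finset.mem_Icc.2 ⟨by omega, by omega⟩
  have hAs := hAs hr
  have hts := hts hr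
  have hii := hii hr
  have hii' := hii' hr
  have hs1 : ∀ i < r, B.s 1 ≤ B.s (i + 1) := by
    intro i hi
    rcases Nat.eq_zero_or_pos i with h0 | h0
    · subst h0; exact le_rfl
    · have h1 := B.s_lt_t 1 (hIcc 0 (by omega))
      have h2 := B.t_lt_s 1 (hIcc 0 (by omega)) (i + 1) (hIcc i hi) (by omega)
      linarith
  have hpX : ∀ i < r, ∀ p ∈ B.X (i + 1), p.Prime ∧ p % 4 = 1 ∧ B.s (i+1) < (p : ℝ) ∧ (p : ℝ) ≤ B.t (i+1) := by
    intro i hi p hp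
    obtain ⟨h1, h2⟩ := B.prime_X (i+1) (hIcc i hi) p hp
    obtain ⟨h3, h4⟩ := B.X_sub (i+1) (hIcc i hi) p hp
    refine ⟨h1, ?_, h3, h4⟩
    rcases h2 with h2 | h2
    · exact h2
    · exfalso
      have : p = 2 := ((Nat.prime_dvd_prime_iff_eq Nat.prime_two h1).1 (by omega)).symm
      subst this
      have := hs1 i hi
      push_cast at h3
      linarith
  have htpos : ∀ i < r, A < B.t (i+1) := by
    intro i hi
    have := hs1 i hi
    have := B.s_lt_t (i+1) (hIcc i hi)
    linarith
  have hne : ∀ i < r, ∃ y, y ∈ B.X (i+1) := by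
    intro i hi
    have h1 := hiii (i+1) (hIcc i hi)
    have h2 := htpos i hi
    have h3 : 0 < Real.log (B.t (i+1)) := Real.log_pos (by linarith)
    have h4 : 0 < B.t (i+1) := by linarith
    have h5 : (0:ℝ) < (2 : ℝ) ^ (c₃ * ((i+1 : ℕ) : ℝ)) * B.t (i+1) / (Real.log (B.t (i+1))) ^ c₄ := by positivity
    have h6 : (0:ℝ) < ((B.X (i+1)).card : ℝ) := by linarith
    exact Finset.card_pos.1 (by exact_mod_cast h6)
  have hyp : PbHyp c₁ c₂ c₃ c₄ c₅ c₇ cL A r k (fun i => B.X (i+1)) B.P (fun i => B.s (i+1)) (fun i => B.t (i+1)) t := by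
    refine ⟨hr, hk1, hkr, hpX, ?_, fun i hi => B.s_lt_t (i+1) (hIcc i hi), ?_, hAs, hts, ?_, ?_, ?_, hii, ?_, ?_, ?_, hv, ?_⟩
    · intro p hp
      obtain ⟨h1, h2⟩ := B.prime_P p hp
      refine ⟨h1, ?_, (B.P_sub p hp).2 hr⟩
      rcases h2 with h2 | h2
      · exact Or.inl h2
      · exact Or.inr ((Nat.prime_dvd_prime_iff_eq Nat.prime_two h1).1 (by omega)).symm
    · intro i j hij hj
      exact B.t_lt_s (i+1) (hIcc i (by omega)) (j+1) (hIcc j hj) (by omega)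
    · intro x hx d hd hdv hdS
      refine hS ⟨d, hdS, hd, fun i => x i, fun i => hx i i.2, ?_⟩
      rw [← Fin.prod_univ_eq_prod_range (fun i => (x i : ℤ)) r] at hdv
      exact hdv
    · intro i hi hki
      have hXi := hX ⟨i, hi⟩ (by simp only; omega)
      refine ⟨B.P.filter (fun p => p ≠ 2 ∧ ∃ hp : p ∈ B.P, ((⟨i, hi⟩, ⟨p, hp⟩) : MrPIdx r B.P) ∈ 𝓜rP),
        Finset.filter_subset _ _,
        fun p => if hp : p ∈ B.P then iotaSign (a (Sum.inr (⟨i, hi⟩, ⟨p, hp⟩))) else 1, ?_, ?_, ?_⟩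
      · simp
      · intro p hp
        have hp' := (Finset.mem_filter.1 hp).1
        simp only [dif_pos hp']
        exact pb_iota _
      · intro p
        refine (hXi p).trans ?_
        constructor
        · rintro ⟨h1, h2, h3, h4, h5⟩
          refine ⟨h1, h2, h3, h4, ?_⟩
          intro p' hp'
          obtain ⟨g1, g2, g3, g4⟩ := Finset.mem_filter.1 hp'
          simp only [dif_pos g1]
          exact h5 _ g4 rfl
        · rintro ⟨h1, h2, h3, h4, h5⟩
          refine ⟨h1, h2, h3, h4, ?_⟩
          rintro ⟨qi, ⟨q, hq⟩⟩ hqM hqi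
          simp only at hqi
          subst hqi
          by_cases hq2 : q = 2
          · subst hq2
            obtain ⟨y, hy⟩ := hne i hi
            obtain ⟨_, y4, _, _, y5⟩ := (hXi y).1 hy
            have := y5 _ hqM rfl
            rw [← this]
            simp only
            rw [jacobiSym.mod_left (p:ℤ), jacobiSym.mod_left (y:ℤ)]
            congr 1
            omega
          · have := h5 q (Finset.mem_filter.2 ⟨hq, hq2, hq, hqM⟩)
            simp only [dif_pos hq] at this
            exact this
    · intro i hi'
      have := hi (i+1) (hIcc i hi')
      push_cast at this
      exact this
    · rw [Nat.sub_add_cancel hk1]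
      exact hii'
    · intro i hi'
      have := hiii (i+1) (hIcc i hi')
      push_cast at this
      exact this
    · intro hkr'
      exact lt_of_le_of_lt (le_max_left _ _) (hiv hkr'.ne)
    · intro i hi' j hj' hij
      apply hv' (i+1) (hIcc i hi') (j+1) (hIcc j hj')
      push_cast
      linarith
  set b : ℕ → ℕ → ℤ := fun i j => if h : ∃ (hi : i < r) (hj : j < r), i < j then
      iotaSign (a (Sum.inl ⟨(⟨i, h.choose⟩, ⟨j, h.choose_spec.choose⟩), h.choose_spec.choose_spec⟩)) else 1 with hb
  have hb1 : ∀ i j, b i j = 1 ∨ b i j = -1 := by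
    intro i j
    simp only [hb]
    split_ifs
    · exact pb_iota _
    · exact Or.inl rfl
  have hbe : ∀ (i j : ℕ) (hi : i < r) (hj : j < r) (hij : i < j),
      b i j = iotaSign (a (Sum.inl ⟨(⟨i, hi⟩, ⟨j, hj⟩), hij⟩)) := by
    intro i j hi hj hij
    simp only [hb]
    rw [dif_pos ⟨hi, hj, hij⟩]
  have hmainA := hA r k _ _ _ _ t hyp (pbM 𝓜r) b hb1
  have hset : preboxPoints B 𝓜r 𝓜rP a = pbset r (fun i => B.X (i+1))
      (fun i j x y => pbM 𝓜r i j → jacobiSym x y = b i j) := by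
    ext x
    simp only [preboxPoints, pbset, Set.mem_ofPred_eq]
    constructor
    · rintro ⟨h1, h2, h3⟩
      refine ⟨h1, ?_⟩
      intro i j hij hM
      obtain ⟨hi, hj, hij', hmem⟩ := hM
      rw [hbe i j hi hj hij']
      exact h2 _ hmem
    · rintro ⟨h1, h2⟩
      refine ⟨h1, ?_, ?_⟩
      · rintro ⟨⟨i, j⟩, hij⟩ hmem
        have := h2 i j hij ⟨i.2, j.2, hij, hmem⟩
        rw [hbe i j i.2 j.2 hij] at this
        exact this
      · rintro ⟨i, q⟩ hq
        have := (hX i (hqk _ hq) (x i)).1 (h1 i)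
        exact this.2.2.2.2 _ hq rfl
  rw [← pb_ncard, ← pbm_ncard, ← hset] at hmainA
  have hprod : ∏ i ∈ Finset.range r, ((B.X (i+1)).card : ℝ) = ∏ i ∈ Finset.Icc 1 r, ((B.X i).card : ℝ) := by
    rw [Finset.range_eq_Ico, Finset.prod_Ico_add' (fun i => ((B.X i).card : ℝ)) 0 r 1]
    rfl
  rw [hprod] at hmainA
  have hPr : 0 ≤ ∏ i ∈ Finset.Icc 1 r, ((B.X i).card : ℝ) := Finset.prod_nonneg (fun i _ => Nat.cast_nonneg _)
  set Pr := ∏ i ∈ Finset.Icc 1 r, ((B.X i).card : ℝ) with hPrd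
  have ht1 : 0 < B.t 1 := by have := htpos 0 (by omega); linarith
  have hp1 : 0 < B.t 1 ^ (c₈ + 1 / c₁) := Real.rpow_pos_of_pos ht1 _
  have hp2 : 0 < B.t 1 ^ c₈ := Real.rpow_pos_of_pos ht1 _
  constructor
  · refine hmainA.trans (le_of_eq ?_)
    rw [div_mul_div_comm]
  · rw [div_le_div_iff₀ (mul_pos hp1 (by positivity)) (mul_pos hp2 (by positivity))]
    have hrT : (r:ℝ) ≤ B.t 1 ^ (1 / c₁) := by
      have a2 := Real.rpow_le_rpow (Real.rpow_nonneg (Nat.cast_nonneg _) _) hii.le (show 0 ≤ 1 / c₁ by positivity)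
      rwa [← Real.rpow_mul (Nat.cast_nonneg _), mul_one_div_cancel hc₁.ne', Real.rpow_one] at a2
    rw [Real.rpow_add ht1]
    have h2n : (0:ℝ) ≤ 2 ^ 𝓜r.ncard := by positivity
    have := mul_le_mul_of_nonneg_right hrT (mul_nonneg hPr (mul_nonneg hp2.le h2n))
    linarith
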